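/- arXiv:math/0512143 — 2 statements merged into one kernel-verified Lean document; each statement's English description precedes it below -/
import Mathlib

section
/- Littlewood's theorem: the difference π(x) - li(x) changes sign infinitely often; that is, there exist arbitrarily large real x with π(x) > li(x) and arbitrarily large real x with π(x) < li(x). In particular Gauss's conjecture that π(x) < li(x) for all x is false. -/
/-- `π(x)`: the number of primes not exceeding the real number `x`. -/
noncomputable def primePi (x : ℝ) : ℝ :=
  ((Finset.range (⌊x⌋₊ + 1)).filter Nat.Prime).card

/-- The logarithmic integral `li(x) = ∫₂ˣ dt / log t`. -/
noncomputable def li (x : ℝ) : ℝ := ∫ t in (2:ℝ)..x, 1 / Real.log t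


open Finset in
lemma LW.folner (S : Finset ℝ) (η : ℝ) (hη : 0 < η) :
    ∃ A : Finset ℝ, A.Nonempty ∧ ∀ l ∈ S,
      (1 - η) * (A.card : ℝ) ≤ ((A.filter (fun x => x + l ∈ A)).card : ℝ) := by
  classical
  set B : ℕ → Finset (S → ℕ) := fun M => Fintype.piFinset (fun _ : S => Finset.range (M + 1)) with hB
  set A : ℕ → Finset ℝ := fun M => (B M).image (fun n => ∑ l : S, (n l : ℝ) * (l : ℝ)) with hA
  have hcard : ∀ M, (A M).card ≤ (M + 1) ^ S.card := by
    intro M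
    refine (Finset.card_image_le).trans ?_
    simp [hB, Fintype.card_piFinset]
  have hsub : ∀ M, A M ⊆ A (M + 1) := by
    intro M
    apply Finset.image_subset_image
    intro n hn
    simp only [hB, Fintype.mem_piFinset, Finset.mem_range] at hn ⊢
    intro a
    have := hn a
    omega
  have hshift : ∀ M, ∀ l ∈ S, ∀ x ∈ A M, x + l ∈ A (M + 1) := by
    intro M l hl x hx
    simp only [hA, Finset.mem_image] at hx ⊢
    obtain ⟨n, hn, rfl⟩ := hx
    refine ⟨n + Pi.single ⟨l, hl⟩ 1, ?_, ?_⟩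
    · simp only [hB, Fintype.mem_piFinset, Finset.mem_range] at hn ⊢
      intro a
      have := hn a
      by_cases h : a = ⟨l, hl⟩
      · subst h; simp; omega
      · simp [Pi.single_apply, h]; omega
    · simp only [Pi.add_apply, Nat.cast_add, add_mul, Finset.sum_add_distrib]
      congr 1
      rw [Finset.sum_eq_single (⟨l, hl⟩ : S)]
      · simp
      · intro b _ hb
        simp [Pi.single_apply, hb]
      · simp
  have hne : ∀ M, (A M).Nonempty := by
    intro M
    refine ⟨_, Finset.mem_image_of_mem _ (a := fun _ => 0) ?_⟩
    simp [hB]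
  have hex : ∃ M, ((A (M + 1)).card : ℝ) ≤ (1 + η) * (A M).card := by
    by_contra! hcon
    have hlow : ∀ M, (1 + η) ^ M ≤ ((A M).card : ℝ) := by
      intro M
      induction M with
      | zero =>
        have := Finset.card_pos.mpr (hne 0)
        simp only [pow_zero]
        exact_mod_cast this
      | succ k ih =>
        have := hcon k
        rw [pow_succ]
        nlinarith
    have hlim := tendsto_pow_const_div_const_pow_of_one_lt S.card (r := 1 + η) (by linarith)
    have hlim2 := (Filter.tendsto_add_atTop_iff_nat 1).mpr hlim
    have hev := (hlim2.eventually (gt_mem_nhds (show (0:ℝ) < 1 / (1 + η) by positivity))).exists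
    obtain ⟨M, hM⟩ := hev
    have h1 := hlow M
    have h2 : ((A M).card : ℝ) ≤ ((M + 1 : ℕ) : ℝ) ^ S.card := by exact_mod_cast hcard M
    rw [div_lt_div_iff₀ (by positivity) (by positivity), one_mul, pow_succ] at hM
    nlinarith
  obtain ⟨M, hM⟩ := hex
  refine ⟨A M, hne M, fun l hl => ?_⟩
  have h1 : ((A M).filter (fun x => ¬ (x + l ∈ A M))).card ≤ (A (M + 1) \ A M).card := by
    apply Finset.card_le_card_of_injOn (fun x => x + l)
    · intro x hx
      simp only [Finset.coe_filter, Set.mem_setOf_eq] at hx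
      simp only [Finset.coe_sdiff, Set.mem_diff, Finset.mem_coe]
      exact ⟨hshift M l hl x hx.1, hx.2⟩
    · intro x _ y _ h
      simpa using h
  have h2 := Finset.card_sdiff_add_card_eq_card (hsub M)
  have h3 := Finset.card_filter_add_card_filter_not (s := A M) (fun x => x + l ∈ A M)
  have h4 : ((A M).card : ℝ) + (A M).card ≤ ((A M).filter (fun x => x + l ∈ A M)).card + (A (M+1)).card := by
    exact_mod_cast (by omega)
  linarith

lemma LW.pair_ineq (f : ℝ → ℝ) (S : Finset ℝ) (hS : ∀ l, l ∉ S → 0 ≤ f l) (D : ℝ)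
    (h : ∀ A : Finset ℝ, A.Nonempty → ∑ x ∈ A, ∑ y ∈ A, f (x - y) ≤ D * A.card) :
    ∑ l ∈ S, f l ≤ D := by
  classical
  apply le_of_forall_pos_le_add
  intro e he
  set T := ∑ l ∈ S, |f l| with hT
  have hT0 : 0 ≤ T := Finset.sum_nonneg fun _ _ => abs_nonneg _
  obtain ⟨A, hA, hAS⟩ := LW.folner S (e / (T + 1)) (by positivity)
  have hpos : (0:ℝ) < A.card := by exact_mod_cast Finset.card_pos.mpr hA
  have h1 := h A hA
  have h2 : ∑ l ∈ S, f l * ((A.filter (fun x => x + l ∈ A)).card : ℝ) ≤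
      ∑ x ∈ A, ∑ y ∈ A, f (x - y) := by
    have e1 : ∑ l ∈ S, f l * ((A.filter (fun x => x + l ∈ A)).card : ℝ) =
        ∑ y ∈ A, ∑ l ∈ S, if y + l ∈ A then f l else 0 := by
      rw [Finset.sum_comm]
      refine Finset.sum_congr rfl fun l _ => ?_
      rw [← Finset.sum_filter, Finset.sum_const, nsmul_eq_mul, mul_comm]
    rw [e1, Finset.sum_comm (s := A) (t := A)]
    refine Finset.sum_le_sum fun y hy => ?_
    rw [← Finset.sum_filter]
    have e2 : ∑ l ∈ S.filter (fun l => y + l ∈ A), f l =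
        ∑ x ∈ A.filter (fun x => x - y ∈ S), f (x - y) := by
      refine Finset.sum_bij' (fun l _ => y + l) (fun x _ => x - y) ?_ ?_ ?_ ?_ ?_ <;>
        simp +contextual
    rw [e2]
    refine Finset.sum_le_sum_of_subset_of_nonneg (Finset.filter_subset _ _) ?_
    intro x hx hx2
    apply hS
    intro hc
    exact hx2 (Finset.mem_filter.mpr ⟨hx, hc⟩)
  have h3 : ∑ l ∈ S, (f l - e / (T + 1) * |f l|) * (A.card : ℝ) ≤
      ∑ l ∈ S, f l * ((A.filter (fun x => x + l ∈ A)).card : ℝ) := by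
    refine Finset.sum_le_sum fun l hl => ?_
    have a1 := hAS l hl
    have a2 : ((A.filter (fun x => x + l ∈ A)).card : ℝ) ≤ A.card := by
      exact_mod_cast Finset.card_filter_le _ _
    have hq : 0 < e / (T + 1) := by positivity
    rcases le_total 0 (f l) with h0 | h0
    · rw [abs_of_nonneg h0]; nlinarith
    · rw [abs_of_nonpos h0]
      nlinarith [mul_nonneg (mul_nonneg hq.le (neg_nonneg.mpr h0)) hpos.le]
  rw [← Finset.sum_mul, Finset.sum_sub_distrib, ← Finset.mul_sum] at h3
  have h4 := h3.trans (h2.trans h1)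
  have h5 := le_of_mul_le_mul_right h4 hpos
  have h6 : e / (T + 1) * T ≤ e := by
    rw [div_mul_eq_mul_div, div_le_iff₀ (by positivity)]; nlinarith
  linarith


open MeasureTheory in
lemma LW.kernel_nonneg (a d : ℝ) (ha : 0 < a) (A : Finset ℝ) (u : ℝ) :
    0 ≤ (∑ x ∈ A, ∑ y ∈ A, (1 / ((a : ℂ) + Complex.I * d * ((x - y : ℝ) : ℂ))) *
      Complex.exp (-(Complex.I * ((x - y : ℝ) : ℂ)) * u)).re := by
  have hre : ∀ x y : ℝ, (-((a : ℂ) + Complex.I * d * ((x - y : ℝ) : ℂ))).re < 0 := by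
    intro x y; simp; linarith
  have hint : ∀ x y : ℝ, IntegrableOn (fun v : ℝ => Complex.exp (-((a : ℂ) + Complex.I * d * ((x - y : ℝ) : ℂ)) * v) * Complex.exp (-(Complex.I * ((x - y : ℝ) : ℂ)) * u)) (Set.Ioi 0) := by
    intro x y
    exact (integrableOn_exp_mul_complex_Ioi (hre x y) 0).mul_const _
  have hval : ∀ x y : ℝ, (1 / ((a : ℂ) + Complex.I * d * ((x - y : ℝ) : ℂ))) *
      Complex.exp (-(Complex.I * ((x - y : ℝ) : ℂ)) * u) =
      ∫ v in Set.Ioi (0:ℝ), Complex.exp (-((a : ℂ) + Complex.I * d * ((x - y : ℝ) : ℂ)) * v) * Complex.exp (-(Complex.I * ((x - y : ℝ) : ℂ)) * u) := by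
    intro x y
    rw [MeasureTheory.integral_mul_const, integral_exp_mul_complex_Ioi (hre x y) 0]
    simp only [Complex.ofReal_zero, mul_zero, Complex.exp_zero]
    congr 1
    rw [neg_div_neg_eq]
  simp_rw [hval]
  simp_rw [← MeasureTheory.integral_finsetSum A (fun y _ => hint _ y)]
  rw [← MeasureTheory.integral_finsetSum A (fun x _ => MeasureTheory.integrable_finsetSum A (fun y _ => hint x y))]
  have hI := MeasureTheory.integrable_finsetSum A (fun x _ => MeasureTheory.integrable_finsetSum A (fun y _ => hint x y))
  rw [← RCLike.re_eq_complex_re, ← integral_re hI]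
  refine MeasureTheory.integral_nonneg fun v => ?_
  set c : ℝ → ℂ := fun x => Complex.exp (-(Complex.I * x) * (u + d * v)) with hc
  have key : (∑ x ∈ A, ∑ y ∈ A, Complex.exp (-((a : ℂ) + Complex.I * d * ((x - y : ℝ) : ℂ)) * v) * Complex.exp (-(Complex.I * ((x - y : ℝ) : ℂ)) * u))
      = ((Real.exp (-a * v) * Complex.normSq (∑ x ∈ A, c x) : ℝ) : ℂ) := by
    push_cast
    rw [Complex.normSq_eq_conj_mul_self, map_sum, Finset.sum_mul_sum, Finset.mul_sum, Finset.sum_comm]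
    refine Finset.sum_congr rfl fun x _ => ?_
    rw [Finset.mul_sum]
    refine Finset.sum_congr rfl fun y _ => ?_
    simp only [hc, ← Complex.exp_conj, ← Complex.exp_add]
    congr 1
    simp
    ring
  simp only [key, RCLike.re_eq_complex_re, Complex.ofReal_re]
  exact mul_nonneg (Real.exp_pos _).le (Complex.normSq_nonneg _)

open Filter Topology in
lemma LW.loglim (v r : ℝ → ℂ) (m : ℂ) (δ B : ℝ) (hδ : 0 < δ)
    (hv : ∀ t ∈ Set.Ioo 0 δ, HasDerivAt v (m / t + r t) t)
    (hr : ∀ t ∈ Set.Ioo 0 δ, ‖r t‖ ≤ B) :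
    Tendsto (fun t : ℝ => v t / (Real.log (1 / t) : ℂ)) (𝓝[>] 0) (𝓝 (-m)) := by
  set w : ℝ → ℂ := fun t => v t - m * (Real.log t : ℂ) with hw
  have hwd : ∀ t ∈ Set.Ioo 0 δ, HasDerivAt w (r t) t := by
    intro t ht
    have h1 := (Real.hasDerivAt_log ht.1.ne').ofReal_comp.const_mul m
    have := (hv t ht).sub h1
    refine this.congr_deriv ?_
    push_cast
    ring
  have hmid : δ / 2 ∈ Set.Ioo 0 δ := ⟨by linarith, by linarith⟩
  have hB : ∀ t ∈ Set.Ioo 0 δ, ‖w t‖ ≤ ‖w (δ/2)‖ + B * δ := by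
    intro t ht
    have := (convex_Ioo 0 δ).norm_image_sub_le_of_norm_hasDerivWithin_le
      (fun x hx => (hwd x hx).hasDerivWithinAt) hr hmid ht
    have h2 : ‖t - δ/2‖ ≤ δ := by
      rw [Real.norm_eq_abs, abs_le]; constructor <;> linarith [ht.1, ht.2]
    have h3 : 0 ≤ B := (norm_nonneg _).trans (hr _ hmid)
    have h4 := norm_sub_norm_le (w t) (w (δ/2))
    nlinarith
  have hlog : Tendsto (fun t : ℝ => Real.log (1 / t)) (𝓝[>] 0) atTop := by
    simp only [one_div, Real.log_inv]
    exact tendsto_neg_atBot_atTop.comp Real.tendsto_log_nhdsGT_zero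
  have hz : Tendsto (fun t : ℝ => w t / (Real.log (1 / t) : ℂ)) (𝓝[>] 0) (𝓝 0) := by
    rw [tendsto_zero_iff_norm_tendsto_zero]
    have hlim : Tendsto (fun t : ℝ => (‖w (δ/2)‖ + B * δ) / Real.log (1/t)) (𝓝[>] 0) (𝓝 0) :=
      hlog.const_div_atTop _
    refine squeeze_zero' (Eventually.of_forall fun t => norm_nonneg _) ?_ hlim
    filter_upwards [hlog.eventually_gt_atTop 0, Ioo_mem_nhdsGT hδ] with t h1 h2
    rw [norm_div, Complex.norm_real, Real.norm_eq_abs, abs_of_pos h1]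
    gcongr
    exact hB t h2
  have := hz.add_const (-m)
  rw [zero_add] at this
  refine this.congr' ?_
  filter_upwards [hlog.eventually_gt_atTop 0, Ioo_mem_nhdsGT hδ] with t h1 h2
  have hne : (Real.log (1 / t) : ℂ) ≠ 0 := by exact_mod_cast h1.ne'
  have : (Real.log t : ℂ) = -(Real.log (1/t) : ℂ) := by
    rw [one_div, Real.log_inv]; push_cast; ring
  simp only [hw, this]
  field_simp
  ring


open MeasureTheory ProbabilityTheory Filter Topology in
lemma LW.landau {Ω : Type*} [MeasurableSpace Ω] (μ : Measure Ω) (X : Ω → ℝ)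
    (hX : AEMeasurable X μ) (hX0 : 0 ≤ᵐ[μ] X) (G : ℂ → ℂ) (b t0 : ℝ)
    (hG : ∀ t : ℝ, t < b → AnalyticAt ℂ G t)
    (hI : ∀ t < t0, t ∈ integrableExpSet X μ)
    (hEq : ∀ t < t0, complexMGF X μ (t : ℂ) = G t) :
    ∀ t < b, t ∈ integrableExpSet X μ := by
  by_contra! hcon
  obtain ⟨t1, ht1b, ht1⟩ := hcon
  have hmono : ∀ s ∈ integrableExpSet X μ, ∀ t ≤ s, t ∈ integrableExpSet X μ := by
    intro s hs t hts
    refine Integrable.mono hs ?_ ?_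
    · exact (Real.measurable_exp.comp_aemeasurable (hX.const_mul t)).aestronglyMeasurable
    · filter_upwards [hX0] with ω hω
      simp only [Real.norm_eq_abs, Real.abs_exp]
      exact Real.exp_le_exp.mpr (mul_le_mul_of_nonneg_right hts hω)
  set T := integrableExpSet X μ with hT
  have hub : ∀ t ∈ T, t ≤ t1 := by
    intro t ht
    by_contra! h
    exact ht1 (hmono t ht t1 h.le)
  have hne : T.Nonempty := ⟨t0 - 1, hI _ (by linarith)⟩
  have hbdd : BddAbove T := ⟨t1, hub⟩
  set c := sSup T with hc
  have hc1 : c ≤ t1 := csSup_le hne hub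
  have hlt : ∀ t < c, t ∈ T := by
    intro t ht
    obtain ⟨s, hs, hts⟩ := exists_lt_of_lt_csSup hne ht
    exact hmono s hs t hts.le
  have hint : ∀ t < c, t ∈ interior T := by
    intro t ht
    exact mem_interior.mpr ⟨Set.Iio c, fun x hx => hlt x hx, isOpen_Iio, ht⟩
  have ht0c : t0 ≤ c := by
    by_contra! h
    have h1 := hI ((c + t0)/2) (by linarith)
    have := le_csSup hbdd h1
    linarith
  -- real identity theorem
  have hreal : ∀ t < c, complexMGF X μ (t : ℂ) = G t := by
    have hA1 : AnalyticOnNhd ℝ (fun t : ℝ => complexMGF X μ (t : ℂ)) (Set.Iio c) := by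
      intro t ht
      have h1 : AnalyticAt ℂ (complexMGF X μ) (t : ℂ) :=
        analyticAt_complexMGF (by simpa using hint t ht)
      exact (h1.restrictScalars (𝕜 := ℝ)).comp (Complex.ofRealCLM.analyticAt t)
    have hA2 : AnalyticOnNhd ℝ (fun t : ℝ => G (t : ℂ)) (Set.Iio c) := by
      intro t ht
      have h1 : AnalyticAt ℂ G (t : ℂ) := hG t (by have : t < c := ht; linarith)
      exact (h1.restrictScalars (𝕜 := ℝ)).comp (Complex.ofRealCLM.analyticAt t)
    have := hA1.eqOn_of_preconnected_of_eventuallyEq hA2 isPreconnected_Iio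
      (z₀ := t0 - 1) (by simp; linarith)
      (by filter_upwards [Iio_mem_nhds (show t0 - 1 < t0 by linarith)] with t ht; exact hEq t ht)
    intro t ht
    exact this ht
  -- differentiability on ball
  have hGc := hG c (by linarith)
  obtain ⟨r, hr0, hr⟩ := Metric.eventually_nhds_iff_ball.mp hGc.eventually_analyticAt
  set δ := r / 4 with hδ
  have hδ0 : 0 < δ := by positivity
  set s : ℝ := c - δ with hs
  have hsc : s < c := by linarith
  have hball : Metric.ball (s : ℂ) (3 * δ) ⊆ Metric.ball (c : ℂ) r := by
    apply Metric.ball_subset_ball'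
    rw [Complex.dist_eq, ← Complex.ofReal_sub, Complex.norm_real, Real.norm_eq_abs, hs]
    rw [show c - δ - c = -δ by ring, abs_neg, abs_of_pos hδ0]
    linarith
  have hdiff : DifferentiableOn ℂ G (Metric.ball (s : ℂ) (3 * δ)) := fun z hz =>
    (hr z (hball hz)).differentiableAt.differentiableWithinAt
  have hev : G =ᶠ[𝓝 (s : ℂ)] complexMGF X μ := by
    have h1 : AnalyticAt ℂ (complexMGF X μ) (s : ℂ) :=
      analyticAt_complexMGF (by simpa using hint s hsc)
    refine ((hG s (by linarith)).frequently_eq_iff_eventually_eq h1).mp ?_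
    have : Tendsto (fun t : ℝ => (t : ℂ)) (𝓝[≠] s) (𝓝[≠] (s : ℂ)) := by
      refine tendsto_nhdsWithin_of_tendsto_nhds_of_eventually_within _ ?_ ?_
      · exact (Complex.continuous_ofReal.tendsto s).mono_left nhdsWithin_le_nhds
      · filter_upwards [self_mem_nhdsWithin] with t ht
        simpa using ht
    refine this.frequently (Eventually.frequently ?_)
    filter_upwards [nhdsWithin_le_nhds (Iio_mem_nhds hsc)] with t ht
    exact (hreal t ht).symm
  have hder : ∀ n, iteratedDeriv n G (s : ℂ) = ((∫ ω, X ω ^ n * Real.exp (s * X ω) ∂μ : ℝ) : ℂ) := by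
    intro n
    rw [Filter.EventuallyEq.iteratedDeriv_eq n hev, iteratedDeriv_complexMGF (by simpa using hint s hsc),
      ← integral_complex_ofReal]
    congr 1
    ext ω
    push_cast
    rfl
  have hsum := Complex.hasSum_taylorSeries_on_ball hdiff (z := ((s + 2 * δ : ℝ) : ℂ)) (by
    rw [Metric.mem_ball, Complex.dist_eq, ← Complex.ofReal_sub, Complex.norm_real, Real.norm_eq_abs]
    rw [show s + 2 * δ - s = 2 * δ by ring, abs_of_pos (by linarith)]
    linarith)
  have hsumr : Summable (fun n : ℕ => ∫ ω, ((2 * δ) ^ n / n.factorial * (X ω ^ n * Real.exp (s * X ω))) ∂μ) := by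
    have := hsum.summable
    rw [← Complex.summable_ofReal]
    refine this.congr fun n => ?_
    rw [hder n, integral_const_mul]
    push_cast
    simp only [smul_eq_mul]
    ring
  have hintn : ∀ n : ℕ, Integrable (fun ω => (2 * δ) ^ n / n.factorial * (X ω ^ n * Real.exp (s * X ω))) μ := by
    intro n
    exact (integrable_pow_mul_exp_of_mem_interior_integrableExpSet (hint s hsc) n).const_mul _
  have hfin : s + 2 * δ ∈ T := by
    have hnn : ∀ n : ℕ, 0 ≤ᵐ[μ] (fun ω => (2 * δ) ^ n / n.factorial * (X ω ^ n * Real.exp (s * X ω))) := by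
      intro n
      filter_upwards [hX0] with ω hω
      have : 0 ≤ X ω := hω
      simp only [Pi.zero_apply]
      positivity
    refine ⟨(Real.measurable_exp.comp_aemeasurable (hX.const_mul _)).aestronglyMeasurable, ?_⟩
    rw [hasFiniteIntegral_iff_ofReal (Eventually.of_forall fun ω => (Real.exp_pos _).le)]
    have e1 : ∫⁻ ω, ENNReal.ofReal (Real.exp ((s + 2 * δ) * X ω)) ∂μ =
        ∫⁻ ω, ∑' n : ℕ, ENNReal.ofReal ((2 * δ) ^ n / n.factorial * (X ω ^ n * Real.exp (s * X ω))) ∂μ := by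
      apply lintegral_congr_ae
      filter_upwards [hX0] with ω hω
      have hω' : 0 ≤ X ω := hω
      have h1 : HasSum (fun n : ℕ => (2 * δ) ^ n / n.factorial * (X ω ^ n * Real.exp (s * X ω)))
          (Real.exp ((s + 2 * δ) * X ω)) := by
        have h2 := NormedSpace.expSeries_div_hasSum_exp (2 * δ * X ω)
        rw [← Real.exp_eq_exp_ℝ] at h2
        have h3 := h2.mul_right (Real.exp (s * X ω))
        rw [← Real.exp_add] at h3
        rw [show (s + 2 * δ) * X ω = 2 * δ * X ω + s * X ω by ring]
        have h4 : (fun n : ℕ => (2 * δ) ^ n / n.factorial * (X ω ^ n * Real.exp (s * X ω))) =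
            fun n : ℕ => (2 * δ * X ω) ^ n / n.factorial * Real.exp (s * X ω) := by
          ext n
          rw [mul_pow]; ring
        rw [h4]
        exact h3
      rw [← h1.tsum_eq, ENNReal.ofReal_tsum_of_nonneg (fun n => by positivity) h1.summable]
    rw [e1, lintegral_tsum (fun n => (hintn n).aestronglyMeasurable.aemeasurable.ennreal_ofReal)]
    have e2 : ∀ n : ℕ, ∫⁻ ω, ENNReal.ofReal ((2 * δ) ^ n / n.factorial * (X ω ^ n * Real.exp (s * X ω))) ∂μ
        = ENNReal.ofReal (∫ ω, ((2 * δ) ^ n / n.factorial * (X ω ^ n * Real.exp (s * X ω))) ∂μ) := by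
      intro n
      rw [ofReal_integral_eq_lintegral_ofReal (hintn n) (hnn n)]
    simp_rw [e2]
    exact hsumr.tsum_ofReal_lt_top
  have := le_csSup hbdd hfin
  linarith


open MeasureTheory ProbabilityTheory Filter Topology

noncomputable def LW.nu (w : ℝ → ℝ) (c : ℝ) : Measure ℝ :=
  (volume.restrict (Set.Ioi c)).withDensity (fun x => ENNReal.ofReal (w x))

lemma LW.nu_ae {w : ℝ → ℝ} {c : ℝ} {p : ℝ → Prop} (h : ∀ x, c < x → p x) :
    ∀ᵐ x ∂(LW.nu w c), p x := by
  apply (withDensity_absolutelyContinuous _ _).ae_le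
  exact (ae_restrict_mem measurableSet_Ioi).mono fun x hx => h x hx

lemma LW.nu_integral {w : ℝ → ℝ} {c : ℝ} (hw : Measurable w) (hpos : ∀ x, c < x → 0 ≤ w x)
    (g : ℝ → ℂ) : ∫ x, g x ∂(LW.nu w c) = ∫ x in Set.Ioi c, (w x : ℂ) * g x := by
  rw [LW.nu, integral_withDensity_eq_integral_toReal_smul hw.ennreal_ofReal (by simp)]
  refine setIntegral_congr_fun measurableSet_Ioi fun x hx => ?_
  simp [ENNReal.toReal_ofReal (hpos x hx)]

lemma LW.nu_integrable {w : ℝ → ℝ} {c : ℝ} (hw : Measurable w) (hpos : ∀ x, c < x → 0 ≤ w x)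
    (g : ℝ → ℝ) : Integrable g (LW.nu w c) ↔ IntegrableOn (fun x => w x * g x) (Set.Ioi c) := by
  rw [LW.nu, integrable_withDensity_iff_integrable_smul' hw.ennreal_ofReal (by simp)]
  refine integrableOn_congr_fun (fun x hx => ?_) measurableSet_Ioi
  simp [ENNReal.toReal_ofReal (hpos x hx)]

lemma LW.nu_mem {w : ℝ → ℝ} {c : ℝ} (hw : Measurable w) (hc : 0 ≤ c)
    (hpos : ∀ x, c < x → 0 ≤ w x) (t : ℝ) :
    t ∈ integrableExpSet Real.log (LW.nu w c) ↔ IntegrableOn (fun x => w x * x ^ t) (Set.Ioi c) := by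
  rw [integrableExpSet, Set.mem_ofPred_eq, LW.nu_integrable hw hpos]
  refine integrableOn_congr_fun (fun x hx => ?_) measurableSet_Ioi
  have : 0 < x := lt_of_le_of_lt hc hx
  rw [Real.rpow_def_of_pos this, mul_comm t]

lemma LW.nu_cmgf {w : ℝ → ℝ} {c : ℝ} (hw : Measurable w) (hc : 0 ≤ c)
    (hpos : ∀ x, c < x → 0 ≤ w x) (z : ℂ) :
    complexMGF Real.log (LW.nu w c) z = ∫ x in Set.Ioi c, (w x : ℂ) * (x : ℂ) ^ z := by
  rw [complexMGF, LW.nu_integral hw hpos]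
  refine setIntegral_congr_fun measurableSet_Ioi fun x hx => ?_
  have : 0 < x := lt_of_le_of_lt hc hx
  rw [Complex.cpow_def_of_ne_zero (by exact_mod_cast this.ne'), ← Complex.ofReal_log this.le, mul_comm z]

lemma LW.nu_bound {w : ℝ → ℝ} {c : ℝ} (hw : Measurable w) (hc : 0 < c)
    (hpos : ∀ x, c < x → 0 ≤ w x) (K p : ℝ) (hK : ∀ x, c < x → w x ≤ K * x ^ p) (t : ℝ)
    (ht : t + p < -1) : t ∈ integrableExpSet Real.log (LW.nu w c) := by
  rw [LW.nu_mem hw hc.le hpos]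
  have h1 := (integrableOn_Ioi_rpow_of_lt ht hc).const_mul K
  refine Integrable.mono h1 ?_ ?_
  · exact (hw.mul (measurable_id.pow_const t)).aestronglyMeasurable
  · refine (ae_restrict_mem measurableSet_Ioi).mono fun x hx => ?_
    have hx0 : 0 < x := hc.trans hx
    have a1 := hpos x hx
    have a2 := hK x hx
    have a3 : 0 < x ^ t := Real.rpow_pos_of_pos hx0 t
    have a4 : 0 < x ^ p := Real.rpow_pos_of_pos hx0 p
    rw [Real.norm_eq_abs, abs_of_nonneg (by positivity), Real.norm_eq_abs]
    refine le_trans ?_ (le_abs_self _)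
    rw [Real.rpow_add hx0]
    nlinarith

lemma LW.interior_of_lt {Ω : Type*} [MeasurableSpace Ω] {μ : Measure Ω} {X : Ω → ℝ} {b : ℝ}
    (h : ∀ t < b, t ∈ integrableExpSet X μ) {z : ℂ} (hz : z.re < b) :
    z.re ∈ interior (integrableExpSet X μ) :=
  mem_interior.mpr ⟨Set.Iio b, fun x hx => h x hx, isOpen_Iio, hz⟩

/-- half-plane -/
lemma LW.halfplane_preconn (a : ℝ) : IsPreconnected {s : ℂ | a < s.re} :=
  (convex_halfSpace_re_gt a).isPreconnected

lemma LW.halfplane_open (a : ℝ) : IsOpen {s : ℂ | a < s.re} :=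
  isOpen_lt continuous_const Complex.continuous_re

/-- identity theorem on right half planes -/
lemma LW.ident {f g : ℂ → ℂ} {a b : ℝ} (hf : DifferentiableOn ℂ f {s | a < s.re})
    (hg : DifferentiableOn ℂ g {s | a < s.re}) (h : ∀ s : ℂ, b < s.re → f s = g s) :
    ∀ s : ℂ, a < s.re → f s = g s := by
  have h1 := (hf.analyticOnNhd (LW.halfplane_open a)).eqOn_of_preconnected_of_eventuallyEq
    (hg.analyticOnNhd (LW.halfplane_open a)) (LW.halfplane_preconn a)
    (z₀ := ((max a b + 1 : ℝ) : ℂ)) (by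
      simp only [Set.mem_ofPred_eq, Complex.ofReal_re]
      linarith [le_max_left a b]) (by
      filter_upwards [(LW.halfplane_open b).mem_nhds (show ((max a b + 1 : ℝ) : ℂ) ∈ {s : ℂ | b < s.re} by
        simp only [Set.mem_ofPred_eq, Complex.ofReal_re]
        linarith [le_max_right a b])] with s hs
      exact h s hs)
  intro s hs
  exact h1 hs

/-- fractional part transform -/
noncomputable def LW.wfr (x : ℝ) : ℝ := Int.fract x / x

lemma LW.wfr_meas : Measurable LW.wfr := measurable_fract.div measurable_id

lemma LW.wfr_pos : ∀ x, (1:ℝ) < x → 0 ≤ LW.wfr x := fun x hx => by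
  have := Int.fract_nonneg x
  unfold LW.wfr
  positivity

lemma LW.wfr_mem : ∀ t < (0:ℝ), t ∈ integrableExpSet Real.log (LW.nu LW.wfr 1) := by
  intro t ht
  refine LW.nu_bound LW.wfr_meas one_pos LW.wfr_pos 1 (-1) ?_ t (by linarith)
  intro x hx
  rw [one_mul, Real.rpow_neg_one, LW.wfr, div_eq_mul_inv]
  have := (Int.fract_lt_one x).le
  have : 0 < x⁻¹ := by positivity
  nlinarith

lemma LW.zeta1_formula : ∀ s : ℂ, 0 < s.re →
    riemannZeta₁ s = s - s * (s - 1) * complexMGF Real.log (LW.nu LW.wfr 1) (-s) := by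
  apply LW.ident (b := 1)
  · exact differentiable_riemannZeta₁.differentiableOn
  · intro s hs
    have : DifferentiableAt ℂ (complexMGF Real.log (LW.nu LW.wfr 1)) (-s) :=
      (hasDerivAt_complexMGF (LW.interior_of_lt LW.wfr_mem (by simpa using hs))).differentiableAt
    have h2 : DifferentiableAt ℂ (fun s => complexMGF Real.log (LW.nu LW.wfr 1) (-s)) s :=
      DifferentiableAt.comp s (f := fun s => -s) this differentiableAt_id.neg
    exact (differentiableAt_id.sub ((differentiableAt_id.mul (differentiableAt_id.sub_const 1)).mul h2)).differentiableWithinAt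
  · intro s hs
    have hs1 : s ≠ 1 := by rintro rfl; simp at hs
    have hs0 : s ≠ 0 := by rintro rfl; simp at hs; linarith
    have hz : riemannZeta₁ s = (s - 1) * riemannZeta s := by
      rw [riemannZeta_eq_inv_sub_mul hs1]
      field_simp [sub_ne_zero.mpr hs1]
    have hL := LSeries_eq_mul_integral_of_nonneg (fun _ => (1:ℝ)) zero_le_one (s := s) hs
      (by simpa using Asymptotics.isBigO_refl _ _) (fun _ => zero_le_one)
    have hL2 : riemannZeta s = LSeries (fun n => (((fun _ => (1:ℝ)) n : ℝ) : ℂ)) s := by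
      rw [← LSeries_one_eq_riemannZeta hs]
      congr 1
    rw [hz, hL2, hL, LW.nu_cmgf LW.wfr_meas zero_le_one LW.wfr_pos]
    have i1 : ∫ t in Set.Ioi (1:ℝ), (t : ℂ) ^ (-s) = 1 / (s - 1) := by
      rw [integral_Ioi_cpow_of_lt (by simpa using hs) one_pos]
      simp
      rw [show -s + 1 = -(s-1) by ring, neg_div_neg_eq, one_div]
    have g1 : IntegrableOn (fun t : ℝ => (t : ℂ) ^ (-s)) (Set.Ioi 1) :=
      integrableOn_Ioi_cpow_of_lt (by simpa using hs) one_pos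
    have g2 : IntegrableOn (fun t : ℝ => (LW.wfr t : ℂ) * (t : ℂ) ^ (-s)) (Set.Ioi 1) := by
      have hh : IntegrableOn (fun t : ℝ => ((LW.wfr t * t ^ (-s.re) : ℝ))) (Set.Ioi 1) :=
        (LW.nu_mem LW.wfr_meas zero_le_one LW.wfr_pos _).mp (LW.wfr_mem (-s.re) (by linarith))
      refine Integrable.mono hh ?_ ?_
      · exact ((Complex.measurable_ofReal.comp LW.wfr_meas).mul (by fun_prop)).aestronglyMeasurable
      · refine (ae_restrict_mem measurableSet_Ioi).mono fun x hx => ?_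
        have hx0 : (0:ℝ) < x := lt_trans one_pos hx
        rw [norm_mul, norm_mul, Complex.norm_cpow_eq_rpow_re_of_pos hx0, Complex.norm_real,
          Real.norm_eq_abs (x ^ _), abs_of_pos (Real.rpow_pos_of_pos hx0 _), Complex.neg_re]
    have i2 : ∫ t in Set.Ioi (1:ℝ), (∑ k ∈ Finset.Icc 1 ⌊t⌋₊, (((1:ℝ) : ℝ) : ℂ)) * (t : ℂ) ^ (-(s + 1))
        = 1 / (s - 1) - ∫ t in Set.Ioi (1:ℝ), (LW.wfr t : ℂ) * (t : ℂ) ^ (-s) := by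
      rw [← i1, ← integral_sub g1 g2]
      refine setIntegral_congr_fun measurableSet_Ioi fun x hx => ?_
      have hx0 : (0:ℝ) < x := lt_trans one_pos hx
      have hx0' : (x : ℂ) ≠ 0 := by exact_mod_cast hx0.ne'
      have e1 : ((⌊x⌋₊ : ℝ)) = x - Int.fract x := by
        rw [natCast_floor_eq_intCast_floor hx0.le]
        linarith [Int.floor_add_fract x]
      have e2 : ((⌊x⌋₊ : ℂ)) = x - (Int.fract x : ℝ) := by
        exact_mod_cast congrArg (fun y : ℝ => (y : ℂ)) e1
      simp only [Complex.ofReal_one, Finset.sum_const, Nat.card_Icc, add_tsub_cancel_right, nsmul_eq_mul, mul_one]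
      rw [e2, show -(s + 1) = -s - 1 by ring, Complex.cpow_sub _ _ hx0', LW.wfr]
      push_cast
      rw [Complex.cpow_one]
      field_simp
    rw [i2]
    have : s - 1 ≠ 0 := sub_ne_zero.mpr hs1
    field_simp

lemma LW.zeta1_slit (σ : ℝ) (h : 0 < σ) : riemannZeta₁ σ ∈ Complex.slitPlane := by
  rcases lt_trichotomy σ 1 with h1 | h1 | h1
  · rw [LW.zeta1_formula σ (by simpa using h)]
    rw [← Complex.ofReal_neg, complexMGF_ofReal]
    rw [Complex.mem_slitPlane_iff]
    left
    have : (σ : ℂ) - σ * (σ - 1) * (mgf Real.log (LW.nu LW.wfr 1) (-σ) : ℝ) =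
      ((σ - σ * (σ - 1) * mgf Real.log (LW.nu LW.wfr 1) (-σ) : ℝ) : ℂ) := by push_cast; ring
    rw [this, Complex.ofReal_re]
    have hm : 0 ≤ mgf Real.log (LW.nu LW.wfr 1) (-σ) := mgf_nonneg
    nlinarith [mul_nonneg (mul_nonneg h.le (sub_nonneg.mpr h1.le)) hm]
  · rw [h1]; simp [riemannZeta₁_one]
  · have h2 : riemannZeta₁ σ = (σ - 1) * riemannZeta σ := by
      have : (σ : ℂ) ≠ 1 := by exact_mod_cast h1.ne'
      rw [riemannZeta_eq_inv_sub_mul this]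
      field_simp [sub_ne_zero.mpr this]
    have h3 := Complex.pos_iff.mp (riemannZeta_pos_of_one_lt h1)
    rw [h2, Complex.mem_slitPlane_iff]
    left
    rw [← Complex.ofReal_one, ← Complex.ofReal_sub, Complex.re_ofReal_mul]
    exact mul_pos (by linarith) h3.1


open MeasureTheory ProbabilityTheory Filter Topology

noncomputable def LW.wE (x : ℝ) : ℝ := 1 / Real.log (max x 2)

lemma LW.wE_cont : Continuous LW.wE := by
  unfold LW.wE
  refine continuous_const.div ((continuous_id.max continuous_const).log fun x => ?_) fun x => ?_
  · have : (2:ℝ) ≤ max (id x) 2 := le_max_right _ _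
    linarith
  · have : (2:ℝ) ≤ max x 2 := le_max_right _ _
    exact (Real.log_pos (by linarith)).ne'

lemma LW.wE_pos (x : ℝ) : 0 < LW.wE x := by
  have : (2:ℝ) ≤ max x 2 := le_max_right _ _
  exact one_div_pos.mpr (Real.log_pos (by linarith))

lemma LW.wE_le (x : ℝ) : LW.wE x ≤ 2 := by
  have h : (2:ℝ) ≤ max x 2 := le_max_right _ _
  have h1 : Real.log 2 ≤ Real.log (max x 2) := Real.log_le_log (by norm_num) h
  have h2 := Real.log_two_gt_d9
  rw [LW.wE, div_le_iff₀ (by linarith)]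
  linarith

lemma LW.wE_eq {x : ℝ} (hx : 2 ≤ x) : LW.wE x = 1 / Real.log x := by rw [LW.wE, max_eq_left hx]

lemma LW.wE_mem : ∀ t < (-1:ℝ), t ∈ integrableExpSet Real.log (LW.nu LW.wE 2) := by
  intro t ht
  refine LW.nu_bound LW.wE_cont.measurable two_pos (fun x _ => (LW.wE_pos x).le) 2 0 ?_ t (by linarith)
  intro x hx
  simpa using LW.wE_le x

noncomputable def LW.E1 (s : ℂ) : ℂ := complexMGF Real.log (LW.nu LW.wE 2) (-s)

lemma LW.E1_eq (s : ℂ) : LW.E1 s = ∫ x in Set.Ioi (2:ℝ), (LW.wE x : ℂ) * (x : ℂ) ^ (-s) :=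
  LW.nu_cmgf LW.wE_cont.measurable zero_le_two (fun x _ => (LW.wE_pos x).le) _

lemma LW.cmgf_neg_hasDerivAt {μ : Measure ℝ} {X : ℝ → ℝ} {b : ℝ}
    (h : ∀ t < b, t ∈ integrableExpSet X μ) {s : ℂ} (hs : -b < s.re) :
    HasDerivAt (fun s => complexMGF X μ (-s)) (- ∫ x, X x * Complex.exp (-s * X x) ∂μ) s := by
  have h1 : HasDerivAt (complexMGF X μ) _ (-s) :=
    hasDerivAt_complexMGF (LW.interior_of_lt h (by simp; linarith))
  have h2 := h1.comp s (hasDerivAt_id s).neg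
  refine h2.congr_deriv ?_
  ring

lemma LW.E1_hasDerivAt {s : ℂ} (hs : 1 < s.re) :
    HasDerivAt LW.E1 (-((2:ℂ) ^ (1 - s) / (s - 1))) s := by
  have h1 := LW.cmgf_neg_hasDerivAt LW.wE_mem (s := s) (by simpa using hs)
  refine h1.congr_deriv ?_
  rw [LW.nu_integral LW.wE_cont.measurable (fun x _ => (LW.wE_pos x).le)]
  congr 1
  have : ∫ x in Set.Ioi (2:ℝ), (LW.wE x : ℂ) * (Real.log x * Complex.exp (-s * Real.log x)) =
      ∫ x in Set.Ioi (2:ℝ), (x:ℂ) ^ (-s) := by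
    refine setIntegral_congr_fun measurableSet_Ioi fun x hx => ?_
    have hx2 : (2:ℝ) < x := hx
    have hx0 : 0 < x := by linarith
    have hl : (Real.log x : ℂ) ≠ 0 := by
      exact_mod_cast (Real.log_pos (by linarith)).ne'
    rw [LW.wE_eq hx2.le, Complex.cpow_def_of_ne_zero (by exact_mod_cast hx0.ne'), ← Complex.ofReal_log hx0.le,
      mul_comm (-s)]
    push_cast
    field_simp
  rw [this, integral_Ioi_cpow_of_lt (by simpa using hs) two_pos]
  rw [show -s + 1 = -(s - 1) by ring, neg_div_neg_eq]
  norm_num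

open ArithmeticFunction in
noncomputable def LW.cf (n : ℕ) : ℝ := vonMangoldt n / Real.log n

lemma LW.cf_nonneg (n : ℕ) : 0 ≤ LW.cf n :=
  div_nonneg ArithmeticFunction.vonMangoldt_nonneg (Real.log_natCast_nonneg n)

lemma LW.cf_le (n : ℕ) : LW.cf n ≤ 1 :=
  div_le_one_of_le₀ ArithmeticFunction.vonMangoldt_le_log (Real.log_natCast_nonneg n)

noncomputable def LW.PiF (x : ℝ) : ℝ := ∑ k ∈ Finset.Icc 1 ⌊x⌋₊, LW.cf k

lemma LW.PiF_nonneg (x : ℝ) : 0 ≤ LW.PiF x := Finset.sum_nonneg fun k _ => LW.cf_nonneg k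

lemma LW.PiF_le {x : ℝ} (hx : 0 ≤ x) : LW.PiF x ≤ x := by
  refine (Finset.sum_le_sum fun k _ => LW.cf_le k).trans ?_
  simpa using Nat.floor_le hx

lemma LW.PiF_meas : Measurable LW.PiF := by
  have : Measurable (fun n : ℕ => ∑ k ∈ Finset.Icc 1 n, LW.cf k) := measurable_from_nat
  exact this.comp Nat.measurable_floor

noncomputable def LW.liM (x : ℝ) : ℝ := ∫ t in (2:ℝ)..x, LW.wE t

lemma LW.liM_hasDerivAt (x : ℝ) : HasDerivAt LW.liM (LW.wE x) x :=
  (LW.wE_cont.integral_hasStrictDerivAt 2 x).hasDerivAt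

lemma LW.liM_cont : Continuous LW.liM :=
  continuous_iff_continuousAt.mpr fun x => (LW.liM_hasDerivAt x).continuousAt

lemma LW.liM_nonneg {x : ℝ} (hx : 2 ≤ x) : 0 ≤ LW.liM x :=
  intervalIntegral.integral_nonneg hx fun t _ => (LW.wE_pos t).le

lemma LW.liM_le {x : ℝ} (hx : 2 ≤ x) : LW.liM x ≤ 2 * x := by
  have h := intervalIntegral.integral_mono_on hx (LW.wE_cont.intervalIntegrable 2 x)
    ((continuous_const (y := (2:ℝ))).intervalIntegrable (μ := volume) 2 x) (fun t _ => LW.wE_le t)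
  rw [intervalIntegral.integral_const, smul_eq_mul] at h
  change LW.liM x ≤ _ at h
  linarith

noncomputable def LW.LS (s : ℂ) : ℂ := LSeries (fun n => (LW.cf n : ℂ)) s

lemma LW.LS_abs : LSeries.abscissaOfAbsConv (fun n => (LW.cf n : ℂ)) ≤ 1 := by
  refine LSeries.abscissaOfAbsConv_le_of_le_const ⟨1, fun n _ => ?_⟩
  rw [Complex.norm_real, Real.norm_eq_abs, abs_of_nonneg (LW.cf_nonneg n)]
  exact LW.cf_le n

lemma LW.LS_hasDerivAt {s : ℂ} (hs : 1 < s.re) :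
    HasDerivAt LW.LS (deriv riemannZeta s / riemannZeta s) s := by
  have h := LSeries_hasDerivAt (f := fun n => (LW.cf n : ℂ)) (s := s)
    (lt_of_le_of_lt LW.LS_abs (by exact_mod_cast hs))
  refine h.congr_deriv ?_
  have h2 := ArithmeticFunction.LSeries_vonMangoldt_eq_deriv_riemannZeta_div hs
  have h3 : LSeries (LSeries.logMul fun n => (LW.cf n : ℂ)) s =
      LSeries (fun n => ((ArithmeticFunction.vonMangoldt n : ℝ) : ℂ)) s := by
    congr 1
    ext n
    rw [LSeries.logMul]
    rcases Nat.lt_or_ge n 2 with hn | hn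
    · interval_cases n <;> simp [LW.cf]
    · have hl : (Real.log n : ℂ) ≠ 0 := by
        exact_mod_cast (Real.log_pos (by exact_mod_cast hn)).ne'
      rw [LW.cf, ← Complex.ofReal_natCast, ← Complex.ofReal_log (by positivity)]
      rw [Complex.ofReal_div]
      field_simp
  rw [h3, h2]
  ring

lemma LW.intg (g : ℝ → ℂ) (hg : Measurable g) (K p : ℝ) (hp : p < -1)
    (h : ∀ x : ℝ, 2 < x → ‖g x‖ ≤ K * x ^ p) : IntegrableOn g (Set.Ioi 2) := by
  have h1 := (integrableOn_Ioi_rpow_of_lt hp two_pos).const_mul K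
  refine Integrable.mono h1 hg.aestronglyMeasurable ?_
  refine (ae_restrict_mem measurableSet_Ioi).mono fun x hx => ?_
  exact (h x hx).trans (le_abs_self _)

lemma LW.cpow_norm {x : ℝ} (hx : 2 < x) (s : ℂ) : ‖(x:ℂ) ^ s‖ = x ^ s.re :=
  Complex.norm_cpow_eq_rpow_re_of_pos (by linarith) s

lemma LW.intg_PiF {s : ℂ} (hs : 1 < s.re) :
    IntegrableOn (fun x : ℝ => (LW.PiF x : ℂ) * (x : ℂ) ^ (-(s + 1))) (Set.Ioi 2) := by
  refine LW.intg _ ((Complex.measurable_ofReal.comp LW.PiF_meas).mul (by fun_prop)) 1 (-s.re) (by linarith) ?_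
  intro x hx
  have hx0 : 0 < x := by linarith
  rw [norm_mul, LW.cpow_norm hx, Complex.norm_real, Real.norm_eq_abs, abs_of_nonneg (LW.PiF_nonneg x)]
  simp only [Complex.neg_re, Complex.add_re, Complex.one_re, one_mul]
  rw [show -(s.re + 1) = -s.re - 1 by ring, Real.rpow_sub_one hx0.ne']
  have := LW.PiF_le hx0.le
  have h2 : 0 < x ^ (-s.re) := Real.rpow_pos_of_pos hx0 _
  rw [← mul_div_assoc, div_le_iff₀ hx0]
  nlinarith

lemma LW.intg_liM {s : ℂ} (hs : 1 < s.re) :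
    IntegrableOn (fun x : ℝ => (LW.liM x : ℂ) * (x : ℂ) ^ (-(s + 1))) (Set.Ioi 2) := by
  refine LW.intg _ ((Complex.measurable_ofReal.comp LW.liM_cont.measurable).mul (by fun_prop)) 2 (-s.re) (by linarith) ?_
  intro x hx
  have hx0 : 0 < x := by linarith
  rw [norm_mul, LW.cpow_norm hx, Complex.norm_real, Real.norm_eq_abs, abs_of_nonneg (LW.liM_nonneg hx.le)]
  simp only [Complex.neg_re, Complex.add_re, Complex.one_re]
  rw [show -(s.re + 1) = -s.re - 1 by ring, Real.rpow_sub_one hx0.ne']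
  have := LW.liM_le hx.le
  have h2 : 0 < x ^ (-s.re) := Real.rpow_pos_of_pos hx0 _
  rw [← mul_div_assoc, div_le_iff₀ hx0]
  nlinarith

lemma LW.intg_wE {s : ℂ} (hs : 1 < s.re) :
    IntegrableOn (fun x : ℝ => (LW.wE x : ℂ) * (x : ℂ) ^ (-s)) (Set.Ioi 2) := by
  refine LW.intg _ ((Complex.measurable_ofReal.comp LW.wE_cont.measurable).mul (by fun_prop)) 2 (-s.re) (by linarith) ?_
  intro x hx
  have hx0 : 0 < x := by linarith
  rw [norm_mul, LW.cpow_norm hx, Complex.norm_real, Real.norm_eq_abs, abs_of_nonneg (LW.wE_pos x).le]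
  have := LW.wE_le x
  have h2 : 0 < x ^ (-s.re) := Real.rpow_pos_of_pos hx0 _
  simp only [Complex.neg_re]
  nlinarith

lemma LW.integral_PiF {s : ℂ} (hs : 1 < s.re) :
    ∫ x in Set.Ioi (2:ℝ), (LW.PiF x : ℂ) * (x : ℂ) ^ (-(s + 1)) = LW.LS s / s := by
  have hs0 : s ≠ 0 := by rintro rfl; simp at hs; linarith
  have hO : (fun n : ℕ ↦ ∑ k ∈ Finset.Icc 1 n, LW.cf k) =O[atTop] fun n ↦ (n : ℝ) ^ (1:ℝ) := by
    refine Asymptotics.IsBigO.of_bound 1 (Eventually.of_forall fun n => ?_)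
    have h1 := LW.PiF_nonneg (n:ℝ)
    have h2 := LW.PiF_le (Nat.cast_nonneg (α := ℝ) n)
    simp only [LW.PiF, Nat.floor_natCast] at h1 h2
    rw [Real.norm_eq_abs, abs_of_nonneg h1]
    simpa using h2
  have h := LSeries_eq_mul_integral_of_nonneg LW.cf zero_le_one (s := s) hs hO LW.cf_nonneg
  rw [LW.LS, h, mul_div_cancel_left₀ _ hs0]
  symm
  have : ∀ x : ℝ, (∑ k ∈ Finset.Icc 1 ⌊x⌋₊, (LW.cf k : ℂ)) = (LW.PiF x : ℂ) := by
    intro x; simp [LW.PiF]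
  simp_rw [this]
  refine setIntegral_eq_of_subset_of_ae_sdiff_eq_zero measurableSet_Ioi.nullMeasurableSet
    (Set.Ioi_subset_Ioi one_le_two) ?_
  have h2 : ∀ᵐ x : ℝ, x ≠ 2 := by
    simp [ae_iff]
  filter_upwards [h2] with x hx hx2
  have a1 : 1 < x := hx2.1
  have a2 : x < 2 := lt_of_le_of_ne (not_lt.mp hx2.2) hx
  have : ⌊x⌋₊ = 1 := by
    rw [Nat.floor_eq_iff (by linarith)]
    constructor <;> norm_num <;> linarith
  simp [LW.PiF, this, LW.cf]

lemma LW.integral_liM {s : ℂ} (hs : 1 < s.re) :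
    ∫ x in Set.Ioi (2:ℝ), (LW.liM x : ℂ) * (x : ℂ) ^ (-(s + 1)) = LW.E1 s / s := by
  have hs0 : s ≠ 0 := by rintro rfl; simp at hs; linarith
  have hd : ∀ x ∈ Set.Ici (2:ℝ), HasDerivAt (fun x : ℝ => (LW.liM x : ℂ) * (x : ℂ) ^ (-s))
      ((LW.wE x : ℂ) * (x:ℂ) ^ (-s) - s * ((LW.liM x : ℂ) * (x:ℂ) ^ (-(s+1)))) x := by
    intro x hx
    have hx2 : (2:ℝ) ≤ x := hx
    have h1 := (LW.liM_hasDerivAt x).ofReal_comp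
    have h2 : HasDerivAt (fun x : ℝ => (x : ℂ) ^ (-s)) ((-s) * (x:ℂ) ^ (-s - 1)) x :=
      hasDerivAt_ofReal_cpow_const (by linarith) (by simpa using hs0)
    refine (h1.mul h2).congr_deriv ?_
    rw [show -(s + 1) = -s - 1 by ring]
    ring
  have hint := (LW.intg_wE hs).sub ((LW.intg_liM hs).const_mul s)
  have hlim : Tendsto (fun x : ℝ => (LW.liM x : ℂ) * (x : ℂ) ^ (-s)) atTop (𝓝 0) := by
    rw [tendsto_zero_iff_norm_tendsto_zero]
    have hz : Tendsto (fun x : ℝ => 2 * x ^ (-(s.re - 1))) atTop (𝓝 0) := by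
      simpa using (tendsto_rpow_neg_atTop (show 0 < s.re - 1 by linarith)).const_mul 2
    refine squeeze_zero' (Eventually.of_forall fun _ => norm_nonneg _) ?_ hz
    filter_upwards [eventually_gt_atTop 2] with x hx
    have hx0 : 0 < x := by linarith
    rw [norm_mul, LW.cpow_norm hx, Complex.norm_real, Real.norm_eq_abs, abs_of_nonneg (LW.liM_nonneg hx.le)]
    simp only [Complex.neg_re]
    rw [show -(s.re - 1) = -s.re + 1 by ring, Real.rpow_add_one hx0.ne']
    have := LW.liM_le hx.le
    have h2 : 0 < x ^ (-s.re) := Real.rpow_pos_of_pos hx0 _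
    nlinarith
  have h := integral_Ioi_of_hasDerivAt_of_tendsto' hd hint hlim
  rw [integral_sub (LW.intg_wE hs) ((LW.intg_liM hs).const_mul s), integral_const_mul, ← LW.E1_eq] at h
  have h0 : LW.liM 2 = 0 := by simp [LW.liM]
  rw [h0] at h
  rw [eq_div_iff hs0]
  rw [Complex.ofReal_zero, zero_mul, sub_zero] at h
  linear_combination -h


open MeasureTheory ProbabilityTheory Filter Topology

noncomputable def LW.BB (e C x : ℝ) : ℝ := e * (LW.PiF x - LW.liM x) + C * (Real.sqrt x * LW.wE x)

noncomputable def LW.wB (e C x : ℝ) : ℝ := LW.BB e C x / x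

noncomputable def LW.FF (e C : ℝ) (s : ℂ) : ℂ := complexMGF Real.log (LW.nu (LW.wB e C) 2) (-s)

lemma LW.wB_meas (e C : ℝ) : Measurable (LW.wB e C) := by
  unfold LW.wB LW.BB
  exact (((LW.PiF_meas.sub LW.liM_cont.measurable).const_mul e).add
    ((Real.continuous_sqrt.mul LW.wE_cont).measurable.const_mul C)).div measurable_id

lemma LW.wB_mem (e C : ℝ) (hB : ∀ x, 2 < x → 0 ≤ LW.wB e C x) :
    ∀ t < (-1:ℝ), t ∈ integrableExpSet Real.log (LW.nu (LW.wB e C) 2) := by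
  intro t ht
  refine LW.nu_bound (LW.wB_meas e C) two_pos hB (3 * |e| + 2 * |C|) 0 ?_ t (by linarith)
  intro x hx
  have hx0 : 0 < x := by linarith
  rw [Real.rpow_zero, mul_one, LW.wB, div_le_iff₀ hx0, LW.BB]
  have a1 := LW.PiF_nonneg x
  have a2 := LW.PiF_le hx0.le
  have a3 := LW.liM_nonneg hx.le
  have a4 := LW.liM_le hx.le
  have a5 : Real.sqrt x * LW.wE x ≤ x * 2 := by
    refine mul_le_mul ?_ (LW.wE_le x) (LW.wE_pos x).le hx0.le
    rw [Real.sqrt_le_left hx0.le]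
    nlinarith
  have a6 : 0 ≤ Real.sqrt x * LW.wE x := mul_nonneg (Real.sqrt_nonneg _) (LW.wE_pos x).le
  have b1 : e * (LW.PiF x - LW.liM x) ≤ |e| * (3 * x) := by
    refine (le_abs_self _).trans ?_
    rw [abs_mul]
    refine mul_le_mul_of_nonneg_left ?_ (abs_nonneg _)
    rw [abs_le]; constructor <;> linarith
  have b2 : C * (Real.sqrt x * LW.wE x) ≤ |C| * (x * 2) := by
    refine (le_abs_self _).trans ?_
    rw [abs_mul, abs_of_nonneg a6]
    exact mul_le_mul_of_nonneg_left a5 (abs_nonneg _)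
  linarith

lemma LW.FF_eq (e C : ℝ) (hB : ∀ x, 2 < x → 0 ≤ LW.wB e C x) {s : ℂ} (hs : 1 < s.re) :
    LW.FF e C s = e * (LW.LS s - LW.E1 s) / s + C * LW.E1 (s + 1/2) := by
  have hs0 : s ≠ 0 := by rintro rfl; simp at hs; linarith
  rw [LW.FF, LW.nu_cmgf (LW.wB_meas e C) zero_le_two hB]
  have hs2 : 1 < (s + 1/2).re := by
    simp; linarith
  have i1 := (LW.intg_PiF hs).const_mul (e:ℂ)
  have i2 := (LW.intg_liM hs).const_mul (e:ℂ)
  have i3 := (LW.intg_wE hs2).const_mul (C:ℂ)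
  have h : ∫ x in Set.Ioi (2:ℝ), (LW.wB e C x : ℂ) * (x:ℂ) ^ (-s) =
      ∫ x in Set.Ioi (2:ℝ), ((e:ℂ) * ((LW.PiF x : ℂ) * (x : ℂ) ^ (-(s + 1))) -
        (e:ℂ) * ((LW.liM x : ℂ) * (x : ℂ) ^ (-(s + 1))) + (C:ℂ) * ((LW.wE x : ℂ) * (x : ℂ) ^ (-(s+1/2)))) := by
    refine setIntegral_congr_fun measurableSet_Ioi fun x hx => ?_
    have hx2 : (2:ℝ) < x := hx
    have hx0 : 0 < x := by linarith
    have hxc : (x:ℂ) ≠ 0 := by exact_mod_cast hx0.ne'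
    have e1 : (x:ℂ) ^ (-(s+1)) = (x:ℂ) ^ (-s) / x := by
      rw [show -(s+1) = -s - 1 by ring, Complex.cpow_sub _ _ hxc, Complex.cpow_one]
    have e2 : (x:ℂ) ^ (-(s+1/2)) = (x:ℂ) ^ (-s) * (Real.sqrt x : ℂ) / x := by
      rw [show -(s+1/2) = -s + (1/2:ℂ) - 1 by ring, Complex.cpow_sub _ _ hxc, Complex.cpow_one,
        Complex.cpow_add _ _ hxc, Real.sqrt_eq_rpow, Complex.ofReal_cpow hx0.le]
      norm_num
    simp only [LW.wB, LW.BB]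
    rw [e1, e2]
    push_cast
    field_simp
  have i12 : IntegrableOn (fun x : ℝ => (e:ℂ) * ((LW.PiF x : ℂ) * (x : ℂ) ^ (-(s + 1))) -
        (e:ℂ) * ((LW.liM x : ℂ) * (x : ℂ) ^ (-(s + 1)))) (Set.Ioi 2) := i1.sub i2
  rw [h, integral_add i12 i3, integral_sub i1 i2, integral_const_mul, integral_const_mul,
    integral_const_mul, LW.integral_PiF hs, LW.integral_liM hs, ← LW.E1_eq]
  field_simp

/-- the entire function `(1 - 2^(1-s))/(s-1)` -/
noncomputable def LW.ee : ℂ → ℂ := dslope (fun s => -(2:ℂ) ^ (1 - s)) 1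

lemma LW.ee_diff : Differentiable ℂ LW.ee := by
  rw [← differentiableOn_univ]
  refine (Complex.differentiableOn_dslope univ_mem).mpr ?_
  refine Differentiable.differentiableOn ?_
  intro s
  exact ((differentiableAt_id.const_sub 1).const_cpow (Or.inl two_ne_zero)).neg

lemma LW.ee_eq {s : ℂ} (hs : s ≠ 1) : LW.ee s = (1 - (2:ℂ) ^ (1 - s)) / (s - 1) := by
  rw [LW.ee, dslope_of_ne _ hs, slope_def_field]
  simp
  ring

lemma LW.exists_KK : ∃ K : ℂ → ℂ, ∀ s, HasDerivAt K (LW.ee s) s := by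
  obtain ⟨K, hK⟩ := LW.ee_diff.isExactOn_univ
  exact ⟨K, fun s => hK s trivial⟩

noncomputable def LW.KK : ℂ → ℂ := LW.exists_KK.choose
lemma LW.KK_deriv (s : ℂ) : HasDerivAt LW.KK (LW.ee s) s := LW.exists_KK.choose_spec s

lemma LW.zeta1_ne_of_one_lt {s : ℂ} (hs : 1 < s.re) : riemannZeta₁ s ≠ 0 := by
  have hs1 : s ≠ 1 := by rintro rfl; simp at hs
  have h := riemannZeta_ne_zero_of_one_lt_re hs
  rw [riemannZeta_eq_inv_sub_mul hs1] at h
  exact right_ne_zero_of_mul h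

lemma LW.V_deriv {s : ℂ} (hs : 1 < s.re) :
    HasDerivAt (fun s => LW.LS s - LW.E1 s) (deriv riemannZeta₁ s / riemannZeta₁ s - LW.ee s) s := by
  have hs1 : s ≠ 1 := by rintro rfl; simp at hs
  have hs1' : s - 1 ≠ 0 := sub_ne_zero.mpr hs1
  have hZ := LW.zeta1_ne_of_one_lt hs
  refine ((LW.LS_hasDerivAt hs).sub (LW.E1_hasDerivAt hs)).congr_deriv ?_
  have h1 : deriv riemannZeta s = -((s-1)^2)⁻¹ * riemannZeta₁ s + (s-1)⁻¹ * deriv riemannZeta₁ s := by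
    have hev : riemannZeta =ᶠ[𝓝 s] fun s => (s-1)⁻¹ * riemannZeta₁ s := by
      filter_upwards [isOpen_ne.mem_nhds hs1] with z hz
      exact riemannZeta_eq_inv_sub_mul hz
    rw [hev.deriv_eq]
    have h2 : HasDerivAt (fun s : ℂ => (s-1)⁻¹) (-1 / (s-1)^2) s :=
      ((hasDerivAt_id s).sub_const 1).inv hs1'
    have h3 := h2.mul (differentiable_riemannZeta₁ s).hasDerivAt
    refine h3.deriv.trans ?_
    ring
  rw [h1, riemannZeta_eq_inv_sub_mul hs1, LW.ee_eq hs1]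
  field_simp
  ring

lemma LW.E1_diffAt {s : ℂ} (hs : 1 < s.re) : DifferentiableAt ℂ LW.E1 s :=
  (LW.E1_hasDerivAt hs).differentiableAt

lemma LW.const_of_deriv {f : ℂ → ℂ} (h : ∀ s : ℂ, 1 < s.re → HasDerivAt f 0 s) :
    ∀ s : ℂ, 1 < s.re → f s = f 2 := by
  intro s hs
  have := (convex_halfSpace_re_gt 1).norm_image_sub_le_of_norm_hasDerivWithin_le (C := 0) (f := f)
    (f' := fun _ => 0) (fun x hx => (h x hx).hasDerivWithinAt) (by simp) (x := 2) (y := s) (by change (1:ℝ) < (2:ℂ).re; norm_num) hs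
  rw [zero_mul] at this
  exact sub_eq_zero.mp (norm_le_zero_iff.mp this)

lemma LW.wB_mem2 (e C : ℝ) (hB : ∀ x, 2 < x → 0 ≤ LW.wB e C x) :
    ∀ t < (-(1/2):ℝ), t ∈ integrableExpSet Real.log (LW.nu (LW.wB e C) 2) := by
  -- log Z on the reals
  have hconst : ∀ σ : ℝ, 1 < σ → LW.LS σ - LW.E1 σ - Complex.log (riemannZeta₁ σ) + LW.KK σ =
      LW.LS (2:ℝ) - LW.E1 (2:ℝ) - Complex.log (riemannZeta₁ (2:ℝ)) + LW.KK (2:ℝ) := by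
    intro σ hσ
    have hd : ∀ x ∈ Set.Ioi (1:ℝ), HasDerivWithinAt (fun x : ℝ => LW.LS x - LW.E1 x - Complex.log (riemannZeta₁ x) + LW.KK x) 0 (Set.Ioi 1) x := by
      intro x hx
      have hx1 : (1:ℝ) < x := hx
      have h1 := LW.V_deriv (s := x) (by simpa using hx1)
      have h2 := (differentiable_riemannZeta₁ x).hasDerivAt.clog (LW.zeta1_slit x (by linarith))
      have h3 := ((h1.sub h2).add (LW.KK_deriv x)).comp_ofReal
      refine (h3.congr_deriv ?_).hasDerivWithinAt
      ring
    have := (convex_Ioi (1:ℝ)).norm_image_sub_le_of_norm_hasDerivWithin_le (C := 0) hd (by simp) (x := 2) (y := σ) (by simp) hσ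
    rw [zero_mul] at this
    exact sub_eq_zero.mp (norm_le_zero_iff.mp this)
  set c0 := LW.LS (2:ℝ) - LW.E1 (2:ℝ) - Complex.log (riemannZeta₁ (2:ℝ)) + LW.KK (2:ℝ) with hc0
  refine LW.landau _ _ Real.measurable_log.aemeasurable
    (LW.nu_ae fun x hx => Real.log_nonneg (by linarith))
    (fun z => e * (Complex.log (riemannZeta₁ (-z)) - LW.KK (-z) + c0) / (-z) + C * LW.E1 (-z + 1/2))
    _ (-1) ?_ (LW.wB_mem e C hB) ?_
  · intro t ht
    rw [Complex.analyticAt_iff_eventually_differentiableAt]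
    have hneg : ContinuousAt (fun z : ℂ => riemannZeta₁ (-z)) t :=
      (differentiable_riemannZeta₁.continuous.comp continuous_neg).continuousAt
    have hslit : ∀ᶠ z : ℂ in 𝓝 (t:ℂ), riemannZeta₁ (-z) ∈ Complex.slitPlane := by
      refine hneg.eventually (Complex.isOpen_slitPlane.mem_nhds ?_)
      have := LW.zeta1_slit (-t) (by linarith)
      simpa using this
    have hre : ∀ᶠ z : ℂ in 𝓝 (t:ℂ), z.re < -(1/2) :=
      (isOpen_lt Complex.continuous_re continuous_const).mem_nhds (by simpa using ht)
    filter_upwards [hslit, hre] with z hz1 hz2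
    have hz0 : -z ≠ 0 := by
      intro h
      have : z = 0 := by simpa using h
      rw [this] at hz2; simp at hz2; linarith
    have d1 : DifferentiableAt ℂ (fun z => riemannZeta₁ (-z)) z :=
      (differentiable_riemannZeta₁.comp differentiable_neg) z
    have d2 : DifferentiableAt ℂ (fun z => LW.KK (-z)) z :=
      DifferentiableAt.comp z (f := fun z => -z) (LW.KK_deriv (-z)).differentiableAt differentiable_neg.differentiableAt
    have d3 : DifferentiableAt ℂ (fun z => LW.E1 (-z + 1/2)) z := by
      refine DifferentiableAt.comp z (f := fun z => -z + 1/2) (LW.E1_diffAt ?_) (differentiable_neg.differentiableAt.add_const _)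
      simp; linarith
    exact (((((d1.clog hz1).sub d2).add_const c0).const_mul (e:ℂ)).div differentiable_neg.differentiableAt hz0).add
      (d3.const_mul _)
  · intro t ht
    have h1 := LW.FF_eq e C hB (s := ((-t : ℝ) : ℂ)) (by simp; linarith)
    have h2 := hconst (-t) (by linarith)
    rw [LW.FF] at h1
    simp only [Complex.ofReal_neg, neg_neg] at h1 h2 ⊢
    rw [h1, ← h2]
    ring

noncomputable def LW.VV (e C : ℝ) (s : ℂ) : ℂ := e * s * (LW.FF e C s - C * LW.E1 (s + 1/2))

lemma LW.FF_diffAt (e C : ℝ) (hB : ∀ x, 2 < x → 0 ≤ LW.wB e C x) {s : ℂ} (hs : 1/2 < s.re) :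
    DifferentiableAt ℂ (LW.FF e C) s :=
  (LW.cmgf_neg_hasDerivAt (LW.wB_mem2 e C hB) (s := s) (by simpa using hs)).differentiableAt

lemma LW.VV_diffAt (e C : ℝ) (hB : ∀ x, 2 < x → 0 ≤ LW.wB e C x) {s : ℂ} (hs : 1/2 < s.re) :
    DifferentiableAt ℂ (LW.VV e C) s := by
  have d3 : DifferentiableAt ℂ (fun z => LW.E1 (z + 1/2)) s := by
    refine DifferentiableAt.comp s (f := fun z => z + 1/2) (LW.E1_diffAt ?_) (differentiableAt_id.add_const _)
    simp; linarith
  exact (differentiableAt_id.const_mul (e:ℂ)).mul ((LW.FF_diffAt e C hB hs).sub (d3.const_mul _))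

lemma LW.VV_eq (e C : ℝ) (he : e * e = 1) (hB : ∀ x, 2 < x → 0 ≤ LW.wB e C x) {s : ℂ} (hs : 1 < s.re) :
    LW.VV e C s = LW.LS s - LW.E1 s := by
  have hs0 : s ≠ 0 := by rintro rfl; simp at hs; linarith
  rw [LW.VV, LW.FF_eq e C hB hs]
  have : (e:ℂ) * e = 1 := by exact_mod_cast he
  field_simp
  linear_combination (LW.LS s - LW.E1 s) * this

lemma LW.zeta1_exp (e C : ℝ) (he : e * e = 1) (hB : ∀ x, 2 < x → 0 ≤ LW.wB e C x) :
    ∃ c : ℂ, c ≠ 0 ∧ ∀ s : ℂ, 1/2 < s.re →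
      riemannZeta₁ s = c * Complex.exp (LW.VV e C s + LW.KK s) := by
  set W : ℂ → ℂ := fun s => riemannZeta₁ s * Complex.exp (-(LW.VV e C s + LW.KK s)) with hW
  have h1 : ∀ s : ℂ, 1 < s.re → W s = W 2 := by
    apply LW.const_of_deriv
    intro s hs
    have hev : (fun s => LW.LS s - LW.E1 s) =ᶠ[𝓝 s] LW.VV e C := by
      filter_upwards [(LW.halfplane_open 1).mem_nhds hs] with z hz
      exact (LW.VV_eq e C he hB hz).symm
    have d1 := (LW.V_deriv hs).congr_of_eventuallyEq hev.symm
    have d2 := (differentiable_riemannZeta₁ s).hasDerivAt.mul (d1.add (LW.KK_deriv s)).neg.cexp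
    refine d2.congr_deriv ?_
    have hZ := LW.zeta1_ne_of_one_lt hs
    field_simp
    simp
  have h2 := LW.ident (a := 1/2) (b := 1) (f := W) (g := fun _ => W 2) (fun s hs =>
    ((differentiable_riemannZeta₁ s).mul
      ((LW.VV_diffAt e C hB hs).add (LW.KK_deriv s).differentiableAt).neg.cexp).differentiableWithinAt)
    (differentiableOn_const _) h1
  refine ⟨W 2, mul_ne_zero (LW.zeta1_ne_of_one_lt (by simp)) (Complex.exp_ne_zero _), fun s hs => ?_⟩
  rw [← h2 s hs, hW]
  simp only
  rw [mul_assoc, ← Complex.exp_add]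
  simp


open MeasureTheory ProbabilityTheory Filter Topology

lemma LW.loglim2 (V r : ℂ → ℂ) (ρ m : ℂ) (hr : ContinuousAt r ρ)
    (h : ∀ᶠ s in 𝓝 ρ, ρ.re < s.re → HasDerivAt V (m / (s - ρ) + r s) s) :
    Tendsto (fun t : ℝ => V (ρ + t) / (Real.log (1 / t) : ℂ)) (𝓝[>] 0) (𝓝 (-m)) := by
  have hb : ∀ᶠ s in 𝓝 ρ, ‖r s‖ ≤ ‖r ρ‖ + 1 :=
    hr.norm.eventually (ge_mem_nhds (by linarith))
  obtain ⟨δ, hδ, hd⟩ := Metric.eventually_nhds_iff.mp (h.and hb)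
  have hdist : ∀ t ∈ Set.Ioo 0 δ, dist (ρ + (t:ℂ)) ρ < δ := by
    intro t ht
    rw [Complex.dist_eq, add_sub_cancel_left, Complex.norm_real, Real.norm_eq_abs, abs_of_pos ht.1]
    exact ht.2
  refine LW.loglim (fun t : ℝ => V (ρ + t)) (fun t : ℝ => r (ρ + t)) m δ (‖r ρ‖ + 1) hδ ?_ ?_
  · intro t ht
    have h1 := (hd (hdist t ht)).1 (by simpa using ht.1)
    have h2 : HasDerivAt (fun z : ℂ => V (ρ + z)) (m / (ρ + t - ρ) + r (ρ + t)) (t : ℂ) :=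
      HasDerivAt.comp_const_add ρ (t:ℂ) h1
    refine h2.comp_ofReal.congr_deriv ?_
    rw [add_sub_cancel_left]
  · intro t ht
    exact (hd (hdist t ht)).2

noncomputable def LW.pt (l : ℝ) : ℂ := 1/2 + Complex.I * l

lemma LW.pt_re (l : ℝ) : (LW.pt l).re = 1/2 := by simp [LW.pt]

noncomputable def LW.mm (l : ℝ) : ℕ := analyticOrderNatAt riemannZeta₁ (LW.pt l)

lemma LW.zeta1_order (z : ℂ) : analyticOrderAt riemannZeta₁ z ≠ ⊤ := by
  have hA : AnalyticOnNhd ℂ riemannZeta₁ Set.univ := fun z _ =>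
    (differentiable_riemannZeta₁.analyticAt z)
  refine hA.analyticOrderAt_ne_top_of_isPreconnected isPreconnected_univ (x := 1) trivial trivial ?_
  have : analyticOrderAt riemannZeta₁ 1 = 0 := by
    rw [(differentiable_riemannZeta₁.analyticAt 1).analyticOrderAt_eq_zero, riemannZeta₁_one]
    exact one_ne_zero
  rw [this]; exact ENat.zero_ne_top

lemma LW.VV_lim (e C : ℝ) (he : e * e = 1) (hB : ∀ x, 2 < x → 0 ≤ LW.wB e C x) (l : ℝ) :
    Tendsto (fun t : ℝ => LW.VV e C (LW.pt l + t) / (Real.log (1 / t) : ℂ)) (𝓝[>] 0) (𝓝 (-(LW.mm l : ℂ))) := by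
  obtain ⟨g, hg, hg0, hev⟩ := ((differentiable_riemannZeta₁.analyticAt (LW.pt l)).analyticOrderAt_ne_top).mp
    (LW.zeta1_order (LW.pt l))
  obtain ⟨c, hc, hexp⟩ := LW.zeta1_exp e C he hB
  refine LW.loglim2 _ (fun s => deriv g s / g s - LW.ee s) _ _ ?_ ?_
  · exact (hg.deriv.continuousAt.div hg.continuousAt hg0).sub LW.ee_diff.continuous.continuousAt
  · filter_upwards [hev.eventually_nhds, hg.eventually_analyticAt, hg.continuousAt.eventually_ne hg0] with s h1 h2 h3 hs
    rw [LW.pt_re] at hs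
    have hsρ : s - LW.pt l ≠ 0 := by
      intro h
      rw [sub_eq_zero.mp h, LW.pt_re] at hs
      exact lt_irrefl _ hs
    have d1 := (LW.VV_diffAt e C hB hs).hasDerivAt
    refine d1.congr_deriv ?_
    have d2 : HasDerivAt riemannZeta₁ (c * (Complex.exp (LW.VV e C s + LW.KK s) * (deriv (LW.VV e C) s + LW.ee s))) s := by
      refine ((d1.add (LW.KK_deriv s)).cexp.const_mul c).congr_of_eventuallyEq ?_
      filter_upwards [(LW.halfplane_open (1/2)).mem_nhds hs] with z hz
      exact hexp z hz
    have d3 : HasDerivAt riemannZeta₁ (((LW.mm l : ℂ) * (s - LW.pt l) ^ (LW.mm l - 1)) * g s + (s - LW.pt l) ^ (LW.mm l) * deriv g s) s := by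
      have := ((((hasDerivAt_id s).sub_const (LW.pt l)).pow (LW.mm l)).mul h2.differentiableAt.hasDerivAt).congr_of_eventuallyEq
        (f₁ := riemannZeta₁) h1
      refine this.congr_deriv ?_
      simp
    have h4 := d2.unique d3
    have h5 := hexp s hs
    have h6 : riemannZeta₁ s = (s - LW.pt l) ^ (LW.mm l) * g s := h1.self_of_nhds
    rw [← mul_assoc, ← h5, h6] at h4
    have h7 : (LW.mm l : ℂ) * (s - LW.pt l) ^ (LW.mm l - 1) = (LW.mm l : ℂ) * (s - LW.pt l) ^ (LW.mm l) / (s - LW.pt l) := by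
      rcases Nat.eq_zero_or_pos (LW.mm l) with h0 | h0
      · simp [h0]
      · rw [eq_div_iff hsρ, mul_assoc, ← pow_succ, Nat.sub_add_cancel h0]
    rw [h7] at h4
    have hp : (s - LW.pt l) ^ (LW.mm l) ≠ 0 := pow_ne_zero _ hsρ
    have h8 : deriv (LW.VV e C) s + LW.ee s = (LW.mm l : ℂ) / (s - LW.pt l) + deriv g s / g s := by
      have : (s - LW.pt l) ^ (LW.mm l) * g s ≠ 0 := mul_ne_zero hp h3
      apply mul_left_cancel₀ this
      rw [h4]
      field_simp
    linear_combination h8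

lemma LW.E1_lim (l : ℝ) :
    Tendsto (fun t : ℝ => LW.E1 (LW.pt l + t + 1/2) / (Real.log (1 / t) : ℂ)) (𝓝[>] 0)
      (𝓝 (if l = 0 then 1 else 0)) := by
  have key : Tendsto (fun t : ℝ => LW.E1 ((LW.pt l + 1/2) + t) / (Real.log (1 / t) : ℂ)) (𝓝[>] 0)
      (𝓝 (-(if l = 0 then -1 else 0))) := by
    have hre : (LW.pt l + 1/2).re = 1 := by
      rw [Complex.add_re, LW.pt_re]; norm_num
    by_cases hl : l = 0
    · have h1 : LW.pt l + 1/2 = 1 := by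
        simp [LW.pt, hl]; norm_num
      rw [if_pos hl, h1]
      refine LW.loglim2 _ LW.ee 1 (-1) LW.ee_diff.continuous.continuousAt ?_
      refine Eventually.of_forall fun s hs => ?_
      have hs1 : s ≠ 1 := by rintro rfl; exact lt_irrefl _ hs
      refine (LW.E1_hasDerivAt (by simpa using hs)).congr_deriv ?_
      rw [LW.ee_eq hs1]
      have := sub_ne_zero.mpr hs1
      field_simp
      ring
    · rw [if_neg hl]
      refine LW.loglim2 _ (fun s => -((2:ℂ) ^ (1 - s) / (s - 1))) _ 0 ?_ ?_
      · have : LW.pt l + 1/2 - 1 ≠ 0 := by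
          intro h
          have := congrArg Complex.im h
          simp [LW.pt] at this
          exact hl this
        have h2 : Continuous (fun s : ℂ => (2:ℂ) ^ (1 - s)) :=
          (continuous_const.sub continuous_id).const_cpow (Or.inl two_ne_zero)
        have h3 : ContinuousAt (fun s : ℂ => s - 1) (LW.pt l + 1/2) := by fun_prop
        exact (h2.continuousAt.div h3 this).neg
      · refine Eventually.of_forall fun s hs => ?_
        rw [hre] at hs
        refine (LW.E1_hasDerivAt (by simpa using hs)).congr_deriv ?_
        ring
  have e1 : (-(if l = 0 then -1 else 0) : ℂ) = if l = 0 then 1 else 0 := by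
    split_ifs <;> simp
  rw [e1] at key
  refine key.congr fun t => ?_
  congr 2
  ring

lemma LW.FF_lim (e C : ℝ) (he : e * e = 1) (hB : ∀ x, 2 < x → 0 ≤ LW.wB e C x) (l : ℝ) :
    Tendsto (fun t : ℝ => LW.FF e C (LW.pt l + t) / (Real.log (1 / t) : ℂ)) (𝓝[>] 0)
      (𝓝 (e * (-(LW.mm l : ℂ)) / LW.pt l + C * (if l = 0 then 1 else 0))) := by
  have h0 : LW.pt l ≠ 0 := by
    intro h
    have := congrArg Complex.re h
    rw [LW.pt_re] at this
    norm_num at this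
  have h1 : Tendsto (fun t : ℝ => LW.pt l + (t:ℂ)) (𝓝[>] 0) (𝓝 (LW.pt l)) := by
    have : Continuous (fun t : ℝ => LW.pt l + (t:ℂ)) := by fun_prop
    have h := this.tendsto 0
    simp only [Complex.ofReal_zero, add_zero] at h
    exact h.mono_left nhdsWithin_le_nhds
  have h2 := (((LW.VV_lim e C he hB l).const_mul (e:ℂ)).div h1 h0).add ((LW.E1_lim l).const_mul (C:ℂ))
  refine h2.congr' ?_
  filter_upwards [self_mem_nhdsWithin] with t ht
  have ht0 : (0:ℝ) < t := ht
  have h3 : LW.pt l + (t:ℂ) ≠ 0 := by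
    intro h
    have := congrArg Complex.re h
    rw [Complex.add_re, LW.pt_re] at this
    simp at this
    linarith
  have hee : (e:ℂ) * e = 1 := by exact_mod_cast he
  simp only [Pi.div_apply, LW.VV]
  have h4 : (e:ℂ) * (e * (LW.pt l + t) * (LW.FF e C (LW.pt l + t) - C * LW.E1 (LW.pt l + t + 1/2)) / (Real.log (1/t) : ℂ)) / (LW.pt l + t) =
     (LW.FF e C (LW.pt l + t) - C * LW.E1 (LW.pt l + t + 1/2)) / (Real.log (1/t) : ℂ) := by
    rw [show (e:ℂ) * (e * (LW.pt l + t) * (LW.FF e C (LW.pt l + t) - C * LW.E1 (LW.pt l + t + 1/2)) / (Real.log (1/t) : ℂ)) / (LW.pt l + t) = (e * e) * ((LW.pt l + t) / (LW.pt l + t)) * ((LW.FF e C (LW.pt l + t) - C * LW.E1 (LW.pt l + t + 1/2)) / (Real.log (1/t) : ℂ)) by ring]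
    rw [hee, div_self h3]
    ring
  rw [h4]
  ring

lemma LW.FF_pos (e C : ℝ) (hB : ∀ x, 2 < x → 0 ≤ LW.wB e C x) (a d : ℝ) (ha : 0 < a)
    (A : Finset ℝ) (t : ℝ) (ht : 0 < t) :
    0 ≤ (∑ x ∈ A, ∑ y ∈ A, (1 / ((a : ℂ) + Complex.I * d * ((x - y : ℝ) : ℂ))) *
      LW.FF e C (LW.pt (x - y) + t)).re := by
  have hint : ∀ l : ℝ, Integrable (fun x => Complex.exp (-(LW.pt l + t) * Real.log x)) (LW.nu (LW.wB e C) 2) := by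
    intro l
    have h1 := LW.wB_mem2 e C hB (-(1/2) - t) (by linarith)
    refine Integrable.mono h1 ?_ ?_
    · exact (Complex.measurable_exp.comp ((Complex.measurable_ofReal.comp Real.measurable_log).const_mul _)).aestronglyMeasurable
    · refine Eventually.of_forall fun x => ?_
      rw [Complex.norm_exp, Real.norm_eq_abs, Real.abs_exp]
      apply le_of_eq
      congr 1
      rw [Complex.re_mul_ofReal]
      simp only [Complex.neg_re, Complex.add_re, LW.pt_re, Complex.ofReal_re]
      ring
  have hval : ∀ x y : ℝ, (1 / ((a : ℂ) + Complex.I * d * ((x - y : ℝ) : ℂ))) * LW.FF e C (LW.pt (x - y) + t) =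
      ∫ u, (1 / ((a : ℂ) + Complex.I * d * ((x - y : ℝ) : ℂ))) * Complex.exp (-(LW.pt (x-y) + t) * Real.log u) ∂(LW.nu (LW.wB e C) 2) := by
    intro x y
    rw [integral_const_mul]
    rfl
  have hint2 : ∀ x y : ℝ, Integrable (fun u => (1 / ((a : ℂ) + Complex.I * d * ((x - y : ℝ) : ℂ))) * Complex.exp (-(LW.pt (x-y) + t) * Real.log u)) (LW.nu (LW.wB e C) 2) :=
    fun x y => (hint (x-y)).const_mul _
  simp_rw [hval]
  simp_rw [← MeasureTheory.integral_finsetSum A (fun y _ => hint2 _ y)]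
  rw [← MeasureTheory.integral_finsetSum A (fun x _ => MeasureTheory.integrable_finsetSum A (fun y _ => hint2 x y))]
  have hI := MeasureTheory.integrable_finsetSum A (fun x _ => MeasureTheory.integrable_finsetSum A (fun y _ => hint2 x y))
  rw [← RCLike.re_eq_complex_re, ← integral_re hI]
  refine MeasureTheory.integral_nonneg fun u => ?_
  have key : (∑ x ∈ A, ∑ y ∈ A, (1 / ((a : ℂ) + Complex.I * d * ((x - y : ℝ) : ℂ))) * Complex.exp (-(LW.pt (x-y) + t) * Real.log u)) =
     (Real.exp (-(1/2 + t) * Real.log u) : ℂ) * ∑ x ∈ A, ∑ y ∈ A, (1 / ((a : ℂ) + Complex.I * d * ((x - y : ℝ) : ℂ))) *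
      Complex.exp (-(Complex.I * ((x - y : ℝ) : ℂ)) * Real.log u) := by
    rw [Finset.mul_sum]
    refine Finset.sum_congr rfl fun x _ => ?_
    rw [Finset.mul_sum]
    refine Finset.sum_congr rfl fun y _ => ?_
    rw [mul_left_comm, Complex.ofReal_exp, ← Complex.exp_add]
    congr 2
    simp [LW.pt]
    ring
  simp only [key, RCLike.re_eq_complex_re, Complex.re_ofReal_mul]
  exact mul_nonneg (Real.exp_pos _).le (LW.kernel_nonneg a d ha A (Real.log u))

lemma LW.pair_bound (e C : ℝ) (he : e = 1 ∨ e = -1) (hB : ∀ x, 2 < x → 0 ≤ LW.wB e C x) (a : ℝ) (ha : 0 < a)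
    (A : Finset ℝ) :
    ∑ x ∈ A, ∑ y ∈ A, (LW.mm (x - y) : ℝ) * (((x-y)^2 - a/2) / ((a^2 + (x-y)^2) * (1/4 + (x-y)^2))) ≤
      C / a * A.card := by
  have hee : e * e = 1 := by rcases he with rfl | rfl <;> norm_num
  have hlim : Tendsto (fun t : ℝ => (∑ x ∈ A, ∑ y ∈ A, (1 / ((a : ℂ) + Complex.I * ((-e : ℝ) : ℂ) * ((x - y : ℝ) : ℂ))) *
      (LW.FF e C (LW.pt (x - y) + t) / (Real.log (1 / t) : ℂ))).re) (𝓝[>] 0)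
      (𝓝 (∑ x ∈ A, ∑ y ∈ A, (1 / ((a : ℂ) + Complex.I * ((-e : ℝ) : ℂ) * ((x - y : ℝ) : ℂ))) *
        (e * (-(LW.mm (x-y) : ℂ)) / LW.pt (x-y) + C * (if x - y = 0 then 1 else 0))).re) := by
    refine (Complex.continuous_re.tendsto _).comp ?_
    refine tendsto_finsetSum _ fun x _ => tendsto_finsetSum _ fun y _ => ?_
    exact (LW.FF_lim e C hee hB (x-y)).const_mul _
  have hge := ge_of_tendsto (b := 0) hlim (by
    filter_upwards [Ioo_mem_nhdsGT (show (0:ℝ) < 1 by norm_num)] with t ht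
    have h1 := LW.FF_pos e C hB a (-e) ha A t ht.1
    have h2 : 0 < Real.log (1/t) := Real.log_pos (by rw [lt_div_iff₀ ht.1]; linarith [ht.2])
    have h3 : (∑ x ∈ A, ∑ y ∈ A, (1 / ((a : ℂ) + Complex.I * ((-e : ℝ) : ℂ) * ((x - y : ℝ) : ℂ))) *
      (LW.FF e C (LW.pt (x - y) + t) / (Real.log (1 / t) : ℂ))) =
      (((Real.log (1/t))⁻¹ : ℝ) : ℂ) * ∑ x ∈ A, ∑ y ∈ A, (1 / ((a : ℂ) + Complex.I * ((-e : ℝ) : ℂ) * ((x - y : ℝ) : ℂ))) *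
      LW.FF e C (LW.pt (x - y) + t) := by
      rw [Finset.mul_sum]
      refine Finset.sum_congr rfl fun x _ => ?_
      rw [Finset.mul_sum]
      refine Finset.sum_congr rfl fun y _ => ?_
      push_cast
      ring
    rw [h3, Complex.re_ofReal_mul]
    exact mul_nonneg (inv_pos.mpr h2).le h1)
  rw [Complex.re_sum] at hge
  simp_rw [Complex.re_sum] at hge
  have hterm : ∀ l : ℝ, ((1 / ((a : ℂ) + Complex.I * ((-e : ℝ) : ℂ) * ((l : ℝ) : ℂ))) *
        (e * (-(LW.mm l : ℂ)) / LW.pt l + C * (if l = 0 then 1 else 0))).re ≤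
      -((LW.mm l : ℝ) * ((l^2 - a/2) / ((a^2 + l^2) * (1/4 + l^2)))) + (if l = 0 then C / a else 0) := by
    intro l
    have hp : 0 < (a^2 + l^2) * (1/4 + l^2) := by positivity
    have hne1 : (a : ℂ) + Complex.I * ((-e : ℝ) : ℂ) * ((l : ℝ) : ℂ) ≠ 0 := by
      intro h
      have := congrArg Complex.re h
      simp at this
      linarith
    have hne2 : LW.pt l ≠ 0 := by
      intro h
      have := congrArg Complex.re h
      rw [LW.pt_re] at this
      norm_num at this
    have e1 : (1 / ((a : ℂ) + Complex.I * ((-e : ℝ) : ℂ) * ((l : ℝ) : ℂ))) * (e * (-(LW.mm l : ℂ)) / LW.pt l) =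
        (((-e * LW.mm l / ((a^2 + l^2) * (1/4 + l^2)) : ℝ)) : ℂ) * (((a : ℂ) + Complex.I * e * l) * (1/2 - Complex.I * l)) := by
      have q1 : ((a : ℂ) + Complex.I * ((-e : ℝ) : ℂ) * ((l : ℝ) : ℂ)) * ((a : ℂ) + Complex.I * e * l) = a^2 + l^2 := by
        have hee' : (e:ℂ)*e = 1 := by exact_mod_cast hee
        push_cast
        linear_combination (-(e:ℂ)*e*l^2) * Complex.I_sq + l^2 * hee'
      have q2 : LW.pt l * (1/2 - Complex.I * l) = 1/4 + l^2 := by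
        rw [LW.pt]
        linear_combination (-(l:ℂ)^2) * Complex.I_sq
      have q3 : ((a:ℂ)^2 + l^2) ≠ 0 := by exact_mod_cast (show a^2 + l^2 ≠ 0 by positivity)
      have q4 : ((1/4:ℂ) + l^2) ≠ 0 := by
        have : (1/4 + l^2 : ℝ) ≠ 0 := by positivity
        have h := Complex.ofReal_ne_zero.mpr this
        push_cast at h
        exact h
      have q5 : ((a : ℂ) + Complex.I * e * l) ≠ 0 := by
        rw [← q1] at q3; exact right_ne_zero_of_mul q3
      have q6 : (1/2 - Complex.I * l) ≠ 0 := by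
        rw [← q2] at q4; exact right_ne_zero_of_mul q4
      push_cast at q1 hne1 ⊢
      rw [← q1, ← q2]
      generalize (a:ℂ) + Complex.I * -(e:ℂ) * (l:ℂ) = X1 at *
      generalize (a:ℂ) + Complex.I * (e:ℂ) * (l:ℂ) = X2 at *
      generalize (1/2 - Complex.I * (l:ℂ)) = X3 at *
      generalize LW.pt l = X4 at *
      field_simp
    rw [mul_add, e1, Complex.add_re, Complex.re_ofReal_mul]
    have e2 : ((1 / ((a : ℂ) + Complex.I * ((-e : ℝ) : ℂ) * ((l : ℝ) : ℂ))) * (C * (if l = 0 then 1 else 0))).re = if l = 0 then C / a else 0 := by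
      by_cases hl : l = 0
      · subst hl
        simp only [if_true, Complex.ofReal_zero, mul_zero, add_zero, mul_one]
        rw [← Complex.ofReal_one, ← Complex.ofReal_div, ← Complex.ofReal_mul, Complex.ofReal_re]
        ring
      · simp [hl]
    rw [e2]
    refine add_le_add ?_ le_rfl
    have e3 : (((a : ℂ) + Complex.I * e * l) * (1/2 - Complex.I * l)).re = a/2 + e * l^2 := by
      simp; ring
    rw [e3, show -((LW.mm l : ℝ) * ((l^2 - a/2) / ((a^2 + l^2) * (1/4 + l^2)))) = ((LW.mm l : ℝ) * (a/2 - l^2)) / ((a^2 + l^2) * (1/4 + l^2)) by ring]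
    rw [div_mul_eq_mul_div, div_le_div_iff_of_pos_right hp]
    have hm : (0:ℝ) ≤ LW.mm l := Nat.cast_nonneg _
    rcases he with rfl | rfl
    · nlinarith [mul_nonneg hm ha.le]
    · nlinarith
  have hsum := hge.trans (Finset.sum_le_sum fun x _ => Finset.sum_le_sum fun y _ => hterm (x - y))
  have hdiag : ∑ x ∈ A, ∑ y ∈ A, (if x - y = 0 then C / a else 0) = C / a * A.card := by
    have : ∀ x ∈ A, ∑ y ∈ A, (if x - y = 0 then C / a else 0) = C / a := by
      intro x hx
      simp_rw [sub_eq_zero]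
      rw [Finset.sum_ite_eq, if_pos hx]
    rw [Finset.sum_congr rfl this, Finset.sum_const, nsmul_eq_mul, mul_comm]
  simp_rw [Finset.sum_add_distrib, Finset.sum_neg_distrib] at hsum
  rw [hdiag] at hsum
  linarith

lemma LW.zero_sum (e C : ℝ) (he : e = 1 ∨ e = -1) (hB : ∀ x, 2 < x → 0 ≤ LW.wB e C x) (a : ℝ) (ha : 1/2 < a)
    (S : Finset ℝ) (hS : ∀ l, l ∉ S → l^2 < a/2 → LW.mm l = 0) :
    ∑ l ∈ S, (LW.mm l : ℝ) * (a / (a^2 + l^2) - (1/2) / (1/4 + l^2)) ≤ |C| := by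
  have ha0 : 0 < a := by linarith
  have h1 := LW.pair_ineq (fun l => (LW.mm l : ℝ) * ((l^2 - a/2) / ((a^2 + l^2) * (1/4 + l^2)))) S ?_ (C / a)
    (fun A _ => LW.pair_bound e C he hB a ha0 A)
  · have h2 : ∀ l : ℝ, (LW.mm l : ℝ) * (a / (a^2 + l^2) - (1/2) / (1/4 + l^2)) =
      (a - 1/2) * ((LW.mm l : ℝ) * ((l^2 - a/2) / ((a^2 + l^2) * (1/4 + l^2)))) := by
      intro l
      have : a^2 + l^2 ≠ 0 := by positivity
      have : 1/4 + l^2 ≠ 0 := by positivity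
      field_simp
      ring
    simp_rw [h2]
    rw [← Finset.mul_sum]
    refine (mul_le_mul_of_nonneg_left h1 (by linarith)).trans ?_
    rw [← mul_div_assoc, div_le_iff₀ ha0]
    have := le_abs_self C
    nlinarith [abs_nonneg C]
  · intro l hl
    by_cases h : l^2 < a/2
    · simp [hS l hl h]
    · have : 0 ≤ l^2 - a/2 := by linarith
      positivity

open MeasureTheory ProbabilityTheory Filter Topology

lemma LW.divide (f : ℂ → ℂ) (hf : Differentiable ℂ f) (ρ : ℂ) (h0 : ρ ≠ 0) (ho : analyticOrderAt f ρ ≠ ⊤) :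
    ∃ g : ℂ → ℂ, Differentiable ℂ g ∧ g ρ ≠ 0 ∧
      ∀ z, f z = (1 - z / ρ) ^ (analyticOrderNatAt f ρ) * g z := by
  obtain ⟨g, hg, hg0, hev⟩ := ((hf.analyticAt ρ).analyticOrderAt_ne_top).mp ho
  set n := analyticOrderNatAt f ρ with hn
  have hne : ∀ z, z ≠ ρ → (1 - z / ρ) ^ n ≠ 0 := by
    intro z hz
    apply pow_ne_zero
    rw [sub_ne_zero]
    intro h
    apply hz
    field_simp at h
    exact h.symm
  have hsub : ∀ z, (z - ρ) = (1 - z / ρ) * (-ρ) := by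
    intro z; field_simp; ring
  let G : ℂ → ℂ := Function.update (fun z => f z / (1 - z / ρ) ^ n) ρ ((-ρ) ^ n * g ρ)
  have hGev : G =ᶠ[𝓝 ρ] fun z => (-ρ) ^ n * g z := by
    filter_upwards [hev] with z hz
    by_cases h : z = ρ
    · subst h; simp [G]
    · have : G z = f z / (1 - z / ρ) ^ n := by simp [G, h]
      rw [this, hz, smul_eq_mul, hsub, mul_pow]
      have := hne z h
      field_simp
  refine ⟨G, ?_, ?_, ?_⟩
  · intro z
    by_cases h : z = ρ
    · subst h
      exact ((hg.differentiableAt).const_mul _).congr_of_eventuallyEq hGev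
    · have : G =ᶠ[𝓝 z] fun z => f z / (1 - z / ρ) ^ n := by
        filter_upwards [isOpen_ne.mem_nhds h] with w hw
        simp only [G]
        rw [Function.update_of_ne hw]
      refine DifferentiableAt.congr_of_eventuallyEq ?_ this
      exact (hf z).div (by fun_prop) (hne z h)
  · simp only [G, Function.update_self]
    exact mul_ne_zero (pow_ne_zero _ (neg_ne_zero.mpr h0)) hg0
  · intro z
    by_cases h : z = ρ
    · subst h
      have h1 := hev.self_of_nhds
      rw [h1, hGev.self_of_nhds]
      simp only [smul_eq_mul]
      rw [hsub, mul_pow]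
      ring
    · have : G z = f z / (1 - z / ρ) ^ n := by simp [G, h]
      rw [this]
      have := hne z h
      field_simp

lemma LW.factor (f : ℂ → ℂ) (hf : Differentiable ℂ f) (ho : ∀ z, analyticOrderAt f z ≠ ⊤)
    (T : Finset ℂ) : (∀ ρ ∈ T, ρ ≠ 0) →
    ∃ g : ℂ → ℂ, Differentiable ℂ g ∧ (∀ ρ ∈ T, g ρ ≠ 0) ∧
      ∀ z, f z = (∏ ρ ∈ T, (1 - z / ρ) ^ (analyticOrderNatAt f ρ)) * g z := by
  induction T using Finset.induction_on with
  | empty => intro _; exact ⟨f, hf, by simp, by simp⟩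
  | insert a T ha ih =>
    intro hT
    obtain ⟨g, hg, hg0, hfg⟩ := ih (fun ρ hρ => hT ρ (Finset.mem_insert_of_mem hρ))
    have ha0 : a ≠ 0 := hT a (Finset.mem_insert_self _ _)
    let P : ℂ → ℂ := fun z => ∏ ρ ∈ T, (1 - z / ρ) ^ (analyticOrderNatAt f ρ)
    have hP : Differentiable ℂ P := by
      intro z
      have : P = fun z => ∏ ρ ∈ T, (fun z => (1 - z / ρ) ^ (analyticOrderNatAt f ρ)) z := rfl
      rw [this]
      apply DifferentiableAt.fun_finsetProd
      intro i _
      fun_prop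
    have hPa : P a ≠ 0 := by
      refine Finset.prod_ne_zero_iff.mpr fun ρ hρ => pow_ne_zero _ ?_
      intro h
      have hρ0 := hT ρ (Finset.mem_insert_of_mem hρ)
      rw [sub_eq_zero] at h
      field_simp at h
      exact ha (h ▸ hρ)
    have hfe : f = P * g := by ext z; exact hfg z
    have hord : analyticOrderAt f a = analyticOrderAt g a := by
      rw [hfe, analyticOrderAt_mul (hP.analyticAt a) (hg.analyticAt a),
        (hP.analyticAt a).analyticOrderAt_eq_zero.mpr hPa, zero_add]
    have hordN : analyticOrderNatAt f a = analyticOrderNatAt g a := by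
      rw [analyticOrderNatAt, hord, analyticOrderNatAt]
    obtain ⟨G, hG, hGa, hgG⟩ := LW.divide g hg a ha0 (hord ▸ ho a)
    refine ⟨G, hG, ?_, ?_⟩
    · intro ρ hρ
      rcases Finset.mem_insert.mp hρ with rfl | h
      · exact hGa
      · have := hg0 ρ h
        rw [hgG] at this
        exact right_ne_zero_of_mul this
    · intro z
      rw [Finset.prod_insert ha, hfg z, hgG z, hordN]
      ring

lemma LW.borel (g : ℂ → ℂ) (hg : Differentiable ℂ g) (g0 : g 0 = 1) (R M : ℝ) (hR : 0 < R) (hM : 0 < M)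
    (hne : ∀ z, ‖z‖ < R / 2 → g z ≠ 0) (hb : ∀ z, ‖z‖ < R → ‖g z‖ ≤ Real.exp M)
    (z : ℂ) (hz : ‖z‖ < R / 4) :
    Real.log ‖g z‖ ≤ (deriv g 0 * z).re + 64 * M * ‖z‖ ^ 2 / R ^ 2 := by
  have hd : DifferentiableOn ℂ (fun z => deriv g z / g z) (Metric.ball 0 (R/2)) := by
    intro w hw
    have := hne w (by simpa using hw)
    exact (((hg.analyticAt w).deriv.differentiableAt).div (hg w) this).differentiableWithinAt
  obtain ⟨h, h0, hh⟩ := hd.isExactOn_ball.with_val_at 0 0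
  have hexp : ∀ w ∈ Metric.ball (0:ℂ) (R/2), g w = Complex.exp (h w) := by
    have hc : ∀ w ∈ Metric.ball (0:ℂ) (R/2), HasDerivAt (fun w => g w * Complex.exp (-h w)) 0 w := by
      intro w hw
      have h1 := (hg w).hasDerivAt.mul ((hh w hw).neg.cexp)
      refine h1.congr_deriv ?_
      have := hne w (by simpa using hw)
      field_simp
      simp
    intro w hw
    have h2 := (convex_ball (0:ℂ) (R/2)).is_const_of_fderivWithin_eq_zero (𝕜 := ℂ) (f := fun w => g w * Complex.exp (-h w))
      (fun w hw => (hc w hw).differentiableAt.differentiableWithinAt)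
      (fun w hw => by
        rw [fderivWithin_of_isOpen Metric.isOpen_ball hw]
        ext
        rw [(hc w hw).hasFDerivAt.fderiv]; simp) hw (Metric.mem_ball_self (by linarith : 0 < R/2))
    simp only [g0, h0, neg_zero, Complex.exp_zero, mul_one] at h2
    rw [Complex.exp_neg] at h2
    have := Complex.exp_ne_zero (h w)
    field_simp at h2
    exact h2
  have hre : ∀ w ∈ Metric.ball (0:ℂ) (R/2), (h w).re ≤ M := by
    intro w hw
    have h1 := hb w (by have : ‖w‖ < R/2 := by simpa using hw
                        linarith)
    rw [hexp w hw, Complex.norm_exp] at h1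
    exact Real.exp_le_exp.mp h1
  have hdh : DifferentiableOn ℂ h (Metric.ball 0 (R/2)) := fun w hw => (hh w hw).differentiableAt.differentiableWithinAt
  have hnorm : ∀ w ∈ Metric.ball (0:ℂ) (R/4), ‖h w‖ ≤ 2 * M := by
    intro w hw
    have hw' : ‖w‖ < R/4 := by simpa using hw
    have h1 := Complex.borelCaratheodory_zero hM hdh hre (by linarith : 0 < R/2) (z := w) (by simp; linarith) h0
    refine h1.trans ?_
    rw [div_le_iff₀ (by linarith)]
    nlinarith
  have hh0 := hh 0 (Metric.mem_ball_self (by linarith : 0 < R/2))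
  have hmem0 : (0:ℂ) ∈ Metric.ball (0:ℂ) (R/4) := Metric.mem_ball_self (by linarith)
  rw [g0, div_one] at hh0
  have hsub : Metric.ball (0:ℂ) (R/4) ⊆ Metric.ball 0 (R/2) := Metric.ball_subset_ball (by linarith)
  have hder : ‖deriv g 0‖ ≤ 2 * M / (R / 4) := by
    rw [← hh0.deriv]
    refine Complex.norm_deriv_le_div_of_mapsTo_ball (hdh.mono hsub) ?_ (by linarith)
    intro w hw
    rw [h0]
    simpa using hnorm w hw
  have hφ := Complex.dist_le_mul_div_pow_of_mapsTo_ball_of_isLittleO (n := 1) (f := fun w => h w - deriv g 0 * w)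
    (c := 0) (z := z) (R₁ := R/4) (R₂ := 4 * M) ((hdh.mono hsub).sub (by fun_prop)) ?_ ?_ (by simpa using hz)
  · simp only [h0, mul_zero, sub_zero, dist_zero_right] at hφ
    rw [hexp z (by simp; linarith), Complex.norm_exp, Real.log_exp]
    have h3 : (h z).re = (deriv g 0 * z).re + (h z - deriv g 0 * z).re := by rw [Complex.sub_re]; ring
    rw [h3]
    have h4 := (Complex.re_le_norm (h z - deriv g 0 * z)).trans hφ
    have h5 : 4 * M * (‖z‖ / (R / 4)) ^ (1 + 1) = 64 * M * ‖z‖ ^ 2 / R ^ 2 := by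
      rw [div_div_eq_mul_div, div_pow, mul_pow]; ring
    linarith
  · intro w hw
    have hw' : ‖w‖ < R/4 := by simpa using hw
    simp only [h0, mul_zero, sub_zero, Metric.mem_closedBall, dist_zero_right]
    refine (norm_sub_le _ _).trans ?_
    rw [norm_mul]
    have h1 := hnorm w hw
    have h2 : ‖deriv g 0‖ * ‖w‖ ≤ 2 * M / (R/4) * (R/4) := by
      gcongr
    rw [div_mul_cancel₀ _ (by positivity)] at h2
    linarith
  · have h1 := hasDerivAt_iff_isLittleO.mp hh0
    simp only [h0, mul_zero, sub_zero, pow_one]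
    simp only [h0, sub_zero, smul_eq_mul] at h1
    refine h1.norm_right.congr_left fun w => by ring

lemma LW.hadamard (f : ℂ → ℂ) (hf : Differentiable ℂ f) (f0 : f 0 = 1) (ho : ∀ z, analyticOrderAt f z ≠ ⊤)
    (R M : ℝ) (hR : 0 < R) (hM : 0 < M) (T : Finset ℂ) (hT : ∀ ρ, ρ ∈ T ↔ f ρ = 0 ∧ ‖ρ‖ ≤ R / 2)
    (hb : ∀ z, ‖z‖ ≤ R → ‖f z‖ ≤ Real.exp M) (z : ℂ) (hz : ‖z‖ < R / 4) (hfz : f z ≠ 0) :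
    Real.log ‖f z‖ ≤ (deriv f 0 * z).re + 64 * M * ‖z‖ ^ 2 / R ^ 2 +
      ∑ ρ ∈ T, (analyticOrderNatAt f ρ : ℝ) * (Real.log ‖1 - z / ρ‖ + (z / ρ).re) := by
  have hT0 : ∀ ρ ∈ T, ρ ≠ 0 := by
    rintro ρ hρ rfl
    have := ((hT 0).mp hρ).1
    rw [f0] at this
    exact one_ne_zero this
  obtain ⟨g, hg, hg0, hfg⟩ := LW.factor f hf ho T hT0
  have g0 : g 0 = 1 := by
    have := hfg 0
    simp [f0] at this
    exact this.symm
  have hne : ∀ z, ‖z‖ < R / 2 → g z ≠ 0 := by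
    intro w hw h
    have h1 : f w = 0 := by rw [hfg, h, mul_zero]
    exact hg0 w ((hT w).mpr ⟨h1, hw.le⟩) h
  have hsph : ∀ w, ‖w‖ = R → ‖g w‖ ≤ Real.exp M := by
    intro w hw
    refine le_trans ?_ (hb w hw.le)
    rw [hfg w, norm_mul]
    refine le_mul_of_one_le_left (norm_nonneg _) ?_
    rw [norm_prod]
    refine Finset.one_le_prod fun ρ hρ => ?_
    rw [norm_pow]
    refine one_le_pow₀ ?_
    have h1 := ((hT ρ).mp hρ).2
    have h2 : 0 < ‖ρ‖ := norm_pos_iff.mpr (hT0 ρ hρ)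
    have h3 : 2 ≤ ‖w / ρ‖ := by
      rw [norm_div, hw, le_div_iff₀ h2]; linarith
    have h4 := norm_sub_norm_le (w / ρ) 1
    rw [norm_sub_rev, norm_one] at h4
    linarith
  have hbg : ∀ w, ‖w‖ < R → ‖g w‖ ≤ Real.exp M := by
    intro w hw
    refine Complex.norm_le_of_forall_mem_frontier_norm_le (U := Metric.ball 0 R) Metric.isBounded_ball hg.diffContOnCl ?_ (subset_closure (by simpa using hw))
    intro u hu
    rw [frontier_ball _ hR.ne'] at hu
    exact hsph u (by simpa using hu)
  have key := LW.borel g hg g0 R M hR hM hne hbg z hz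
  have hzT : ∀ ρ ∈ T, 1 - z / ρ ≠ 0 := by
    intro ρ hρ h
    rw [sub_eq_zero] at h
    have := hT0 ρ hρ
    field_simp at h
    rw [← h] at hfz
    exact hfz ((hT ρ).mp hρ).1
  have hder : deriv g 0 = deriv f 0 + ∑ ρ ∈ T, (analyticOrderNatAt f ρ : ℂ) / ρ := by
    have h1 : logDeriv f 0 = deriv f 0 := by rw [logDeriv_apply, f0, div_one]
    have h2 : logDeriv g 0 = deriv g 0 := by rw [logDeriv_apply, g0, div_one]
    have h3 : f = fun z => (∏ ρ ∈ T, (1 - z / ρ) ^ (analyticOrderNatAt f ρ)) * g z := funext hfg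
    have hd : ∀ ρ ∈ T, DifferentiableAt ℂ (fun z : ℂ => (1 - z / ρ) ^ (analyticOrderNatAt f ρ)) 0 := by
      intro ρ _; fun_prop
    have h4 : logDeriv f 0 = logDeriv (fun z => ∏ ρ ∈ T, (1 - z / ρ) ^ (analyticOrderNatAt f ρ)) 0 + logDeriv g 0 := by
      conv_lhs => rw [h3]
      refine logDeriv_mul (f := fun z => ∏ ρ ∈ T, (1 - z / ρ) ^ (analyticOrderNatAt f ρ)) (g := g) 0 (by simp) (by rw [g0]; exact one_ne_zero) ?_ (hg 0)
      exact DifferentiableAt.fun_finsetProd hd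
    have h5 : logDeriv (fun z => ∏ ρ ∈ T, (1 - z / ρ) ^ (analyticOrderNatAt f ρ)) 0 = ∑ ρ ∈ T, -((analyticOrderNatAt f ρ : ℂ) / ρ) := by
      rw [logDeriv_prod (by simp) hd]
      refine Finset.sum_congr rfl fun ρ hρ => ?_
      rw [logDeriv_fun_pow (by fun_prop), logDeriv_apply]
      have : HasDerivAt (fun z : ℂ => 1 - z / ρ) (-(1 / ρ)) 0 := ((hasDerivAt_id (0:ℂ)).div_const ρ).const_sub 1
      rw [this.deriv]
      simp
      ring
    rw [h1, h2, h5, Finset.sum_neg_distrib] at h4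
    rw [h4]; ring
  have hlog : Real.log ‖f z‖ = ∑ ρ ∈ T, (analyticOrderNatAt f ρ : ℝ) * Real.log ‖1 - z / ρ‖ + Real.log ‖g z‖ := by
    rw [hfg z, norm_mul, Real.log_mul, norm_prod, Real.log_prod]
    · congr 1
      refine Finset.sum_congr rfl fun ρ _ => ?_
      rw [norm_pow, Real.log_pow]
    · intro ρ hρ
      exact norm_ne_zero_iff.mpr (pow_ne_zero _ (hzT ρ hρ))
    · exact norm_ne_zero_iff.mpr (Finset.prod_ne_zero_iff.mpr fun ρ hρ => pow_ne_zero _ (hzT ρ hρ))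
    · exact norm_ne_zero_iff.mpr (hne z (by linarith))
  have h6 : (deriv g 0 * z).re = (deriv f 0 * z).re + ∑ ρ ∈ T, (analyticOrderNatAt f ρ : ℝ) * (z / ρ).re := by
    rw [hder, add_mul, Complex.add_re, Finset.sum_mul, Complex.re_sum]
    congr 1
    refine Finset.sum_congr rfl fun ρ _ => ?_
    rw [show (analyticOrderNatAt f ρ : ℂ) / ρ * z = ((analyticOrderNatAt f ρ : ℝ) : ℂ) * (z / ρ) by push_cast; ring, Complex.re_ofReal_mul]
  simp_rw [mul_add, Finset.sum_add_distrib]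
  rw [hlog]
  linarith

open MeasureTheory ProbabilityTheory Filter Topology

noncomputable def LW.xi (s : ℂ) : ℂ := s * (s - 1) * completedRiemannZeta₀ s + 1

lemma LW.xi_diff : Differentiable ℂ LW.xi := by
  have := differentiable_completedZeta₀
  unfold LW.xi
  fun_prop

lemma LW.xi_symm (s : ℂ) : LW.xi (1 - s) = LW.xi s := by
  rw [LW.xi, LW.xi, completedRiemannZeta₀_one_sub]
  ring

lemma LW.xi_one : LW.xi 1 = 1 := by simp [LW.xi]

lemma LW.xi_eq (s : ℂ) (hs : 0 < s.re) : LW.xi s = s * Complex.Gammaℝ s * riemannZeta₁ s := by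
  by_cases h1 : s = 1
  · subst h1
    simp [LW.xi_one, riemannZeta₁_one]
  · have h0 : s ≠ 0 := by rintro rfl; simp at hs
    have hG := Complex.Gammaℝ_ne_zero_of_re_pos hs
    have e1 := riemannZeta_def_of_ne_zero h0
    rw [riemannZeta_eq_inv_sub_mul h1, completedRiemannZeta_eq] at e1
    have h2 : s - 1 ≠ 0 := sub_ne_zero.mpr h1
    have h3 : 1 - s ≠ 0 := sub_ne_zero.mpr (Ne.symm h1)
    have e2 : riemannZeta₁ s = (s - 1) * ((completedRiemannZeta₀ s - 1 / s - 1 / (1 - s)) / Complex.Gammaℝ s) := by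
      rw [← e1]; field_simp
    rw [e2, LW.xi]
    field_simp
    ring

lemma LW.Gamma_bound (w : ℂ) (N : ℕ) (h1 : 1/4 ≤ w.re) (h2 : w.re ≤ N + 1) :
    ‖Complex.Gamma w‖ ≤ Real.Gamma (1/4) + N.factorial := by
  rw [Complex.Gamma_eq_integral (by linarith), Complex.GammaIntegral,
    ← Real.Gamma_nat_eq_factorial, Real.Gamma_eq_integral (by norm_num), Real.Gamma_eq_integral (by positivity),
    ← integral_add (Real.GammaIntegral_convergent (by norm_num)) (Real.GammaIntegral_convergent (by positivity))]
  refine norm_integral_le_of_norm_le ((Real.GammaIntegral_convergent (by norm_num)).add (Real.GammaIntegral_convergent (by positivity))) ?_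
  refine (ae_restrict_mem measurableSet_Ioi).mono fun x hx => ?_
  have hx : 0 < x := hx
  rw [norm_mul, Complex.norm_real, Real.norm_eq_abs, Real.abs_exp, Complex.norm_cpow_eq_rpow_re_of_pos hx, ← mul_add]
  refine mul_le_mul_of_nonneg_left ?_ (Real.exp_pos _).le
  rw [Complex.sub_re, Complex.one_re]
  rcases le_total x 1 with h | h
  · refine (Real.rpow_le_rpow_of_exponent_ge hx h (show (1/4 - 1 : ℝ) ≤ w.re - 1 by linarith)).trans ?_
    have := Real.rpow_nonneg hx.le ((N:ℝ) + 1 - 1)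
    linarith
  · refine (Real.rpow_le_rpow_of_exponent_le h (show w.re - 1 ≤ (N:ℝ) + 1 - 1 by linarith)).trans ?_
    have := Real.rpow_nonneg hx.le (1/4 - 1 : ℝ)
    linarith

lemma LW.zeta1_bound (s : ℂ) (hs : 1/2 ≤ s.re) :
    ‖riemannZeta₁ s‖ ≤ ‖s‖ + ‖s‖ * (‖s‖ + 1) * mgf Real.log (LW.nu LW.wfr 1) (-(1/2)) := by
  rw [LW.zeta1_formula s (by linarith)]
  refine (norm_sub_le _ _).trans (add_le_add le_rfl ?_)
  rw [norm_mul, norm_mul]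
  have h1 : ‖s - 1‖ ≤ ‖s‖ + 1 := (norm_sub_le _ _).trans (by simp)
  have h2 : ‖complexMGF Real.log (LW.nu LW.wfr 1) (-s)‖ ≤ mgf Real.log (LW.nu LW.wfr 1) (-(1/2)) := by
    refine norm_complexMGF_le_mgf.trans ?_
    refine integral_mono_ae (LW.wfr_mem _ (by rw [Complex.neg_re]; linarith)) (LW.wfr_mem _ (by norm_num)) ?_
    refine LW.nu_ae fun x hx => ?_
    refine Real.exp_le_exp.mpr (mul_le_mul_of_nonneg_right ?_ (Real.log_nonneg hx.le))
    rw [Complex.neg_re]; linarith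
  gcongr

lemma LW.xi_bound (s : ℂ) (hs : 1/2 ≤ s.re) (r : ℝ) (N : ℕ) (hr : ‖s‖ ≤ r) (hN : r ≤ N) :
    ‖LW.xi s‖ ≤ r * (Real.Gamma (1/4) + N.factorial) * (r + r * (r + 1) * mgf Real.log (LW.nu LW.wfr 1) (-(1/2))) := by
  have hG : 0 < Real.Gamma (1/4) := Real.Gamma_pos_of_pos (by norm_num)
  have hm : 0 ≤ mgf Real.log (LW.nu LW.wfr 1) (-(1/2)) := mgf_nonneg
  have hr0 : 0 ≤ r := (norm_nonneg s).trans hr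
  rw [LW.xi_eq s (by linarith), norm_mul, norm_mul]
  have h1 : ‖Complex.Gammaℝ s‖ ≤ Real.Gamma (1/4) + N.factorial := by
    rw [Complex.Gammaℝ_def, norm_mul]
    have e : (s / 2).re = s.re / 2 := by
      rw [show s / 2 = s / ((2:ℝ):ℂ) by norm_num, Complex.div_ofReal_re]
    have h2 := LW.Gamma_bound (s/2) N (by rw [e]; linarith) (by
      rw [e]
      have := Complex.re_le_norm s
      linarith)
    refine le_trans ?_ h2
    refine mul_le_of_le_one_left (norm_nonneg _) ?_
    rw [Complex.norm_cpow_eq_rpow_re_of_pos Real.pi_pos]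
    refine Real.rpow_le_one_of_one_le_of_nonpos (by linarith [Real.pi_gt_three]) ?_
    rw [neg_div, Complex.neg_re, e]; linarith
  have h3 := LW.zeta1_bound s hs
  have h4 : ‖s‖ + ‖s‖ * (‖s‖ + 1) * mgf Real.log (LW.nu LW.wfr 1) (-(1/2)) ≤ r + r * (r + 1) * mgf Real.log (LW.nu LW.wfr 1) (-(1/2)) := by
    gcongr
  have h5 := h3.trans h4
  gcongr

lemma LW.xi_growth (δ : ℝ) (hδ : 0 < δ) : ∀ᶠ R : ℝ in atTop, ∀ z : ℂ, ‖z‖ ≤ R → ‖LW.xi (1 + z)‖ ≤ Real.exp (δ * R ^ 2) := by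
  have hG : 0 < Real.Gamma (1/4) := Real.Gamma_pos_of_pos (by norm_num)
  have hm : 0 ≤ mgf Real.log (LW.nu LW.wfr 1) (-(1/2)) := mgf_nonneg
  set G := Real.Gamma (1/4)
  set K := mgf Real.log (LW.nu LW.wfr 1) (-(1/2))
  set D : ℝ := 2 * (G + 1) * (2 + 6 * K) with hD
  have hDpos : 0 < D := by positivity
  have hlog : ∀ᶠ R : ℝ in atTop, Real.log (3 * R) ≤ δ / 40 * (3 * R) := by
    have h := (Real.isLittleO_log_id_atTop.bound (show 0 < δ/40 by positivity))
    have h2 : Tendsto (fun R : ℝ => 3 * R) atTop atTop := tendsto_id.const_mul_atTop (by norm_num)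
    filter_upwards [h2.eventually h, eventually_ge_atTop 1] with R h3 h4
    simp only [id] at h3
    rw [Real.norm_of_nonneg (Real.log_nonneg (by linarith)), Real.norm_of_nonneg (by linarith)] at h3
    exact h3
  have hDl : ∀ᶠ R : ℝ in atTop, Real.log D ≤ δ / 40 * R := by
    have h2 : Tendsto (fun R : ℝ => δ / 40 * R) atTop atTop := tendsto_id.const_mul_atTop (by positivity)
    exact h2.eventually_ge_atTop _
  filter_upwards [hlog, hDl, eventually_ge_atTop 1] with R h1 h2 hR z hz
  set N := ⌈2 * R⌉₊ with hN
  have hN1 : 2 * R ≤ N := Nat.le_ceil _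
  have hN2 : (N:ℝ) ≤ 3 * R := by
    have := Nat.ceil_lt_add_one (show 0 ≤ 2 * R by linarith)
    linarith
  have hb : ‖LW.xi (1 + z)‖ ≤ 2 * R * (G + N.factorial) * (2 * R + 2 * R * (2 * R + 1) * K) := by
    rcases le_total (1/2) (1 + z).re with h | h
    · refine LW.xi_bound _ h (2 * R) N ?_ hN1
      refine (norm_add_le _ _).trans ?_
      rw [norm_one]; linarith
    · rw [← LW.xi_symm]
      refine LW.xi_bound _ (by rw [Complex.sub_re, Complex.one_re]; linarith) (2 * R) N ?_ hN1
      rw [show 1 - (1 + z) = -z by ring, norm_neg]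
      linarith
  refine hb.trans ?_
  have hfac : (N.factorial : ℝ) ≤ (3 * R) ^ (3 * R) := by
    have a1 : (N.factorial : ℝ) ≤ (N:ℝ) ^ N := by exact_mod_cast Nat.factorial_le_pow N
    refine a1.trans ?_
    rw [← Real.rpow_natCast]
    refine (Real.rpow_le_rpow (by positivity) hN2 (by positivity)).trans ?_
    exact Real.rpow_le_rpow_of_exponent_le (by linarith) hN2
  have hone : (1:ℝ) ≤ (3 * R) ^ (3 * R) := Real.one_le_rpow (by linarith) (by linarith)
  have step : 2 * R * (G + N.factorial) * (2 * R + 2 * R * (2 * R + 1) * K) ≤ D * R ^ 3 * (3 * R) ^ (3 * R) := by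
    have a1 : G + N.factorial ≤ (G + 1) * (3 * R) ^ (3 * R) := by nlinarith
    have a2 : 2 * R + 2 * R * (2 * R + 1) * K ≤ R ^ 2 * (2 + 6 * K) := by
      have : 2 * R + 1 ≤ 3 * R := by linarith
      have b1 : 2 * R * (2 * R + 1) * K ≤ 2 * R * (3 * R) * K := by gcongr
      nlinarith
    calc _ ≤ 2 * R * ((G + 1) * (3 * R) ^ (3 * R)) * (R ^ 2 * (2 + 6 * K)) := by gcongr
      _ = _ := by rw [hD]; ring
  refine step.trans ?_
  have e1 : D * R ^ 3 * (3 * R) ^ (3 * R) = Real.exp (Real.log D + 3 * Real.log R + Real.log (3 * R) * (3 * R)) := by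
    rw [Real.exp_add, Real.exp_add, Real.exp_log hDpos, ← Real.rpow_def_of_pos (by linarith), mul_comm 3 (Real.log R), Real.exp_mul, Real.exp_log (by linarith)]
    norm_num
  rw [e1]
  refine Real.exp_le_exp.mpr ?_
  have h3 : Real.log R ≤ Real.log (3 * R) := Real.log_le_log (by linarith) (by linarith)
  have h4 : Real.log (3 * R) * (3 * R) ≤ δ / 40 * (3 * R) * (3 * R) := by gcongr
  have h5 : δ * R ≤ δ * R ^ 2 := by gcongr; nlinarith
  nlinarith

lemma LW.xi_zero (e C : ℝ) (he : e * e = 1) (hB : ∀ x, 2 < x → 0 ≤ LW.wB e C x) (s : ℂ) (hs : 1/2 < s.re) :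
    LW.xi s ≠ 0 := by
  obtain ⟨c, hc, h⟩ := LW.zeta1_exp e C he hB
  rw [LW.xi_eq s (by linarith), h s hs]
  refine mul_ne_zero (mul_ne_zero ?_ (Complex.Gammaℝ_ne_zero_of_re_pos (by linarith))) (mul_ne_zero hc (Complex.exp_ne_zero _))
  rintro rfl
  norm_num at hs

lemma LW.xi_re (e C : ℝ) (he : e * e = 1) (hB : ∀ x, 2 < x → 0 ≤ LW.wB e C x) (s : ℂ) (hs : LW.xi s = 0) :
    s.re = 1/2 := by
  rcases lt_trichotomy s.re (1/2) with h | h | h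
  · exfalso
    rw [← LW.xi_symm] at hs
    exact LW.xi_zero e C he hB (1 - s) (by rw [Complex.sub_re, Complex.one_re]; linarith) hs
  · exact h
  · exact absurd hs (LW.xi_zero e C he hB s h)

lemma LW.xi_order (l : ℝ) : analyticOrderAt LW.xi (LW.pt l) = analyticOrderAt riemannZeta₁ (LW.pt l) := by
  have hpos : {s : ℂ | 0 < s.re} ∈ 𝓝 (LW.pt l) := (LW.halfplane_open 0).mem_nhds (by
    rw [Set.mem_ofPred_eq, LW.pt_re]; norm_num)
  let U : ℂ → ℂ := fun s => s * Complex.Gammaℝ s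
  have hU : AnalyticAt ℂ U (LW.pt l) := by
    rw [Complex.analyticAt_iff_eventually_differentiableAt]
    filter_upwards [hpos] with s hs
    have hs : 0 < s.re := hs
    refine differentiableAt_id.mul ?_
    have h1 : DifferentiableAt ℂ (fun s : ℂ => (Real.pi : ℂ) ^ (-s / 2)) s :=
      DifferentiableAt.const_cpow (by fun_prop) (Or.inl (by exact_mod_cast Real.pi_ne_zero))
    have h2 : DifferentiableAt ℂ (fun s : ℂ => Complex.Gamma (s / 2)) s := by
      refine DifferentiableAt.comp s (g := Complex.Gamma) (f := fun s => s / 2) ?_ (by fun_prop)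
      refine Complex.differentiableAt_Gamma _ fun m h => ?_
      have := congrArg Complex.re h
      rw [show s / 2 = s / ((2:ℝ):ℂ) by norm_num, Complex.div_ofReal_re, Complex.neg_re, Complex.natCast_re] at this
      have hm : (0:ℝ) ≤ m := Nat.cast_nonneg m
      linarith
    exact h1.mul h2
  have hev : LW.xi =ᶠ[𝓝 (LW.pt l)] U * riemannZeta₁ := by
    filter_upwards [hpos] with s hs
    exact LW.xi_eq s hs
  have hre : 0 < (LW.pt l).re := by rw [LW.pt_re]; norm_num
  have hU0 : U (LW.pt l) ≠ 0 := by
    refine mul_ne_zero ?_ (Complex.Gammaℝ_ne_zero_of_re_pos hre)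
    intro h
    rw [h] at hre
    simp at hre
  rw [analyticOrderAt_congr hev, analyticOrderAt_mul hU (differentiable_riemannZeta₁.analyticAt _),
    hU.analyticOrderAt_eq_zero.mpr hU0, zero_add]

open MeasureTheory ProbabilityTheory Filter Topology

lemma LW.finite_zeros (f : ℂ → ℂ) (hf : Differentiable ℂ f) (f0 : f 0 = 1) (r : ℝ) :
    {ρ : ℂ | f ρ = 0 ∧ ‖ρ‖ ≤ r}.Finite := by
  by_contra hinf
  obtain ⟨x, hx, hacc⟩ := Set.Infinite.exists_accPt_of_subset_isCompact (K := Metric.closedBall (0:ℂ) r) hinf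
    (isCompact_closedBall _ _) (fun ρ hρ => by simpa using hρ.2)
  have hA : AnalyticOnNhd ℂ f Set.univ := fun z _ => hf.analyticAt z
  have h1 : ∃ᶠ z in 𝓝[≠] x, f z = 0 :=
    (accPt_iff_frequently_nhdsNE.mp hacc).mono fun z hz => hz.1
  have h2 := hA.eqOn_zero_of_preconnected_of_frequently_eq_zero isPreconnected_univ (Set.mem_univ x) h1
  have := h2 (Set.mem_univ 0)
  rw [f0] at this
  exact one_ne_zero this

lemma LW.term (a l : ℝ) (ha : 1/2 < a) :
    Real.log ‖1 - ((a - 1/2 : ℝ) : ℂ) / (LW.pt l - 1)‖ + (((a - 1/2 : ℝ) : ℂ) / (LW.pt l - 1)).re =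
      1/2 * Real.log ((a^2 + l^2) / (1/4 + l^2)) - (a - 1/2) * ((1/2) / (1/4 + l^2)) := by
  have hp : 0 < 1/4 + l^2 := by positivity
  have hsq : Complex.normSq (LW.pt l - 1) = 1/4 + l^2 := by
    rw [Complex.normSq_apply]; simp [LW.pt]; ring
  have hne : LW.pt l - 1 ≠ 0 := by
    intro h; rw [h] at hsq; simp at hsq; linarith
  have h1 : (((a - 1/2 : ℝ) : ℂ) / (LW.pt l - 1)).re = -((a - 1/2) * ((1/2) / (1/4 + l^2))) := by
    rw [Complex.div_re, hsq]
    simp [LW.pt]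
    ring
  have h2 : ‖1 - ((a - 1/2 : ℝ) : ℂ) / (LW.pt l - 1)‖ ^ 2 = (a^2 + l^2) / (1/4 + l^2) := by
    rw [show 1 - ((a - 1/2 : ℝ) : ℂ) / (LW.pt l - 1) = (LW.pt l - 1 - ((a - 1/2 : ℝ) : ℂ)) / (LW.pt l - 1) by field_simp]
    rw [← Complex.normSq_eq_norm_sq, map_div₀, hsq]
    congr 1
    rw [Complex.normSq_apply]; simp [LW.pt]; ring
  rw [h1, ← h2, Real.log_pow]
  push_cast
  ring

lemma LW.sum_le (e C : ℝ) (he : e = 1 ∨ e = -1) (hB : ∀ x, 2 < x → 0 ≤ LW.wB e C x) (a : ℝ) (ha : 1/2 < a)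
    (S : Finset ℝ) (hS : ∀ l, l ∉ S → l^2 < a/2 → LW.mm l = 0) :
    ∑ l ∈ S, (LW.mm l : ℝ) * (1/2 * Real.log ((a^2 + l^2) / (1/4 + l^2)) - (a - 1/2) * ((1/2) / (1/4 + l^2))) ≤ |C| * (a - 1/2) := by
  let φ : ℝ → ℝ := fun u => ∑ l ∈ S, (LW.mm l : ℝ) * (1/2 * Real.log ((u^2 + l^2) / (1/4 + l^2)) - (u - 1/2) * ((1/2) / (1/4 + l^2)))
  have hd : ∀ u, 0 < u → HasDerivAt φ (∑ l ∈ S, (LW.mm l : ℝ) * (u / (u^2 + l^2) - (1/2) / (1/4 + l^2))) u := by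
    intro u hu
    refine HasDerivAt.fun_sum fun l _ => ?_
    have hp : 0 < 1/4 + l^2 := by positivity
    have hp2 : 0 < u^2 + l^2 := by positivity
    have h1 : HasDerivAt (fun u : ℝ => (u^2 + l^2) / (1/4 + l^2)) ((2 * u) / (1/4 + l^2)) u := by
      refine ((((hasDerivAt_id u).pow 2).add_const (l^2)).div_const (1/4 + l^2)).congr_deriv ?_
      simp
    have h2 := (h1.log (by positivity)).const_mul (1/2)
    have h3 := ((hasDerivAt_id u).sub_const (1/2)).mul_const ((1/2) / (1/4 + l^2))
    refine ((h2.sub h3).const_mul (LW.mm l : ℝ)).congr_deriv ?_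
    congr 1
    field_simp
  have h0 : φ (1/2) = 0 := by
    refine Finset.sum_eq_zero fun l _ => ?_
    have hp : 0 < 1/4 + l^2 := by positivity
    rw [show ((1/2:ℝ)^2 + l^2) / (1/4 + l^2) = 1 by rw [div_eq_one_iff_eq hp.ne']; ring]
    simp
  have hmv := (convex_Icc (1/2) a).image_sub_le_mul_sub_of_deriv_le (f := φ) (C := |C|)
    (fun u hu => (hd u (by linarith [hu.1])).continuousAt.continuousWithinAt)
    (fun u hu => by
      rw [interior_Icc] at hu
      exact (hd u (by linarith [hu.1])).differentiableAt.differentiableWithinAt)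
    (fun u hu => by
      rw [interior_Icc] at hu
      rw [(hd u (by linarith [hu.1])).deriv]
      exact LW.zero_sum e C he hB u hu.1 S (fun l hl h => hS l hl (by linarith [hu.2])))
    (1/2) (Set.left_mem_Icc.mpr ha.le) a (Set.right_mem_Icc.mpr ha.le) ha.le
  rw [h0, sub_zero] at hmv
  exact hmv

lemma LW.xi_upper (e C : ℝ) (he : e = 1 ∨ e = -1) (hB : ∀ x, 2 < x → 0 ≤ LW.wB e C x) :
    ∃ K : ℝ, ∀ a : ℝ, 1/2 < a → Real.log ‖LW.xi ((1/2 + a : ℝ) : ℂ)‖ ≤ K * (a - 1/2) + 1 := by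
  have hee : e * e = 1 := by rcases he with rfl | rfl <;> norm_num
  let f : ℂ → ℂ := fun z => LW.xi (1 + z)
  have hf : Differentiable ℂ f := LW.xi_diff.comp (by fun_prop)
  have f0 : f 0 = 1 := by simp [f, LW.xi_one]
  have ho : ∀ z, analyticOrderAt f z ≠ ⊤ := by
    intro z
    have hA : AnalyticOnNhd ℂ f Set.univ := fun z _ => hf.analyticAt z
    refine hA.analyticOrderAt_ne_top_of_isPreconnected isPreconnected_univ (x := 0) trivial trivial ?_
    have : analyticOrderAt f 0 = 0 := by
      rw [(hf.analyticAt 0).analyticOrderAt_eq_zero, f0]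
      exact one_ne_zero
    rw [this]; exact ENat.zero_ne_top
  have hzero : ∀ ρ, f ρ = 0 → ρ = LW.pt ρ.im - 1 := by
    intro ρ hρ
    have := LW.xi_re e C hee hB _ hρ
    rw [Complex.add_re, Complex.one_re] at this
    apply Complex.ext
    · rw [Complex.sub_re, LW.pt_re, Complex.one_re]; linarith
    · simp [LW.pt]
  have hord : ∀ l : ℝ, analyticOrderNatAt f (LW.pt l - 1) = LW.mm l := by
    intro l
    have h1 : analyticOrderAt f (LW.pt l - 1) = analyticOrderAt LW.xi (LW.pt l) := by
      have h2 := analyticOrderAt_comp_of_deriv_ne_zero (f := LW.xi) (g := fun z : ℂ => 1 + z) (z₀ := LW.pt l - 1)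
        ((differentiable_id.const_add 1).analyticAt _) (by simp)
      rw [show (1 + (LW.pt l - 1)) = LW.pt l by ring] at h2
      exact h2
    rw [analyticOrderNatAt, h1, LW.xi_order]
    rfl
  refine ⟨(deriv f 0).re + |C|, fun a ha => ?_⟩
  set z : ℂ := ((a - 1/2 : ℝ) : ℂ) with hz
  have hzn : ‖z‖ = a - 1/2 := by
    rw [hz, Complex.norm_real, Real.norm_of_nonneg (by linarith)]
  have hzpos : 0 < a - 1/2 := by linarith
  obtain ⟨R, hRb, hR⟩ := ((LW.xi_growth (1 / (64 * (a - 1/2)^2)) (by positivity)).and (eventually_ge_atTop (4 * a + 4))).exists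
  have hRpos : 0 < R := by linarith
  have hfin := LW.finite_zeros f hf f0 (R/2)
  set T := hfin.toFinset with hTdef
  have hT : ∀ ρ, ρ ∈ T ↔ f ρ = 0 ∧ ‖ρ‖ ≤ R / 2 := fun ρ => by
    rw [hTdef, Set.Finite.mem_toFinset]; rfl
  have hfz : f z = LW.xi ((1/2 + a : ℝ) : ℂ) := by
    simp only [f, hz]
    congr 1
    push_cast; ring
  have hne : f z ≠ 0 := by
    rw [hfz]
    exact LW.xi_zero e C hee hB _ (by rw [Complex.ofReal_re]; linarith)
  have key := LW.hadamard f hf f0 ho R (1 / (64 * (a - 1/2)^2) * R^2) hRpos (by positivity) T hT hRb z (by rw [hzn]; linarith) hne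
  rw [hfz] at key
  refine key.trans ?_
  have e1 : (deriv f 0 * z).re = (deriv f 0).re * (a - 1/2) := by rw [hz, Complex.re_mul_ofReal]
  have e2 : 64 * (1 / (64 * (a - 1/2)^2) * R^2) * ‖z‖^2 / R^2 = 1 := by
    rw [hzn]
    generalize a - 1/2 = y at hzpos
    field_simp
  have e3 : ∑ ρ ∈ T, (analyticOrderNatAt f ρ : ℝ) * (Real.log ‖1 - z / ρ‖ + (z / ρ).re) =
      ∑ l ∈ T.image Complex.im, (LW.mm l : ℝ) * (1/2 * Real.log ((a^2 + l^2) / (1/4 + l^2)) - (a - 1/2) * ((1/2) / (1/4 + l^2))) := by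
    rw [Finset.sum_image]
    · refine Finset.sum_congr rfl fun ρ hρ => ?_
      have h1 := hzero ρ ((hT ρ).mp hρ).1
      rw [← LW.term a ρ.im ha, ← hord ρ.im, ← h1]
    · intro ρ hρ ρ' hρ' h
      rw [hzero ρ ((hT ρ).mp hρ).1, hzero ρ' ((hT ρ').mp hρ').1, h]
  have hsum := LW.sum_le e C he hB a ha (T.image Complex.im) (by
    intro l hl hla
    by_contra hm
    apply hl
    refine Finset.mem_image.mpr ⟨LW.pt l - 1, (hT _).mpr ⟨?_, ?_⟩, by simp [LW.pt]⟩
    · have h1 := hord l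
      by_contra h2
      have h3 : analyticOrderAt f (LW.pt l - 1) = 0 := (hf.analyticAt _).analyticOrderAt_eq_zero.mpr h2
      rw [analyticOrderNatAt, h3] at h1
      exact hm h1.symm
    · have h1 : LW.pt l - 1 = ((-(1/2) : ℝ) : ℂ) + Complex.I * l := by
        rw [LW.pt]; push_cast; ring
      have h2 : |l| ≤ a + 1 := by
        refine abs_le_of_sq_le_sq ?_ (by linarith)
        nlinarith
      rw [h1]
      refine (norm_add_le _ _).trans ?_
      rw [norm_mul, Complex.norm_I, Complex.norm_real, Complex.norm_real, one_mul, Real.norm_eq_abs, Real.norm_eq_abs]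
      rw [abs_neg, abs_of_pos (by norm_num : (0:ℝ) < 1/2)]
      linarith)
  rw [e1, e2, e3]
  linarith

lemma LW.xi_lower (n : ℕ) : (n.factorial : ℝ) ≤ Real.pi ^ (n + 1) * ‖LW.xi ((1/2 + (2 * n + 3/2) : ℝ) : ℂ)‖ := by
  set s : ℂ := ((1/2 + (2 * n + 3/2) : ℝ) : ℂ) with hs
  have hs2 : s = ((2 * (n + 1) : ℕ) : ℂ) := by rw [hs]; push_cast; ring
  have hre : s.re = 2 * n + 2 := by rw [hs, Complex.ofReal_re]; ring
  have hn : (0:ℝ) ≤ n := Nat.cast_nonneg n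
  have hs1 : s ≠ 1 := by
    intro h
    rw [h, Complex.one_re] at hre
    linarith
  rw [LW.xi_eq s (by linarith), norm_mul, norm_mul]
  have h1 : 1 ≤ ‖s‖ := by
    refine le_trans ?_ (Complex.re_le_norm s); linarith
  have h2 : 1 ≤ ‖riemannZeta s‖ := by
    rw [hs2, zeta_nat_eq_tsum_of_gt_one (by omega)]
    have e : (∑' m : ℕ, 1 / (m:ℂ) ^ (2 * (n + 1))) = ((∑' m : ℕ, 1 / (m:ℝ) ^ (2 * (n + 1)) : ℝ) : ℂ) := by
      push_cast; rfl
    rw [e, Complex.norm_real]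
    refine le_trans ?_ (le_abs_self _)
    have hsm : Summable (fun m : ℕ => 1 / (m:ℝ) ^ (2 * (n + 1))) := Real.summable_one_div_nat_pow.mpr (by omega)
    have := hsm.le_tsum 1 (fun m _ => by positivity)
    simpa using this
  have h3 : 1 ≤ ‖riemannZeta₁ s‖ := by
    have e : riemannZeta₁ s = (s - 1) * riemannZeta s := by
      rw [riemannZeta_eq_inv_sub_mul hs1]
      have := sub_ne_zero.mpr hs1
      field_simp
    rw [e, norm_mul]
    refine one_le_mul_of_one_le_of_one_le ?_ h2
    refine le_trans ?_ (Complex.re_le_norm _)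
    rw [Complex.sub_re, Complex.one_re]; linarith
  have h4 : Real.pi ^ (n+1) * ‖Complex.Gammaℝ s‖ = n.factorial := by
    rw [Complex.Gammaℝ_def, norm_mul, Complex.norm_cpow_eq_rpow_re_of_pos Real.pi_pos]
    have e1 : s / 2 = (n:ℂ) + 1 := by rw [hs2]; push_cast; ring
    rw [neg_div, e1, Complex.Gamma_nat_eq_factorial, Complex.norm_natCast]
    have e2 : (-((n:ℂ) + 1)).re = -((n + 1 : ℕ) : ℝ) := by simp
    rw [e2, Real.rpow_neg Real.pi_pos.le, Real.rpow_natCast, ← mul_assoc, mul_inv_cancel₀ (by positivity), one_mul]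
  calc (n.factorial : ℝ) = Real.pi ^ (n+1) * (1 * ‖Complex.Gammaℝ s‖ * 1) := by rw [one_mul, mul_one, h4]
    _ ≤ _ := by gcongr

lemma LW.main (e C : ℝ) (he : e = 1 ∨ e = -1) (hB : ∀ x, 2 < x → 0 ≤ LW.wB e C x) : False := by
  obtain ⟨K, hK⟩ := LW.xi_upper e C he hB
  have hee : e * e = 1 := by rcases he with rfl | rfl <;> norm_num
  set B := Real.pi * Real.exp (2 * K) with hBdef
  set A := Real.pi * Real.exp (K + 1) with hA
  have hApos : 0 < A := by positivity
  have hle : ∀ n : ℕ, (n.factorial : ℝ) ≤ A * B ^ n := by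
    intro n
    have hn : (0:ℝ) ≤ n := Nat.cast_nonneg n
    have h1 := hK (2 * n + 3/2) (by linarith)
    have hx : LW.xi ((1/2 + (2 * n + 3/2) : ℝ) : ℂ) ≠ 0 :=
      LW.xi_zero e C hee hB _ (by rw [Complex.ofReal_re]; linarith)
    rw [Real.log_le_iff_le_exp (norm_pos_iff.mpr hx)] at h1
    refine (LW.xi_lower n).trans ?_
    refine (mul_le_mul_of_nonneg_left h1 (by positivity)).trans (le_of_eq ?_)
    rw [hA, hBdef, mul_pow, ← Real.exp_nat_mul]
    rw [show K * (2 * (n:ℝ) + 3/2 - 1/2) + 1 = (K + 1) + n * (2 * K) by ring, Real.exp_add]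
    ring
  have ht := FloorSemiring.tendsto_pow_div_factorial_atTop B
  have hev := ht.eventually_lt_const (show (0:ℝ) < 1 / A by positivity)
  obtain ⟨n, hn⟩ := hev.exists
  have hf : (0:ℝ) < n.factorial := by positivity
  rw [div_lt_div_iff₀ hf hApos] at hn
  linarith [hle n]

lemma LW.cf_prime {p : ℕ} (hp : p.Prime) : LW.cf p = 1 := by
  rw [LW.cf, ArithmeticFunction.vonMangoldt_apply_prime hp]
  exact div_self (Real.log_pos (by exact_mod_cast hp.one_lt)).ne'

lemma LW.PiF_split (x : ℝ) : LW.PiF x = primePi x + ∑ n ∈ (Finset.Ioc 0 ⌊x⌋₊).filter (fun n => ¬ n.Prime), LW.cf n := by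
  have h0 : Finset.Icc 1 ⌊x⌋₊ = Finset.Ioc 0 ⌊x⌋₊ := by ext n; simp; omega
  rw [LW.PiF, h0, ← Finset.sum_filter_add_sum_filter_not (Finset.Ioc 0 ⌊x⌋₊) Nat.Prime]
  congr 1
  rw [Finset.sum_congr rfl (fun p hp => LW.cf_prime (Finset.mem_filter.mp hp).2)]
  rw [Finset.sum_const, nsmul_eq_mul, mul_one, primePi]
  congr 2
  ext p
  simp only [Finset.mem_filter, Finset.mem_Ioc, Finset.mem_range]
  constructor
  · rintro ⟨h1, h2⟩; exact ⟨by omega, h2⟩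
  · rintro ⟨h1, h2⟩; exact ⟨⟨h2.pos, by omega⟩, h2⟩

lemma LW.PiF_ge (x : ℝ) : primePi x ≤ LW.PiF x := by
  rw [LW.PiF_split]
  have := Finset.sum_nonneg (s := (Finset.Ioc 0 ⌊x⌋₊).filter (fun n => ¬ n.Prime)) (fun n _ => LW.cf_nonneg n)
  linarith

lemma LW.PiF_upper : ∃ D : ℝ, ∀ x, 2 ≤ x → LW.PiF x ≤ primePi x + D * (Real.sqrt x * LW.wE x) := by
  obtain ⟨C, hC⟩ := Chebyshev.psi_sub_theta_le_mul_sqrt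
  refine ⟨|C| * 4 / Real.log 2 + |C| * 2, fun x hx => ?_⟩
  have hx0 : 0 < x := by linarith
  have hl2 : 0 < Real.log 2 := Real.log_pos (by norm_num)
  have hlx : 0 < Real.log x := Real.log_pos (by linarith)
  rw [LW.PiF_split]
  refine add_le_add le_rfl ?_
  have h1 : ∀ y : ℝ, ∑ n ∈ Finset.Ioc 0 ⌊y⌋₊ with ¬ n.Prime, ArithmeticFunction.vonMangoldt n ≤ |C| * Real.sqrt y := by
    intro y
    rw [← Chebyshev.psi_sub_theta_eq_sum_not_prime]
    exact (hC y).trans (mul_le_mul_of_nonneg_right (le_abs_self C) (Real.sqrt_nonneg y))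
  have hterm : ∀ n ∈ (Finset.Ioc 0 ⌊x⌋₊).filter (fun n => ¬ n.Prime),
      LW.cf n ≤ (if n ≤ ⌊Real.sqrt x⌋₊ then ArithmeticFunction.vonMangoldt n / Real.log 2 else 0) + ArithmeticFunction.vonMangoldt n * (2 / Real.log x) := by
    intro n hn
    have hv : 0 ≤ ArithmeticFunction.vonMangoldt n := ArithmeticFunction.vonMangoldt_nonneg
    have hn0 : 0 < n := (Finset.mem_Ioc.mp (Finset.mem_filter.mp hn).1).1
    rcases Nat.lt_or_ge 1 n with h2 | h2
    · have h2' : (2:ℝ) ≤ n := by exact_mod_cast h2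
      split_ifs with h
      · have : LW.cf n ≤ ArithmeticFunction.vonMangoldt n / Real.log 2 := by
          rw [LW.cf]
          exact div_le_div_of_nonneg_left hv hl2 (Real.log_le_log (by norm_num) h2')
        have h3 : 0 ≤ ArithmeticFunction.vonMangoldt n * (2 / Real.log x) := by positivity
        linarith
      · rw [zero_add, LW.cf, div_eq_mul_inv]
        refine mul_le_mul_of_nonneg_left ?_ hv
        have h4 : Real.sqrt x < n := (Nat.floor_lt (Real.sqrt_nonneg x)).mp (not_le.mp h)
        have h5 : Real.log x / 2 ≤ Real.log n := by
          rw [← Real.log_sqrt hx0.le]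
          exact Real.log_le_log (Real.sqrt_pos.mpr hx0) h4.le
        rw [← inv_div]
        exact inv_anti₀ (by positivity) h5
    · have : n = 1 := by omega
      subst this
      simp [LW.cf]
  refine (Finset.sum_le_sum hterm).trans ?_
  rw [Finset.sum_add_distrib, ← Finset.sum_mul, ← Finset.sum_filter]
  have h6 : ∑ a ∈ ((Finset.Ioc 0 ⌊x⌋₊).filter (fun n => ¬ n.Prime)).filter (fun n => n ≤ ⌊Real.sqrt x⌋₊), ArithmeticFunction.vonMangoldt a / Real.log 2 ≤ |C| * Real.sqrt (Real.sqrt x) / Real.log 2 := by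
    rw [← Finset.sum_div]
    refine div_le_div_of_nonneg_right ?_ hl2.le
    refine le_trans ?_ (h1 (Real.sqrt x))
    refine Finset.sum_le_sum_of_subset_of_nonneg ?_ (fun n _ _ => ArithmeticFunction.vonMangoldt_nonneg)
    intro n hn
    simp only [Finset.mem_filter, Finset.mem_Ioc] at hn ⊢
    exact ⟨⟨hn.1.1.1, hn.2⟩, hn.1.2⟩
  have h7 : Real.sqrt (Real.sqrt x) ≤ 4 * (Real.sqrt x * LW.wE x) := by
    rw [LW.wE_eq hx]
    set y := Real.sqrt (Real.sqrt x) with hy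
    have hypos : 0 < y := Real.sqrt_pos.mpr (Real.sqrt_pos.mpr hx0)
    have hsq : y ^ 2 = Real.sqrt x := Real.sq_sqrt (Real.sqrt_nonneg x)
    have hl : Real.log x = 4 * Real.log y := by
      rw [hy, Real.log_sqrt (Real.sqrt_nonneg x), Real.log_sqrt hx0.le]; ring
    have hl' : Real.log x ≤ 4 * y := by
      rw [hl]; linarith [Real.log_le_sub_one_of_pos hypos]
    rw [← hsq, mul_one_div, ← mul_div_assoc, le_div_iff₀ hlx]
    nlinarith
  have h8 := h1 x
  have h9 : (∑ n ∈ Finset.Ioc 0 ⌊x⌋₊ with ¬ n.Prime, ArithmeticFunction.vonMangoldt n) * (2 / Real.log x) ≤ |C| * 2 * (Real.sqrt x * LW.wE x) := by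
    rw [LW.wE_eq hx]
    refine (mul_le_mul_of_nonneg_right h8 (by positivity)).trans (le_of_eq ?_)
    ring
  have h10 : |C| * Real.sqrt (Real.sqrt x) / Real.log 2 ≤ |C| * 4 / Real.log 2 * (Real.sqrt x * LW.wE x) := by
    rw [div_mul_eq_mul_div]
    refine div_le_div_of_nonneg_right ?_ hl2.le
    rw [mul_assoc]
    exact mul_le_mul_of_nonneg_left h7 (abs_nonneg C)
  rw [add_mul]
  linarith

lemma LW.li_eq {x : ℝ} (hx : 2 ≤ x) : li x = LW.liM x := by
  refine intervalIntegral.integral_congr fun t ht => ?_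
  rw [Set.uIcc_of_le hx] at ht
  exact (LW.wE_eq ht.1).symm

lemma LW.red (e C X : ℝ) (he : e = 1 ∨ e = -1)
    (h : ∀ x, X < x → 2 ≤ x → 0 ≤ e * (LW.PiF x - LW.liM x) + C * (Real.sqrt x * LW.wE x)) : False := by
  set Y := max X 3 with hY
  have hY3 : 3 ≤ Y := le_max_right _ _
  have hYX : X ≤ Y := le_max_left _ _
  have hlY : 0 < Real.log Y := Real.log_pos (by linarith)
  refine LW.main e (|C| + 3 * Y * Real.log Y) he fun x hx => ?_
  have hx0 : 0 < x := by linarith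
  refine div_nonneg ?_ hx0.le
  rw [LW.BB]
  have hp : 0 ≤ Real.sqrt x * LW.wE x := mul_nonneg (Real.sqrt_nonneg x) (LW.wE_pos x).le
  rcases lt_or_ge X x with h1 | h1
  · have h2 := h x h1 hx.le
    have h3 : C * (Real.sqrt x * LW.wE x) ≤ (|C| + 3 * Y * Real.log Y) * (Real.sqrt x * LW.wE x) := by
      refine mul_le_mul_of_nonneg_right ?_ hp
      have : 0 ≤ 3 * Y * Real.log Y := by positivity
      linarith [le_abs_self C]
    linarith
  · have h2 : 1 / Real.log Y ≤ Real.sqrt x * LW.wE x := by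
      rw [LW.wE_eq hx.le]
      have h3 : 1 ≤ Real.sqrt x := Real.one_le_sqrt.mpr (by linarith)
      have h4 : 1 / Real.log Y ≤ 1 / Real.log x := by
        refine one_div_le_one_div_of_le (Real.log_pos (by linarith)) ?_
        exact Real.log_le_log hx0 (by linarith)
      have h5 : 0 < 1 / Real.log x := one_div_pos.mpr (Real.log_pos (by linarith))
      nlinarith
    have h6 : 3 * Y ≤ (|C| + 3 * Y * Real.log Y) * (Real.sqrt x * LW.wE x) := by
      have h7 : (3 * Y * Real.log Y) * (1 / Real.log Y) ≤ (|C| + 3 * Y * Real.log Y) * (Real.sqrt x * LW.wE x) := by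
        have : 0 ≤ 3 * Y * Real.log Y := by positivity
        gcongr
        linarith [abs_nonneg C]
      rwa [mul_one_div, mul_div_assoc, div_self hlY.ne', mul_one] at h7
    have a1 := LW.PiF_nonneg x
    have a2 := LW.PiF_le hx0.le
    have a3 := LW.liM_nonneg hx.le
    have a4 := LW.liM_le hx.le
    rcases he with rfl | rfl <;> linarith

/-- Littlewood's theorem: `π(x) - li(x)` changes sign infinitely often;
there are arbitrarily large `x` with `π(x) > li(x)` and arbitrarily large `x`
with `π(x) < li(x)`. -/
theorem littlewood_sign_changes :
    (∀ X : ℝ, ∃ x : ℝ, X < x ∧ li x < primePi x) ∧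
      (∀ X : ℝ, ∃ x : ℝ, X < x ∧ primePi x < li x) := by
  constructor
  · intro X
    by_contra hcon
    push Not at hcon
    obtain ⟨D, hD⟩ := LW.PiF_upper
    refine LW.red (-1) D X (Or.inr rfl) fun x hx hx2 => ?_
    have h1 := hcon x hx
    have h2 := hD x hx2
    rw [LW.li_eq hx2] at h1
    linarith
  · intro X
    by_contra hcon
    push Not at hcon
    refine LW.red 1 0 X (Or.inl rfl) fun x hx hx2 => ?_
    have h1 := hcon x hx
    have h2 := LW.PiF_ge x
    rw [LW.li_eq hx2] at h1
    linarith
end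

section
/- Brun's theorem on almost-twin primes: there are infinitely many natural numbers n > 1 such that both Ω(n) ≤ 9 and Ω(n + 2) ≤ 9, i.e. infinitely many pairs of integers differing by 2 each of which has at most nine prime factors counted with multiplicity. -/
namespace BrunTwins
open Finset

lemma log_factorial_eq (n : ℕ) : Real.log (n.factorial : ℝ) =
    ∑ p ∈ n.primesLE, (n.factorial.factorization p : ℝ) * Real.log p := by
  have h0 : n.factorial ≠ 0 := n.factorial_ne_zero
  have h1 : ∏ p ∈ n.primesLE, p ^ (n.factorial.factorization p) = n.factorial := by
    conv_rhs => rw [← Nat.prod_factorization_pow_eq_self h0]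
    rw [Finsupp.prod]
    symm
    apply Finset.prod_subset
    · intro p hp
      rw [Nat.support_factorization, Nat.mem_primeFactors] at hp
      rw [Nat.mem_primesLE]
      exact ⟨(Nat.Prime.dvd_factorial hp.1).1 hp.2.1, hp.1⟩
    · intro p _ hp
      rw [Finsupp.notMem_support_iff] at hp
      rw [hp, pow_zero]
  conv_lhs => rw [← h1]
  push_cast
  rw [Real.log_prod]
  · apply Finset.sum_congr rfl
    intro p hp
    rw [Real.log_pow]
  · intro p hp
    have := (Nat.mem_primesLE.1 hp).2.pos
    positivity

/-- sum of `log p / p` over primes up to `n` -/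
noncomputable def SM (n : ℕ) : ℝ := ∑ p ∈ n.primesLE, Real.log p / p

lemma SM_upper (n : ℕ) (hn : 1 ≤ n) : SM n ≤ Real.log n + Real.log 4 := by
  have hn0 : (0:ℝ) < n := by exact_mod_cast hn
  have h1 : ∑ p ∈ n.primesLE, ((n:ℝ) / p - 1) * Real.log p ≤ Real.log (n.factorial : ℝ) := by
    rw [log_factorial_eq]
    apply Finset.sum_le_sum
    intro p hp
    have hp' := Nat.mem_primesLE.1 hp
    apply mul_le_mul_of_nonneg_right _ (Real.log_natCast_nonneg p)
    have h2 : n / p ≤ n.factorial.factorization p := by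
      rw [Nat.factorization_factorial hp'.2 (Nat.lt_succ_self _)]
      have := Finset.single_le_sum (f := fun i => n / p ^ i) (s := Finset.Ico 1 (Nat.log p n).succ)
        (fun i _ => Nat.zero_le _) (a := 1) (by
          have := Nat.log_pos hp'.2.one_lt hp'.1
          exact Finset.mem_Ico.2 ⟨le_rfl, by omega⟩)
      simpa using this
    have h3 : (n:ℝ) / p < ((n / p : ℕ) : ℝ) + 1 := by
      rw [← Nat.floor_div_eq_div (K := ℝ)]
      exact Nat.lt_floor_add_one _
    have h4 : ((n / p : ℕ) : ℝ) ≤ n.factorial.factorization p := by exact_mod_cast h2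
    linarith
  have h2 : Real.log (n.factorial : ℝ) ≤ n * Real.log n := by
    rw [← Real.log_pow]
    apply Real.log_le_log
    · exact_mod_cast n.factorial_pos
    · exact_mod_cast Nat.factorial_le_pow n
  have h3 : ∑ p ∈ n.primesLE, ((n:ℝ) / p - 1) * Real.log p
      = n * SM n - Chebyshev.theta n := by
    rw [Chebyshev.theta_eq_sum_primesLE_log, SM, Finset.mul_sum, ← Finset.sum_sub_distrib]
    apply Finset.sum_congr rfl
    intro p hp
    ring
  have h4 := Chebyshev.theta_le_log4_mul_x hn0.le
  have : n * SM n ≤ n * (Real.log n + Real.log 4) := by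
    rw [h3] at h1; linarith
  exact le_of_mul_le_mul_left this hn0

lemma aux_sum : ∃ C : ℝ, ∀ n : ℕ, ∑ p ∈ n.primesLE, Real.log p / (p * (p - 1)) ≤ C := by
  have hs : Summable (fun n : ℕ => 4 * (n:ℝ) ^ (-(3/2) : ℝ)) :=
    (Real.summable_nat_rpow.2 (by norm_num)).mul_left 4
  refine ⟨∑' n : ℕ, 4 * (n:ℝ) ^ (-(3/2) : ℝ), fun n => ?_⟩
  refine le_trans (Finset.sum_le_sum ?_) (hs.sum_le_tsum n.primesLE (fun i _ => by positivity))
  intro p hp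
  have hp' := (Nat.mem_primesLE.1 hp).2
  have h2 : (2:ℝ) ≤ p := by exact_mod_cast hp'.two_le
  have h3 := Real.log_le_rpow_div (x := p) (ε := 1/2) (by positivity) (by norm_num)
  have hp0 : (0:ℝ) < p := by linarith
  have h5 : (p:ℝ) ^ (-(3/2) : ℝ) = (p:ℝ)^(1/2 : ℝ) / (p * p) := by
    rw [← pow_two, ← Real.rpow_natCast, ← Real.rpow_sub hp0]; norm_num
  rw [h5, div_le_iff₀ (by nlinarith)]
  have h6 : 4 * ((p:ℝ)^(1/2 : ℝ) / (p * p)) * (p * (p - 1)) =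
    (p:ℝ)^(1/2 : ℝ) * 2 * (2 * (p-1) / p) := by field_simp; ring
  rw [h6]
  have h7 : 1 ≤ 2 * ((p:ℝ)-1) / p := by rw [le_div_iff₀ hp0]; linarith
  have h8 : 0 ≤ (p:ℝ)^(1/2 : ℝ) * 2 := by positivity
  nlinarith

lemma mertens_one : ∃ C : ℝ, 0 < C ∧ ∀ n : ℕ, 1 ≤ n → |SM n - Real.log n| ≤ C := by
  obtain ⟨C, hC⟩ := aux_sum
  refine ⟨Real.log 4 + |C| + 1, by
    have := Real.log_pos (show (1:ℝ) < 4 by norm_num)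
    positivity, fun n hn => ?_⟩
  have hn0 : (0:ℝ) < n := by exact_mod_cast hn
  have hl4 := Real.log_pos (show (1:ℝ) < 4 by norm_num)
  have hup := SM_upper n hn
  have h1 := Stirling.le_log_factorial_stirling (n := n) (by omega)
  have h2 : Real.log (n.factorial : ℝ) ≤ ∑ p ∈ n.primesLE, (n:ℝ) / (p - 1) * Real.log p := by
    rw [log_factorial_eq]
    apply Finset.sum_le_sum
    intro p hp
    have hp' := Nat.mem_primesLE.1 hp
    apply mul_le_mul_of_nonneg_right _ (Real.log_natCast_nonneg p)
    have h3 := Nat.factorization_factorial_le_div_pred hp'.2 n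
    calc (n.factorial.factorization p : ℝ) ≤ ((n / (p-1) : ℕ) : ℝ) := by exact_mod_cast h3
      _ ≤ (n:ℝ) / ((p-1 : ℕ) : ℝ) := Nat.cast_div_le
      _ = _ := by rw [Nat.cast_sub hp'.2.one_le]; simp
  have h3 : ∑ p ∈ n.primesLE, (n:ℝ) / (p - 1) * Real.log p
      = n * (SM n + ∑ p ∈ n.primesLE, Real.log p / (p * (p - 1))) := by
    rw [SM, ← Finset.sum_add_distrib, Finset.mul_sum]
    apply Finset.sum_congr rfl
    intro p hp
    have hp' := (Nat.mem_primesLE.1 hp).2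
    have h2 : (2:ℝ) ≤ p := by exact_mod_cast hp'.two_le
    have : (p:ℝ) - 1 ≠ 0 := by linarith
    field_simp
    ring
  have h4 := hC n
  have h5 : 0 ≤ Real.log n := Real.log_natCast_nonneg n
  have h6 : 0 ≤ Real.log (2 * Real.pi) := Real.log_nonneg (by nlinarith [Real.pi_gt_three])
  have h7 : n * (Real.log n - 1) ≤ n * (SM n + ∑ p ∈ n.primesLE, Real.log p / (p * (p - 1))) := by
    rw [← h3]; nlinarith
  have h8 := le_of_mul_le_mul_left h7 hn0
  have h9 := le_abs_self C
  rw [abs_le]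
  constructor <;> linarith [abs_nonneg C]

lemma SM_succ (n : ℕ) : SM (n+1) = SM n + (if (n+1).Prime then Real.log (n+1) / (n+1) else 0) := by
  unfold SM
  rw [Nat.primesLE_succ]
  split_ifs with h
  · rw [Finset.sum_insert (by simp [Nat.mem_primesLE])]
    push_cast; ring
  · simp

lemma mertens_two_aux (C : ℝ) (hC : ∀ n : ℕ, 1 ≤ n → |SM n - Real.log n| ≤ C)
    (a : ℕ) (ha : 2 ≤ a) (b : ℕ) (hab : a ≤ b) :
    ∑ p ∈ (Finset.Ioc a b).filter Nat.Prime, (1:ℝ) / p ≤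
      Real.log (Real.log b) - Real.log (Real.log a) + (SM b - Real.log b) / Real.log b
        + C * (1 / Real.log a - 1 / Real.log b) + C / Real.log a := by
  induction b, hab using Nat.le_induction with
  | base =>
    have h1 := (abs_le.1 (hC a (by omega))).1
    have h2 : 0 < Real.log a := Real.log_pos (by exact_mod_cast ha)
    simp
    rw [← add_div]
    apply div_nonneg _ h2.le
    linarith
  | succ b hb ih =>
    have hb2 : (2:ℝ) ≤ b := by exact_mod_cast ha.trans hb
    have hx : 0 < Real.log b := Real.log_pos (by linarith)
    have hy : 0 < Real.log (b+1) := Real.log_pos (by linarith)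
    have hxy : Real.log b ≤ Real.log (b+1) := Real.log_le_log (by linarith) (by linarith)
    have hE := (abs_le.1 (hC b (by omega))).2
    have hsum : ∑ p ∈ (Finset.Ioc a (b+1)).filter Nat.Prime, (1:ℝ) / p =
        ∑ p ∈ (Finset.Ioc a b).filter Nat.Prime, (1:ℝ) / p + (SM (b+1) - SM b) / Real.log (b+1) := by
      rw [SM_succ, Finset.sum_filter, Finset.sum_filter, show Finset.Ioc a (b+1) = insert (b+1) (Finset.Ioc a b) by ext; simp; omega,
        Finset.sum_insert (by simp)]
      split_ifs
      · push_cast; field_simp; ring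
      · simp
    rw [hsum]
    have hlog : 1 - Real.log b / Real.log (b+1) ≤ Real.log (Real.log (b+1)) - Real.log (Real.log b) := by
      have := Real.log_le_sub_one_of_pos (div_pos hx hy)
      rw [Real.log_div hx.ne' hy.ne'] at this
      linarith
    have hinv : 0 ≤ 1 / Real.log b - 1 / Real.log (b+1) := by
      have := one_div_le_one_div_of_le hx hxy
      linarith
    have hk := mul_le_mul_of_nonneg_right hE hinv
    push_cast
    have e1 : (SM (b+1) - SM b) / Real.log (b+1) =
      (SM (b+1) - Real.log (b+1)) / Real.log (b+1) + (1 - Real.log b / Real.log (b+1))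
       - (SM b - Real.log b) * (1 / Real.log (b+1)) := by field_simp; ring
    rw [e1]
    have e2 : (SM b - Real.log b) / Real.log b = (SM b - Real.log b) * (1/ Real.log b) := by ring
    rw [e2] at ih
    nlinarith

lemma mertens_block : ∃ w₀ : ℕ, ∀ u : ℕ, w₀ ≤ u →
    ∑ p ∈ (Finset.Ico u (u^2)).filter Nat.Prime, (2:ℝ) / p ≤ 1.4 := by
  obtain ⟨C, hC0, hC⟩ := mertens_one
  have ht : Filter.Tendsto (fun u : ℕ => Real.log u) Filter.atTop Filter.atTop :=
    Real.tendsto_log_atTop.comp tendsto_natCast_atTop_atTop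
  obtain ⟨w₀, hw⟩ := Filter.eventually_atTop.1 (ht.eventually_ge_atTop (1000 * C))
  refine ⟨max w₀ 1000, fun u hu => ?_⟩
  have hu1 : 1000 ≤ u := le_trans (le_max_right _ _) hu
  have hu1' : (1000:ℝ) ≤ u := by exact_mod_cast hu1
  have hl := hw u (le_trans (le_max_left _ _) hu)
  have hl0 : 0 < Real.log u := Real.log_pos (by linarith)
  have hle : u ≤ u^2 := by nlinarith
  have h1 := mertens_two_aux C hC u (by omega) (u^2) hle
  have h2 : ∑ p ∈ (Finset.Ico u (u^2)).filter Nat.Prime, (1:ℝ) / p ≤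
      1 / u + ∑ p ∈ (Finset.Ioc u (u^2)).filter Nat.Prime, (1:ℝ) / p := by
    rw [← Finset.sum_insert (f := fun p : ℕ => (1:ℝ)/p) (a := u) (by simp)]
    apply Finset.sum_le_sum_of_subset_of_nonneg
    · intro p hp
      simp at hp ⊢
      by_cases h : p = u
      · left; exact h
      · right; refine ⟨⟨by omega, by omega⟩, hp.2⟩
    · intros; positivity
  have h3 : ∑ p ∈ (Finset.Ico u (u^2)).filter Nat.Prime, (2:ℝ) / p =
     2 * ∑ p ∈ (Finset.Ico u (u^2)).filter Nat.Prime, (1:ℝ) / p := by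
    rw [Finset.mul_sum]; apply Finset.sum_congr rfl; intros; ring
  have hE := (abs_le.1 (hC (u^2) (by nlinarith))).2
  have hlu : Real.log ((u^2 : ℕ) : ℝ) = 2 * Real.log u := by push_cast; rw [Real.log_pow]; simp
  rw [hlu] at h1 hE
  rw [Real.log_mul (by norm_num) hl0.ne'] at h1
  have h4 : (SM (u^2) - 2 * Real.log u) / (2 * Real.log u) ≤ 1/1000 := by
    rw [div_le_iff₀ (by linarith)]; linarith
  have h5 : C / Real.log u ≤ 1/1000 := by
    rw [div_le_iff₀ (by linarith)]; linarith
  have h6 : C * (1 / Real.log u - 1 / (2 * Real.log u)) ≤ 1/1000 := by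
    have : C * (1 / Real.log u - 1 / (2 * Real.log u)) = C / Real.log u / 2 := by field_simp; ring
    rw [this]; linarith
  have h7 : 1 / (u:ℝ) ≤ 1/1000 := one_div_le_one_div_of_le (by norm_num) hu1'
  have h8 := Real.log_two_lt_d9
  rw [h3]
  linarith

end BrunTwins

namespace BrunTwins
open Finset

/-- weighted sum over subsets, weight depending on cardinality -/
noncomputable def G (P : Finset ℕ) (g : ℕ → ℝ) (c : ℕ → ℝ) : ℝ :=
  ∑ S ∈ P.powerset, c S.card * ∏ p ∈ S, g p

noncomputable def cE (i : ℕ) : ℕ → ℝ := fun n => if n = i then 1 else 0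
noncomputable def cB (m : ℕ) : ℕ → ℝ := fun n => if n ≤ m then (-1) ^ n else 0
noncomputable def cA (m : ℕ) : ℕ → ℝ := fun n => if n ≤ m then 1 else 0

lemma G_empty (g c : ℕ → ℝ) : G ∅ g c = c 0 := by simp [G]

lemma G_insert {a : ℕ} {P : Finset ℕ} (ha : a ∉ P) (g c : ℕ → ℝ) :
    G (insert a P) g c = G P g c + g a * G P g (fun n => c (n+1)) := by
  unfold G
  rw [Finset.sum_powerset_insert ha, Finset.mul_sum]
  congr 1
  apply Finset.sum_congr rfl
  intro S hS
  have : a ∉ S := fun h => ha (Finset.mem_powerset.1 hS h)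
  rw [Finset.card_insert_of_notMem this, Finset.prod_insert this]
  ring

lemma G_zero (P : Finset ℕ) (g : ℕ → ℝ) : G P g (fun _ => 0) = 0 := by simp [G]

lemma G_neg (P : Finset ℕ) (g c : ℕ → ℝ) : G P g (fun n => - c n) = - G P g c := by simp [G]

lemma G_sub (P : Finset ℕ) (g c d : ℕ → ℝ) :
    G P g (fun n => c n - d n) = G P g c - G P g d := by
  simp [G, sub_mul]

lemma G_mono (P : Finset ℕ) (g c d : ℕ → ℝ) (hg : ∀ p ∈ P, 0 ≤ g p) (h : ∀ n, c n ≤ d n) :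
    G P g c ≤ G P g d := by
  apply Finset.sum_le_sum
  intro S hS
  apply mul_le_mul_of_nonneg_right (h _)
  exact Finset.prod_nonneg fun p hp => hg p (Finset.mem_powerset.1 hS hp)

lemma cE_succ (i : ℕ) : (fun n => cE (i+1) (n+1)) = cE i := by
  ext n; simp [cE]
lemma cE_zero : (fun n => cE 0 (n+1)) = fun _ => 0 := by
  ext n; simp [cE]
lemma cA_succ (i : ℕ) : (fun n => cA (i+1) (n+1)) = cA i := by
  ext n; simp [cA]
lemma cA_zero : (fun n => cA 0 (n+1)) = fun _ => 0 := by
  ext n; simp [cA]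
lemma cB_succ (i : ℕ) : (fun n => cB (i+1) (n+1)) = fun n => - cB i n := by
  ext n; simp [cB]; split_ifs <;> ring
lemma cB_zero : (fun n => cB 0 (n+1)) = fun _ => 0 := by
  ext n; simp [cB]

lemma pow_aux (a b : ℝ) (n : ℕ) (ha : 0 ≤ a) (hb : 0 ≤ b) :
    a^(n+1) + (n+1) * (b * a^n) ≤ (a+b)^(n+1) := by
  induction n with
  | zero => simp
  | succ n ih =>
    have h1 := mul_le_mul_of_nonneg_right ih (add_nonneg ha hb)
    rw [← pow_succ] at h1
    refine le_trans ?_ h1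
    have h2 : 0 ≤ (n+1:ℝ) * (b * a^n * b) := by positivity
    push_cast
    have h3 : (a^(n+1) + (n+1:ℝ) * (b * a^n)) * (a + b) - (a^(n+1+1) + ((n:ℝ)+1+1) * (b * a^(n+1)))
      = (n+1:ℝ) * (b * a^n * b) := by ring
    linarith

lemma G_E_nonneg (P : Finset ℕ) (g : ℕ → ℝ) (hg : ∀ p ∈ P, 0 ≤ g p) (i : ℕ) :
    0 ≤ G P g (cE i) := by
  rw [← G_zero P g]
  apply G_mono P g _ _ hg
  intro n; unfold cE; split_ifs <;> norm_num

lemma G_E_le (P : Finset ℕ) (g : ℕ → ℝ) (hg : ∀ p ∈ P, 0 ≤ g p) (i : ℕ) :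
    G P g (cE i) ≤ (∑ p ∈ P, g p) ^ i / i.factorial := by
  induction P using Finset.induction_on generalizing i with
  | empty =>
    rw [G_empty]
    rcases i with _ | i <;> simp [cE]
  | insert a P ha ih =>
    have hg' : ∀ p ∈ P, 0 ≤ g p := fun p hp => hg p (Finset.mem_insert_of_mem hp)
    have hga : 0 ≤ g a := hg a (Finset.mem_insert_self _ _)
    have hT : 0 ≤ ∑ p ∈ P, g p := Finset.sum_nonneg hg'
    rw [G_insert ha, Finset.sum_insert ha]
    rcases i with _ | i
    · rw [cE_zero, G_zero]
      have := ih hg' 0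
      simpa using this
    · rw [cE_succ]
      have h1 := ih hg' (i+1)
      have h2 := mul_le_mul_of_nonneg_left (ih hg' i) hga
      refine (add_le_add h1 h2).trans ?_
      have h3 := pow_aux _ _ i hT hga
      rw [add_comm (g a)]
      rw [le_div_iff₀ (by positivity)]
      refine le_trans (le_of_eq ?_) h3
      rw [Nat.factorial_succ]
      push_cast
      field_simp

lemma G_A_le (P : Finset ℕ) (g : ℕ → ℝ) (hg : ∀ p ∈ P, 0 ≤ g p) (m : ℕ) :
    G P g (cA m) ≤ (1 + ∑ p ∈ P, g p) ^ m := by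
  induction P using Finset.induction_on generalizing m with
  | empty =>
    rw [G_empty]
    simp [cA]
  | insert a P ha ih =>
    have hg' : ∀ p ∈ P, 0 ≤ g p := fun p hp => hg p (Finset.mem_insert_of_mem hp)
    have hga : 0 ≤ g a := hg a (Finset.mem_insert_self _ _)
    have hT : 0 ≤ ∑ p ∈ P, g p := Finset.sum_nonneg hg'
    rw [G_insert ha, Finset.sum_insert ha]
    rcases m with _ | i
    · rw [cA_zero, G_zero]
      have := ih hg' 0
      simpa using this
    · rw [cA_succ]
      have h1 := ih hg' (i+1)
      have h2 := mul_le_mul_of_nonneg_left (ih hg' i) hga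
      refine (add_le_add h1 h2).trans ?_
      have h3 := pow_aux (1 + ∑ p ∈ P, g p) (g a) i (by linarith) hga
      have h4 : 0 ≤ (i:ℝ) * (g a * (1 + ∑ p ∈ P, g p)^i) := by positivity
      have h5 : 1 + (g a + ∑ p ∈ P, g p) = (1 + ∑ p ∈ P, g p) + g a := by ring
      rw [h5]
      linarith

lemma G_B_zero (P : Finset ℕ) (g : ℕ → ℝ) : G P g (cB 0) = 1 := by
  have : ∀ S ∈ P.powerset, S ≠ ∅ → cB 0 S.card * ∏ p ∈ S, g p = 0 := by
    intro S _ hS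
    simp [cB, hS]
  unfold G
  rw [Finset.sum_eq_single ∅ this (by simp)]
  simp [cB]

lemma bonf (P : Finset ℕ) (g : ℕ → ℝ) (hg : ∀ p ∈ P, 0 ≤ g p)
    (hg1 : ∀ p ∈ P, g p ≤ 1) (m : ℕ) :
    0 ≤ (-1)^m * (G P g (cB m) - ∏ p ∈ P, (1 - g p)) := by
  induction P using Finset.induction_on generalizing m with
  | empty =>
    rw [G_empty]
    simp [cB]
  | insert a P ha ih =>
    have hg' : ∀ p ∈ P, 0 ≤ g p := fun p hp => hg p (Finset.mem_insert_of_mem hp)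
    have hg1' : ∀ p ∈ P, g p ≤ 1 := fun p hp => hg1 p (Finset.mem_insert_of_mem hp)
    have hga : 0 ≤ g a := hg a (Finset.mem_insert_self _ _)
    rw [G_insert ha, Finset.prod_insert ha]
    rcases m with _ | m
    · rw [cB_zero, G_zero]
      have h1 := ih hg' hg1' 0
      have h2 := G_B_zero P g
      rw [h2] at h1 ⊢
      have h3 : 0 ≤ ∏ p ∈ P, (1 - g p) :=
        Finset.prod_nonneg fun p hp => sub_nonneg.2 (hg1' p hp)
      nlinarith [mul_nonneg hga h3]
    · rw [cB_succ, G_neg]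
      have h1 := ih hg' hg1' (m+1)
      have h2 := mul_nonneg hga (ih hg' hg1' m)
      rw [pow_succ] at h1 ⊢
      nlinarith

lemma cB_odd (k : ℕ) : (fun n => cB (2*k) n - cE (2*k+1) n) = cB (2*k+1) := by
  ext n
  unfold cB cE
  rcases lt_trichotomy n (2*k+1) with h | h | h
  · rw [if_pos (by omega), if_neg (by omega), if_pos (by omega), sub_zero]
  · rw [if_neg (by omega), if_pos h, if_pos (by omega), h, pow_succ, pow_mul]; simp
  · rw [if_neg (by omega), if_neg (by omega), if_neg (by omega), sub_zero]

lemma bonf_even (P : Finset ℕ) (g : ℕ → ℝ) (hg : ∀ p ∈ P, 0 ≤ g p)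
    (hg1 : ∀ p ∈ P, g p ≤ 1) (k : ℕ) :
    ∏ p ∈ P, (1 - g p) ≤ G P g (cB (2*k)) := by
  have := bonf P g hg hg1 (2*k)
  rw [pow_mul] at this
  simp at this
  linarith

lemma bonf_odd (P : Finset ℕ) (g : ℕ → ℝ) (hg : ∀ p ∈ P, 0 ≤ g p)
    (hg1 : ∀ p ∈ P, g p ≤ 1) (k : ℕ) :
    G P g (cB (2*k)) - ∏ p ∈ P, (1 - g p) ≤ G P g (cE (2*k+1)) := by
  have := bonf P g hg hg1 (2*k+1)
  rw [← cB_odd, G_sub, pow_succ, pow_mul] at this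
  simp at this
  linarith

lemma G_B_one (P : Finset ℕ) (g : ℕ → ℝ) :
    G P g (cB 1) = 1 - ∑ p ∈ P, g p := by
  induction P using Finset.induction_on with
  | empty => rw [G_empty]; simp [cB]
  | insert a P ha ih =>
    rw [G_insert ha, cB_succ, G_neg, G_B_zero, ih, Finset.sum_insert ha]; ring

lemma G_B_two (P : Finset ℕ) (g : ℕ → ℝ) :
    G P g (cB 2) = 1 - ∑ p ∈ P, g p + ((∑ p ∈ P, g p)^2 - ∑ p ∈ P, (g p)^2) / 2 := by
  induction P using Finset.induction_on with
  | empty => rw [G_empty]; simp [cB]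
  | insert a P ha ih =>
    rw [G_insert ha, cB_succ, G_neg, G_B_one, ih, Finset.sum_insert ha, Finset.sum_insert ha]; ring

lemma exp_aux : Real.exp (-1.403) ≥ 1 / 4.1 := by
  have h1 : Real.exp 0.403 ≤ 1.4964 := by
    refine (Real.exp_bound' (by norm_num) (by norm_num) (n := 6) (by norm_num)).trans ?_
    simp [Finset.sum_range_succ, Nat.factorial]
    norm_num
  have h2 := Real.exp_one_lt_d9
  have h3 : Real.exp 1.403 ≤ 4.1 := by
    rw [show (1.403:ℝ) = 1 + 0.403 by norm_num, Real.exp_add]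
    have := Real.exp_pos 0.403
    nlinarith
  rw [Real.exp_neg, ← one_div]
  exact one_div_le_one_div_of_le (Real.exp_pos _) h3

lemma V_lower (P : Finset ℕ) (g : ℕ → ℝ) (hg : ∀ p ∈ P, 0 ≤ g p)
    (hg1 : ∀ p ∈ P, g p ≤ 0.002) (ht : ∑ p ∈ P, g p ≤ 1.4) :
    1 / 4.1 ≤ ∏ p ∈ P, (1 - g p) := by
  have h1 : ∏ p ∈ P, Real.exp (-(1000/998 * g p)) ≤ ∏ p ∈ P, (1 - g p) := by
    apply Finset.prod_le_prod (fun p _ => (Real.exp_pos _).le)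
    intro p hp
    have h0 := hg p hp
    have h1 := hg1 p hp
    rw [Real.exp_neg]
    apply inv_le_of_inv_le₀ (by linarith)
    refine le_trans ?_ (Real.add_one_le_exp _)
    rw [inv_le_iff_one_le_mul₀ (by linarith)]
    nlinarith
  refine le_trans ?_ h1
  rw [← Real.exp_sum, Finset.sum_neg_distrib, ← Finset.mul_sum]
  refine le_trans exp_aux (Real.exp_le_exp.2 ?_)
  linarith

/-- loss ratio in block `i` -/
noncomputable def qq (i : ℕ) : ℝ := if i = 0 then 0.8 else 0.185 * (1/20)^(i-1)

lemma qq_sum (r : ℕ) : ∑ i ∈ Finset.range r, qq i ≤ 0.995 := by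
  rcases r with _ | r
  · norm_num
  have : ∑ i ∈ Finset.range (r+1), qq i = 0.8 + 0.185 * (20/19) * (1 - (1/20)^r) := by
    induction r with
    | zero => simp [qq]
    | succ r ih => rw [Finset.sum_range_succ, ih]; simp [qq, pow_succ]; ring
  rw [this]
  have : (0:ℝ) < (1/20)^r := by positivity
  linarith

lemma fact_bound (t : ℝ) (h0 : 0 ≤ t) (h1 : t ≤ 1.4) (i : ℕ) :
    t ^ (2*(i+2)+1) / ((2*(i+2)+1).factorial : ℝ) ≤ 0.0449 * (1/20)^i := by
  have : t ^ (2*(i+2)+1) / ((2*(i+2)+1).factorial : ℝ) ≤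
      1.4 ^ (2*(i+2)+1) / ((2*(i+2)+1).factorial : ℝ) := by gcongr
  refine this.trans ?_
  clear this
  induction i with
  | zero => norm_num [Nat.factorial]
  | succ i ih =>
    have e : (2*(i+1+2)+1) = (2*(i+2)+1) + 1 + 1 := by ring
    have e2 : ∀ m : ℕ, (1.4:ℝ) ^ (m+1+1) / ((m+1+1).factorial : ℝ)
      = (1.4 ^ m / (m.factorial : ℝ)) * (1.96 / (((m:ℝ)+1+1) * (m+1))) := by
      intro m
      rw [Nat.factorial_succ, Nat.factorial_succ, pow_succ, pow_succ]
      push_cast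
      field_simp; norm_num
    rw [e, e2, pow_succ (1/20 : ℝ) i, ← mul_assoc]
    apply mul_le_mul ih _ (by positivity) (by positivity)
    have hi : (0:ℝ) ≤ i := by positivity
    rw [div_le_div_iff₀ (by positivity) (by norm_num)]
    push_cast
    nlinarith

lemma block_ratio (P : Finset ℕ) (g : ℕ → ℝ) (hg : ∀ p ∈ P, 0 ≤ g p)
    (hg1 : ∀ p ∈ P, g p ≤ 0.002) (ht : ∑ p ∈ P, g p ≤ 1.4) (i : ℕ) :
    G P g (cE (2*(i+1)+1)) ≤ qq i * G P g (cB (2*(i+1))) := by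
  have hg1' : ∀ p ∈ P, g p ≤ 1 := fun p hp => (hg1 p hp).trans (by norm_num)
  have ht0 : 0 ≤ ∑ p ∈ P, g p := Finset.sum_nonneg hg
  refine (G_E_le P g hg _).trans ?_
  rcases i with _ | i
  · simp only [zero_add, mul_one, qq, if_true]
    rw [G_B_two]
    have h2 : ∑ p ∈ P, (g p)^2 ≤ 0.002 * ∑ p ∈ P, g p := by
      rw [Finset.mul_sum]
      apply Finset.sum_le_sum
      intro p hp
      have := hg p hp
      have := hg1 p hp
      nlinarith
    set t := ∑ p ∈ P, g p
    have h3 : t^3/6 ≤ 0.8 * (1 - 1.001 * t + t^2/2) := by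
      nlinarith [mul_nonneg (sub_nonneg.2 ht) ht0, mul_nonneg (sub_nonneg.2 ht) (sq_nonneg t),
        mul_nonneg (sub_nonneg.2 ht) (sq_nonneg (t-0.5))]
    norm_num [Nat.factorial] at h3 ⊢
    linarith
  · have h1 := fact_bound _ ht0 ht i
    have h2 := (V_lower P g hg hg1 ht).trans (bonf_even P g hg hg1' (i+1+1))
    refine h1.trans ?_
    simp only [qq]
    rw [if_neg (by omega)]
    have h3 : (0:ℝ) < (1/20)^i := by positivity
    simp only [Nat.add_sub_cancel]
    have h4 : 0.185 * (1/20:ℝ)^i * (1/4.1) ≤ 0.185 * (1/20:ℝ)^i * G P g (cB (2*(i+1+1))) := by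
      gcongr
    refine le_trans ?_ h4
    nlinarith

lemma prod_diff {ι : Type*} [DecidableEq ι] (s : Finset ι) (a b c : ι → ℝ)
    (ha : ∀ i, 0 ≤ a i) (hab : ∀ i, a i ≤ b i) (hc : ∀ i, b i - a i ≤ c i) :
    ∏ j ∈ s, b j - ∏ j ∈ s, a j ≤ ∑ i ∈ s, ∏ j ∈ s, (if j = i then c j else b j) := by
  induction s using Finset.induction_on with
  | empty => simp
  | insert x s hx ih =>
    rw [Finset.prod_insert hx, Finset.prod_insert hx, Finset.sum_insert hx, Finset.prod_insert hx]
    rw [if_pos rfl]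
    have e1 : ∏ j ∈ s, (if j = x then c j else b j) = ∏ j ∈ s, b j := by
      apply Finset.prod_congr rfl
      intro j hj
      rw [if_neg]; rintro rfl; exact hx hj
    have e2 : ∑ i ∈ s, ∏ j ∈ insert x s, (if j = i then c j else b j) =
        b x * ∑ i ∈ s, ∏ j ∈ s, (if j = i then c j else b j) := by
      rw [Finset.mul_sum]
      apply Finset.sum_congr rfl
      intro i hi
      rw [Finset.prod_insert hx, if_neg]; rintro rfl; exact hx hi
    rw [e1, e2]
    have hb : ∀ i, 0 ≤ b i := fun i => (ha i).trans (hab i)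
    have h1 := mul_le_mul_of_nonneg_left ih (hb x)
    have h2 : ∏ j ∈ s, a j ≤ ∏ j ∈ s, b j := Finset.prod_le_prod (fun i _ => ha i) (fun i _ => hab i)
    have h3 : 0 ≤ ∏ j ∈ s, a j := Finset.prod_nonneg (fun i _ => ha i)
    have h4 := mul_le_mul_of_nonneg_right (hc x) h3
    have h5 := mul_le_mul_of_nonneg_left h2 ((sub_nonneg.2 (hab x)).trans (hc x))
    nlinarith

end BrunTwins
namespace BrunTwins
open Finset

/-- indicator of `k` lying in one of the two removed classes mod `p` -/
noncomputable def chi (r1 r2 : ℕ → ℕ) (k p : ℕ) : ℝ :=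
  if k ≡ r1 p [MOD p] ∨ k ≡ r2 p [MOD p] then 1 else 0

lemma count_base (K m c : ℕ) (hm : 0 < m) :
    |∑ k ∈ Finset.range K, (if k ≡ c [MOD m] then (1:ℝ) else 0) - K / m| ≤ 1 := by
  have h1 : ∑ k ∈ Finset.range K, (if k ≡ c [MOD m] then (1:ℝ) else 0)
      = (Nat.count (fun x => x ≡ c [MOD m]) K : ℝ) := by
    rw [Finset.sum_boole, Nat.count_eq_card_filter_range]
  rw [h1, Nat.count_modEq_card K hm c]
  have hm' : (0:ℝ) < m := by exact_mod_cast hm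
  have h2 : ((K / m : ℕ) : ℝ) ≤ (K:ℝ) / m := Nat.cast_div_le
  have h3 : (K:ℝ) / m < ((K / m : ℕ) : ℝ) + 1 := by
    rw [← Nat.floor_div_eq_div (K := ℝ)]
    exact Nat.lt_floor_add_one _
  rw [abs_le]
  push_cast
  split_ifs <;> constructor <;> linarith

lemma count_lemma (r1 r2 : ℕ → ℕ) (U : Finset ℕ) (hU : ∀ p ∈ U, p.Prime)
    (hr : ∀ p ∈ U, ¬ r1 p ≡ r2 p [MOD p]) (K m c : ℕ) (hm : 0 < m)
    (hcop : ∀ p ∈ U, Nat.Coprime m p) :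
    |∑ k ∈ Finset.range K, ((if k ≡ c [MOD m] then (1:ℝ) else 0) * ∏ p ∈ U, chi r1 r2 k p)
      - K / m * ∏ p ∈ U, (2 / (p:ℝ))| ≤ ∏ _p ∈ U, (2:ℝ) := by
  induction U using Finset.induction_on generalizing m c with
  | empty => simpa using count_base K m c hm
  | insert q U hq ih =>
    have hqp : q.Prime := hU q (Finset.mem_insert_self _ _)
    have hmq : Nat.Coprime m q := hcop q (Finset.mem_insert_self _ _)
    have hrq := hr q (Finset.mem_insert_self _ _)
    have hcop' : ∀ p ∈ U, Nat.Coprime (m * q) p := by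
      intro p hp
      apply Nat.Coprime.mul_left (hcop p (Finset.mem_insert_of_mem hp))
      rw [Nat.coprime_primes hqp (hU p (Finset.mem_insert_of_mem hp))]
      rintro rfl; exact hq hp
    have IH := fun c' => ih (fun p hp => hU p (Finset.mem_insert_of_mem hp))
      (fun p hp => hr p (Finset.mem_insert_of_mem hp)) (m*q) c' (Nat.mul_pos hm hqp.pos) hcop'
    have key : ∀ a : ℕ, ∃ c' : ℕ, ∀ k : ℕ,
        (if k ≡ c [MOD m] then (1:ℝ) else 0) * (if k ≡ a [MOD q] then (1:ℝ) else 0)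
          = if k ≡ c' [MOD (m*q)] then (1:ℝ) else 0 := by
      intro a
      obtain ⟨c', h1, h2⟩ := Nat.chineseRemainder hmq c a
      refine ⟨c', fun k => ?_⟩
      have : k ≡ c' [MOD (m*q)] ↔ (k ≡ c [MOD m] ∧ k ≡ a [MOD q]) := by
        rw [← Nat.modEq_and_modEq_iff_modEq_mul hmq]
        exact ⟨fun h => ⟨h.1.trans h1, h.2.trans h2⟩, fun h => ⟨h.1.trans h1.symm, h.2.trans h2.symm⟩⟩
      simp only [this]
      by_cases h1 : k ≡ c [MOD m] <;> by_cases h2 : k ≡ a [MOD q] <;> simp [h1, h2]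
    obtain ⟨c1, hc1⟩ := key (r1 q)
    obtain ⟨c2, hc2⟩ := key (r2 q)
    have hchi : ∀ k, chi r1 r2 k q =
        (if k ≡ r1 q [MOD q] then (1:ℝ) else 0) + (if k ≡ r2 q [MOD q] then (1:ℝ) else 0) := by
      intro k
      unfold chi
      by_cases h1 : k ≡ r1 q [MOD q] <;> by_cases h2 : k ≡ r2 q [MOD q] <;> simp [h1, h2]
      exact hrq (h1.symm.trans h2)
    have e1 : ∑ k ∈ Finset.range K, ((if k ≡ c [MOD m] then (1:ℝ) else 0) *
        ∏ p ∈ insert q U, chi r1 r2 k p) =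
        ∑ k ∈ Finset.range K, ((if k ≡ c1 [MOD (m*q)] then (1:ℝ) else 0) * ∏ p ∈ U, chi r1 r2 k p)
        + ∑ k ∈ Finset.range K, ((if k ≡ c2 [MOD (m*q)] then (1:ℝ) else 0) * ∏ p ∈ U, chi r1 r2 k p) := by
      rw [← Finset.sum_add_distrib]
      apply Finset.sum_congr rfl
      intro k _
      rw [Finset.prod_insert hq, hchi, ← hc1, ← hc2]
      ring
    rw [e1, Finset.prod_insert hq, Finset.prod_insert hq]
    have hm' : (0:ℝ) < m := by exact_mod_cast hm
    have hq' : (0:ℝ) < q := by exact_mod_cast hqp.pos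
    have e2 : (K:ℝ) / m * (2 / q * ∏ p ∈ U, (2 / (p:ℝ))) =
      K / ((m * q : ℕ) : ℝ) * ∏ p ∈ U, (2 / (p:ℝ)) + K / ((m * q : ℕ) : ℝ) * ∏ p ∈ U, (2 / (p:ℝ)) := by
      push_cast; field_simp; ring
    rw [e2]
    have h1 := abs_le.1 (IH c1)
    have h2 := abs_le.1 (IH c2)
    rw [abs_le]
    constructor <;> linarith [h1.1, h1.2, h2.1, h2.2]

lemma G_prod {r : ℕ} (P : Fin r → Finset ℕ) (g : ℕ → ℝ) (c : Fin r → ℕ → ℝ) :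
    ∏ j, G (P j) g (c j) = ∑ σ ∈ Fintype.piFinset (fun j => (P j).powerset),
      (∏ j, c j (σ j).card) * ∏ j, ∏ p ∈ σ j, g p := by
  unfold G
  rw [Finset.prod_univ_sum]
  apply Finset.sum_congr rfl
  intro σ _
  rw [Finset.prod_mul_distrib]

lemma equidist {r : ℕ} (P : Fin r → Finset ℕ) (hP : ∀ j, ∀ p ∈ P j, p.Prime)
    (hdisj : ∀ i j, i ≠ j → Disjoint (P i) (P j))
    (r1 r2 : ℕ → ℕ) (hr : ∀ j, ∀ p ∈ P j, ¬ r1 p ≡ r2 p [MOD p]) (K : ℕ)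
    (c : Fin r → ℕ → ℝ) :
    |∑ k ∈ Finset.range K, ∏ j, G (P j) (chi r1 r2 k) (c j)
      - K * ∏ j, G (P j) (fun p => 2 / (p:ℝ)) (c j)| ≤
    ∏ j, G (P j) (fun _ => 2) (fun n => |c j n|) := by
  simp only [G_prod]
  rw [Finset.sum_comm, Finset.mul_sum, ← Finset.sum_sub_distrib]
  refine (Finset.abs_sum_le_sum_abs _ _).trans ?_
  apply Finset.sum_le_sum
  intro σ hσ
  rw [Fintype.mem_piFinset] at hσ
  have hσ' : ∀ j, σ j ⊆ P j := fun j => Finset.mem_powerset.1 (hσ j)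
  rw [← Finset.mul_sum]
  have hd : Set.PairwiseDisjoint (↑(Finset.univ : Finset (Fin r))) σ := by
    intro i _ j _ hij
    exact Finset.disjoint_of_subset_left (hσ' i) (Finset.disjoint_of_subset_right (hσ' j) (hdisj i j hij))
  have hbi : ∀ f : ℕ → ℝ, ∏ j, ∏ p ∈ σ j, f p = ∏ p ∈ Finset.univ.biUnion σ, f p := by
    intro f
    rw [Finset.prod_biUnion hd]
  simp only [hbi]
  have h := count_lemma r1 r2 (Finset.univ.biUnion σ)
    (by intro p hp; obtain ⟨j, _, hj⟩ := Finset.mem_biUnion.1 hp; exact hP j p (hσ' j hj))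
    (by intro p hp; obtain ⟨j, _, hj⟩ := Finset.mem_biUnion.1 hp; exact hr j p (hσ' j hj))
    K 1 0 (by norm_num) (by intros; simp)
  simp only [Nat.modEq_one, if_true, one_mul, Nat.cast_one, div_one] at h
  rw [← Finset.abs_prod]
  have e : (∏ j, c j (σ j).card) * ∑ k ∈ Finset.range K, ∏ p ∈ Finset.univ.biUnion σ, chi r1 r2 k p
     - K * ((∏ j, c j (σ j).card) * ∏ p ∈ Finset.univ.biUnion σ, 2 / (p:ℝ))
    = (∏ j, c j (σ j).card) * (∑ k ∈ Finset.range K, ∏ p ∈ Finset.univ.biUnion σ, chi r1 r2 k p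
       - K * ∏ p ∈ Finset.univ.biUnion σ, 2 / (p:ℝ)) := by ring
  rw [e, abs_mul]
  exact mul_le_mul_of_nonneg_left h (abs_nonneg _)

/-- primes in `[u, u^2)` -/
def blk (u : ℕ) : Finset ℕ := (Finset.Ico u (u^2)).filter Nat.Prime

lemma blk_card (u : ℕ) (hu : 3 ≤ u) : 1 + 2 * (blk u).card ≤ u^2 := by
  have h : (blk u).card ≤ (Finset.Ico 1 ((u^2+1)/2)).card := by
    apply Finset.card_le_card_of_injOn (fun p => p / 2)
    · intro p hp
      simp only [blk, Finset.coe_filter, Finset.mem_Ico, Set.mem_ofPred_eq] at hp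
      have := hp.2.eq_two_or_odd
      simp only [Finset.coe_Ico, Set.mem_Ico]
      omega
    · intro p hp q hq hpq
      simp only [blk, Finset.coe_filter, Finset.mem_Ico, Set.mem_ofPred_eq] at hp hq
      have := hp.2.eq_two_or_odd
      have := hq.2.eq_two_or_odd
      simp only at hpq
      omega
  rw [Nat.card_Ico] at h
  have : 9 ≤ u^2 := by nlinarith
  omega

lemma blk_cover (w p : ℕ) (r : ℕ) (h1 : w ≤ p) (h2 : p < w ^ 2^r) :
    ∃ i < r, w ^ 2^i ≤ p ∧ p < (w ^ 2^i)^2 := by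
  induction r with
  | zero => simp at h2; omega
  | succ r ih =>
    by_cases h : p < w ^ 2^r
    · obtain ⟨i, hi, h'⟩ := ih h
      exact ⟨i, by omega, h'⟩
    · refine ⟨r, by omega, by omega, ?_⟩
      rwa [← pow_mul, ← pow_succ]

lemma exp_sum (r : ℕ) : ∑ i ∈ Finset.range r, 2*(i+1) * 2^(r-i) + 4*r + 8 = 8 * 2^r := by
  induction r with
  | zero => simp
  | succ r ih =>
    rw [Finset.sum_range_succ]
    have : ∑ i ∈ Finset.range r, 2*(i+1) * 2^(r+1-i) = 2 * ∑ i ∈ Finset.range r, 2*(i+1) * 2^(r-i) := by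
      rw [Finset.mul_sum]
      apply Finset.sum_congr rfl
      intro i hi
      have := Finset.mem_range.1 hi
      rw [show r + 1 - i = (r - i) + 1 by omega, pow_succ]; ring
    rw [this]
    simp
    rw [pow_succ]
    omega

theorem sieve (w : ℕ) (hw : 1000 ≤ w) (hM : ∀ u, w ≤ u → ∑ p ∈ blk u, (2:ℝ) / p ≤ 1.4)
    (r1 r2 : ℕ → ℕ) (hr : ∀ p, p.Prime → w ≤ p → ¬ r1 p ≡ r2 p [MOD p]) (r K : ℕ)
    (hK : (r + 1) * ((w:ℝ) ^ 2^r)^9 < K * (1/5)^r * 0.005) :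
    ∃ k < K, ∀ p, p.Prime → w ≤ p → p < w ^ 2^r →
      ¬ k ≡ r1 p [MOD p] ∧ ¬ k ≡ r2 p [MOD p] := by
  have hw1 : (1:ℝ) ≤ w := by exact_mod_cast (by omega : 1 ≤ w)
  set u : Fin r → ℕ := fun j => w ^ 2^(r - 1 - (j:ℕ)) with hu
  have huw : ∀ j, w ≤ u j := fun j => Nat.le_self_pow (by positivity) w
  have husq : ∀ j, (u j)^2 = w ^ 2^(r - (j:ℕ)) := by
    intro j
    have := j.2
    simp only [hu]
    rw [← pow_mul, ← pow_succ]; congr 2; omega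
  set P : Fin r → Finset ℕ := fun j => blk (u j) with hPdef
  have hmem : ∀ j p, p ∈ P j ↔ (u j ≤ p ∧ p < (u j)^2) ∧ p.Prime := by
    intro j p; simp [hPdef, blk]
  have hP : ∀ j, ∀ p ∈ P j, p.Prime := fun j p hp => ((hmem j p).1 hp).2
  have hPw : ∀ j, ∀ p ∈ P j, w ≤ p := fun j p hp => (huw j).trans ((hmem j p).1 hp).1.1
  have hlt : ∀ i j : Fin r, i < j → Disjoint (P i) (P j) := by
    intro i j hij
    rw [Finset.disjoint_left]
    intro p hi hj
    have h1 := ((hmem i p).1 hi).1.1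
    have h2 := ((hmem j p).1 hj).1.2
    rw [husq] at h2
    have h3 : w ^ 2^(r - (j:ℕ)) ≤ u i := by
      apply Nat.pow_le_pow_right (by omega)
      apply Nat.pow_le_pow_right (by omega)
      have : (i:ℕ) < j := hij
      omega
    omega
  have hdisj : ∀ i j, i ≠ j → Disjoint (P i) (P j) := by
    intro i j hij
    rcases lt_or_gt_of_ne hij with h | h
    · exact hlt i j h
    · exact (hlt j i h).symm
  have hrP : ∀ j, ∀ p ∈ P j, ¬ r1 p ≡ r2 p [MOD p] := fun j p hp => hr p (hP j p hp) (hPw j p hp)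
  set g : ℕ → ℝ := fun p => 2 / (p:ℝ) with hgdef
  have hg0 : ∀ j, ∀ p ∈ P j, 0 ≤ g p := fun j p _ => by simp only [hgdef]; positivity
  have hg1 : ∀ j, ∀ p ∈ P j, g p ≤ 0.002 := by
    intro j p hp
    have h1 : (1000:ℝ) ≤ p := by exact_mod_cast hw.trans (hPw j p hp)
    simp only [hgdef]
    rw [div_le_iff₀ (by linarith)]
    linarith
  have hg1' : ∀ j, ∀ p ∈ P j, g p ≤ 1 := fun j p hp => (hg1 j p hp).trans (by norm_num)
  have ht : ∀ j, ∑ p ∈ P j, g p ≤ 1.4 := fun j => hM (u j) (huw j)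
  set B : Fin r → ℝ := fun j => G (P j) g (cB (2*((j:ℕ)+1))) with hB
  have hBlow : ∀ j, 1/5 ≤ B j := by
    intro j
    refine le_trans ?_ ((V_lower (P j) g (hg0 j) (hg1 j) (ht j)).trans
      (bonf_even (P j) g (hg0 j) (hg1' j) _))
    norm_num
  have hB0 : ∀ j, 0 ≤ B j := fun j => le_trans (by norm_num) (hBlow j)
  have hBprod : (1/5:ℝ)^r ≤ ∏ j, B j := by
    have := Finset.prod_le_prod (s := (Finset.univ : Finset (Fin r))) (f := fun _ => (1/5:ℝ)) (g := B)
      (fun _ _ => by norm_num) (fun j _ => hBlow j)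
    simpa using this
  -- remainder bounds
  set z : ℝ := (w:ℝ) ^ 2^r with hz
  have hz1 : 1 ≤ z := one_le_pow₀ hw1
  set y : Fin r → ℝ := fun j => (w:ℝ) ^ 2^(r - (j:ℕ)) with hy
  have hy1 : ∀ j, 1 ≤ y j := fun j => one_le_pow₀ hw1
  have hyz : ∀ j, y j ≤ z := fun j =>
    pow_le_pow_right₀ hw1 (Nat.pow_le_pow_right (by norm_num) (by omega))
  have hA : ∀ j m, G (P j) (fun _ => 2) (cA m) ≤ (y j)^m := by
    intro j m
    refine (G_A_le (P j) _ (fun _ _ => by norm_num) m).trans ?_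
    apply pow_le_pow_left₀ (by positivity)
    have h1 := blk_card (u j) (by have := huw j; omega)
    rw [husq] at h1
    have h2 : ((1 + 2 * (blk (u j)).card : ℕ) : ℝ) ≤ ((w ^ 2^(r - (j:ℕ)) : ℕ) : ℝ) := by exact_mod_cast h1
    push_cast at h2
    simp only [Finset.sum_const, nsmul_eq_mul]
    linarith
  have hRB : ∀ j : Fin r, G (P j) (fun _ => 2) (fun n => |cB (2*((j:ℕ)+1)) n|) ≤ (y j)^(2*((j:ℕ)+1)) := by
    intro j
    refine le_trans (G_mono _ _ _ _ (fun _ _ => by norm_num) ?_) (hA j _)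
    intro n; unfold cB cA; split_ifs <;> simp
  have hRE : ∀ j : Fin r, G (P j) (fun _ => 2) (fun n => |cE (2*((j:ℕ)+1)+1) n|) ≤ (y j)^(2*((j:ℕ)+1)) * z := by
    intro j
    refine le_trans (G_mono _ _ _ _ (fun _ _ => by norm_num) ?_) ((hA j (2*((j:ℕ)+1)+1)).trans ?_)
    · intro n; unfold cE cA
      by_cases h : n = 2*((j:ℕ)+1)+1
      · simp [h]
      · rw [if_neg h]; split_ifs <;> simp
    · rw [pow_succ]
      exact mul_le_mul_of_nonneg_left (hyz j) (by have := hy1 j; positivity)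
  have hG0 : ∀ (j : Fin r) (c : ℕ → ℝ), 0 ≤ G (P j) (fun _ => 2) (fun n => |c n|) := by
    intro j c
    unfold G
    exact Finset.sum_nonneg fun S _ => mul_nonneg (abs_nonneg _) (by positivity)
  have hyprod : ∏ j : Fin r, (y j)^(2*((j:ℕ)+1)) ≤ z^8 := by
    have e : ∏ j : Fin r, (y j)^(2*((j:ℕ)+1)) = (w:ℝ)^(∑ i ∈ Finset.range r, 2*(i+1) * 2^(r-i)) := by
      rw [← Finset.prod_pow_eq_pow_sum, ← Fin.prod_univ_eq_prod_range (fun i => (w:ℝ)^(2*(i+1) * 2^(r-i)))]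
      apply Finset.prod_congr rfl
      intro j _
      simp only [hy]
      rw [← pow_mul, mul_comm]
    rw [e, hz, ← pow_mul]
    apply pow_le_pow_right₀ hw1
    have := exp_sum r
    omega
  set cc : Fin r → Fin r → ℕ → ℝ := fun i j =>
    if j = i then cE (2*((j:ℕ)+1)+1) else cB (2*((j:ℕ)+1)) with hcc
  have hR0 : ∏ j : Fin r, G (P j) (fun _ => 2) (fun n => |cB (2*((j:ℕ)+1)) n|) ≤ z^9 := by
    refine (Finset.prod_le_prod (fun j _ => hG0 j _) (fun j _ => hRB j)).trans (hyprod.trans ?_)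
    exact pow_le_pow_right₀ hz1 (by norm_num)
  have hRi : ∀ i, ∏ j : Fin r, G (P j) (fun _ => 2) (fun n => |cc i j n|) ≤ z^9 := by
    intro i
    have h1 : ∏ j : Fin r, G (P j) (fun _ => 2) (fun n => |cc i j n|) ≤
        ∏ j : Fin r, ((y j)^(2*((j:ℕ)+1)) * (if j = i then z else 1)) := by
      apply Finset.prod_le_prod (fun j _ => hG0 j _)
      intro j _
      simp only [hcc]
      by_cases h : j = i
      · simp only [h, if_true]; exact hRE i
      · simp only [h, if_false, mul_one]; exact hRB j
    refine h1.trans ?_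
    rw [Finset.prod_mul_distrib, Finset.prod_ite_eq' Finset.univ i, if_pos (Finset.mem_univ _), pow_succ]
    exact mul_le_mul_of_nonneg_right hyprod (by linarith)
  have hMi : ∀ i : Fin r, ∏ j, G (P j) g (cc i j) ≤ qq i * ∏ j, B j := by
    intro i
    have h1 : ∏ j, G (P j) g (cc i j) ≤ ∏ j, ((if j = i then qq i else 1) * B j) := by
      apply Finset.prod_le_prod
      · intro j _
        simp only [hcc]
        by_cases h : j = i
        · simp only [h, if_true]; exact G_E_nonneg _ _ (hg0 i) _
        · simp only [h, if_false]; exact hB0 j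
      · intro j _
        simp only [hcc]
        by_cases h : j = i
        · simp only [h, if_true]; exact block_ratio (P i) g (hg0 i) (hg1 i) (ht i) i
        · simp only [h, if_false, one_mul]; exact le_rfl
    refine h1.trans ?_
    rw [Finset.prod_mul_distrib, Finset.prod_ite_eq' Finset.univ i (fun _ => qq i), if_pos (Finset.mem_univ _)]
  have hq : ∑ i : Fin r, qq i ≤ 0.995 := by
    rw [Fin.sum_univ_eq_sum_range]; exact qq_sum r
  have hchi0 : ∀ k p, 0 ≤ chi r1 r2 k p := by intro k p; unfold chi; split_ifs <;> norm_num
  have hchi1 : ∀ k p, chi r1 r2 k p ≤ 1 := by intro k p; unfold chi; split_ifs <;> norm_num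
  by_contra hcon
  push Not at hcon
  have hzero : ∀ k ∈ Finset.range K, ∏ j, ∏ p ∈ P j, (1 - chi r1 r2 k p) = 0 := by
    intro k hk
    obtain ⟨p, hp, hwp, hpz, himp⟩ := hcon k (Finset.mem_range.1 hk)
    obtain ⟨i, hi, h1, h2⟩ := blk_cover w p r hwp hpz
    have hj : r - 1 - (r - 1 - i) = i := by omega
    apply Finset.prod_eq_zero (Finset.mem_univ (⟨r - 1 - i, by omega⟩ : Fin r))
    apply Finset.prod_eq_zero (i := p)
    · rw [hmem]; simp only [hu, hj]; exact ⟨⟨h1, h2⟩, hp⟩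
    · have : k ≡ r1 p [MOD p] ∨ k ≡ r2 p [MOD p] := by tauto
      simp [chi, this]
  have hpt : ∀ k ∈ Finset.range K, ∏ j, G (P j) (chi r1 r2 k) (cB (2*((j:ℕ)+1))) ≤
      ∑ i, ∏ j, G (P j) (chi r1 r2 k) (cc i j) := by
    intro k hk
    have h := prod_diff (Finset.univ : Finset (Fin r)) (fun j => ∏ p ∈ P j, (1 - chi r1 r2 k p))
      (fun j => G (P j) (chi r1 r2 k) (cB (2*((j:ℕ)+1))))
      (fun j => G (P j) (chi r1 r2 k) (cE (2*((j:ℕ)+1)+1)))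
      (fun j => Finset.prod_nonneg fun p _ => sub_nonneg.2 (hchi1 k p))
      (fun j => bonf_even _ _ (fun p _ => hchi0 k p) (fun p _ => hchi1 k p) _)
      (fun j => bonf_odd _ _ (fun p _ => hchi0 k p) (fun p _ => hchi1 k p) _)
    rw [hzero k hk, sub_zero] at h
    refine h.trans (le_of_eq ?_)
    apply Finset.sum_congr rfl
    intro i _
    apply Finset.prod_congr rfl
    intro j _
    simp only [hcc]
    split_ifs <;> rfl
  have hsum := Finset.sum_le_sum hpt
  rw [Finset.sum_comm] at hsum
  have hlow := (abs_le.1 (equidist P hP hdisj r1 r2 hrP K (fun j => cB (2*((j:ℕ)+1))))).1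
  have hup : ∀ i ∈ (Finset.univ : Finset (Fin r)),
      ∑ k ∈ Finset.range K, ∏ j, G (P j) (chi r1 r2 k) (cc i j) ≤
      K * (qq i * ∏ j, B j) + z^9 := by
    intro i _
    have h1 := (abs_le.1 (equidist P hP hdisj r1 r2 hrP K (cc i))).2
    have h2 := mul_le_mul_of_nonneg_left (hMi i) (Nat.cast_nonneg (α := ℝ) K)
    have h3 := hRi i
    linarith
  have hup' := Finset.sum_le_sum hup
  rw [Finset.sum_add_distrib, ← Finset.mul_sum, ← Finset.sum_mul] at hup'
  simp only [Finset.sum_const, Finset.card_univ, Fintype.card_fin, nsmul_eq_mul] at hup'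
  have hKB : (K:ℝ) * (1/5)^r ≤ K * ∏ j, B j :=
    mul_le_mul_of_nonneg_left hBprod (Nat.cast_nonneg _)
  have hKB0 : 0 ≤ (K:ℝ) * ∏ j, B j := mul_nonneg (Nat.cast_nonneg _) (Finset.prod_nonneg fun j _ => hB0 j)
  have hqK := mul_le_mul_of_nonneg_right hq hKB0
  have hlow' : (K:ℝ) * ∏ j, B j - z^9 ≤
      ∑ k ∈ Finset.range K, ∏ j, G (P j) (chi r1 r2 k) (cB (2*((j:ℕ)+1))) := by
    have : ∏ j, B j = ∏ j, G (P j) (fun p => 2 / (p:ℝ)) (cB (2*((j:ℕ)+1))) := rfl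
    rw [this]
    linarith
  linarith

lemma omega_le (z n : ℕ) (hz : 2 ≤ z) (hn : n < z^10) (h : ∀ p, p.Prime → p ∣ n → z ≤ p) (hn0 : n ≠ 0) :
    n.primeFactorsList.length ≤ 9 := by
  by_contra hc
  push Not at hc
  have h1 := List.pow_card_le_prod n.primeFactorsList z (fun p hp =>
    h p (Nat.prime_of_mem_primeFactorsList hp) (Nat.dvd_of_mem_primeFactorsList hp))
  rw [Nat.prod_primeFactorsList hn0] at h1
  have h2 : z^10 ≤ z^n.primeFactorsList.length := Nat.pow_le_pow_right (by omega) hc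
  omega

lemma exists_root (p Q a : ℕ) (hp : p.Prime) (hQ : ¬ p ∣ Q) : ∃ x, p ∣ x * Q + a := by
  have hc : Nat.Coprime p Q := (Nat.Prime.coprime_iff_not_dvd hp).2 hQ
  obtain ⟨y, h1, h2⟩ := Nat.chineseRemainder hc (a * (p-1)) 0
  obtain ⟨x, rfl⟩ := (Nat.modEq_zero_iff_dvd).1 h2
  refine ⟨x, ?_⟩
  rw [← Nat.modEq_zero_iff_dvd, mul_comm x]
  refine (h1.add_right a).trans ?_
  rw [Nat.modEq_zero_iff_dvd]
  refine ⟨a, ?_⟩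
  obtain ⟨m, rfl⟩ : ∃ m, p = m + 1 := ⟨p - 1, by have := hp.pos; omega⟩
  simp; ring

lemma root_unique (p Q a x k : ℕ) (hp : p.Prime) (hQ : ¬ p ∣ Q) (hx : p ∣ x * Q + a)
    (hk : p ∣ k * Q + a) : k ≡ x [MOD p] := by
  have hc : Nat.Coprime p Q := (Nat.Prime.coprime_iff_not_dvd hp).2 hQ
  have h1 : k * Q + a ≡ x * Q + a [MOD p] :=
    ((Nat.modEq_zero_iff_dvd).2 hk).trans ((Nat.modEq_zero_iff_dvd).2 hx).symm
  exact Nat.ModEq.cancel_right_of_coprime hc (Nat.ModEq.add_right_cancel' a h1)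

end BrunTwins

/-- Brun's theorem on almost-twin primes: there are infinitely many `n > 1`
such that both `n` and `n + 2` have at most nine prime factors counted with
multiplicity. -/
theorem brun_almost_twins :
    ∀ N : ℕ, ∃ n : ℕ, N < n ∧ 1 < n ∧
      n.primeFactorsList.length ≤ 9 ∧ (n + 2).primeFactorsList.length ≤ 9 := by
  classical
  intro N
  obtain ⟨w₀, hw₀⟩ := BrunTwins.mertens_block
  set w := max w₀ 1000 with hwdef
  have hw : 1000 ≤ w := le_max_right _ _
  have hM : ∀ u, w ≤ u → ∑ p ∈ BrunTwins.blk u, (2:ℝ) / p ≤ 1.4 :=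
    fun u hu => hw₀ u ((le_max_left _ _).trans hu)
  clear_value w
  set Q := (w-1).factorial with hQ
  have hQ3 : 3 ≤ Q := by
    have := Nat.self_le_factorial (w-1)
    omega
  have hdvd : ∀ p, p.Prime → (p ∣ Q ↔ p < w) := by
    intro p hp
    rw [hQ, hp.dvd_factorial]; omega
  clear_value Q
  have hroots : ∀ a : ℕ, ∃ f : ℕ → ℕ, ∀ p, p.Prime → w ≤ p → p ∣ f p * Q + a := by
    intro a
    have : ∀ p, ∃ x, p.Prime → w ≤ p → p ∣ x * Q + a := by
      intro p
      by_cases h : p.Prime ∧ w ≤ p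
      · obtain ⟨x, hx⟩ := BrunTwins.exists_root p Q a h.1 (by rw [hdvd p h.1]; omega)
        exact ⟨x, fun _ _ => hx⟩
      · exact ⟨0, fun h1 h2 => absurd ⟨h1, h2⟩ h⟩
    choose f hf using this
    exact ⟨f, hf⟩
  obtain ⟨r1, hr1⟩ := hroots (Q-1)
  obtain ⟨r2, hr2⟩ := hroots (Q+1)
  have hr : ∀ p, p.Prime → w ≤ p → ¬ r1 p ≡ r2 p [MOD p] := by
    intro p hp hwp heq
    have h1 := hr1 p hp hwp
    have h2 := hr2 p hp hwp
    have h3 : p ∣ r1 p * Q + (Q+1) := by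
      rw [← Nat.modEq_zero_iff_dvd] at h2 ⊢
      exact ((heq.mul_right Q).add_right (Q+1)).trans h2
    have h4 : r1 p * Q + (Q+1) = (r1 p * Q + (Q-1)) + 2 := by omega
    rw [h4, Nat.dvd_add_right h1] at h3
    have := Nat.le_of_dvd (by norm_num) h3
    omega
  set r := 1000 * Q + 1 + N with hrdef
  set z := w ^ 2^r with hz
  have hz20 : 20^r * 20^r ≤ z := by
    have h2r : r + r ≤ 2^r := by
      obtain ⟨m, hm⟩ : ∃ m, r = m + 1 := ⟨r - 1, by omega⟩
      rw [hm, pow_succ]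
      have := Nat.lt_two_pow_self (n := m)
      omega
    rw [← pow_add]
    calc 20^(r+r) ≤ 20^(2^r) := Nat.pow_le_pow_right (by norm_num) h2r
      _ ≤ w^(2^r) := Nat.pow_le_pow_left (by omega) _
  have h20r : r < 20^r := Nat.lt_pow_self (by norm_num)
  have hMz : 1000 * 20^r * Q + 1 ≤ z := by
    have : 20^r * (1000*Q+1) ≤ 20^r * 20^r := Nat.mul_le_mul_left _ (by omega)
    nlinarith
  have hNz : N < z := by nlinarith
  have hz2 : 2 ≤ z := by nlinarith
  set K := z^9 * (1000 * 20^r) with hK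
  have hzR : (z:ℝ) = (w:ℝ)^2^r := by rw [hz]; push_cast; rfl
  have hKcond : ((r:ℝ) + 1) * ((w:ℝ) ^ 2^r)^9 < K * (1/5)^r * 0.005 := by
    rw [← hzR, hK]
    push_cast
    have h1 : (z:ℝ)^9 * (1000 * 20^r) * (1/5)^r * 0.005 = 5 * 4^r * (z:ℝ)^9 := by
      rw [show (20:ℝ) = 4 * 5 by norm_num, mul_pow]
      have h0 : (5:ℝ)^r * (1/5)^r = 1 := by rw [← mul_pow]; norm_num
      calc (z:ℝ)^9 * (1000 * (4^r * 5^r)) * (1/5)^r * 0.005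
          = 5 * 4^r * (z:ℝ)^9 * (5^r * (1/5)^r) := by ring
        _ = _ := by rw [h0, mul_one]
    rw [h1]
    have h2 : (0:ℝ) < (z:ℝ)^9 := by
      have : (0:ℝ) < z := by exact_mod_cast (by omega : 0 < z)
      positivity
    apply mul_lt_mul_of_pos_right _ h2
    have h3 : r < 4^r := Nat.lt_pow_self (by norm_num)
    have h4 : (r:ℝ) < 4^r := by exact_mod_cast h3
    have h5 : (1:ℝ) ≤ 4^r := one_le_pow₀ (by norm_num)
    linarith
  obtain ⟨k, hkK, hk⟩ := BrunTwins.sieve w hw hM r1 r2 hr r K hKcond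
  have hlt : k * Q + (Q + 1) < z^10 := by
    have h1 : (k+1) * Q ≤ K * Q := Nat.mul_le_mul_right _ hkK
    have h2 : K * Q = z^9 * (1000 * 20^r * Q) := by rw [hK]; ring
    have h3 : z^9 * (1000 * 20^r * Q + 1) ≤ z^9 * z := Nat.mul_le_mul_left _ hMz
    have h4 : 1 < z^9 := Nat.one_lt_pow (by norm_num) (by omega)
    have h5 : z^10 = z^9 * z := pow_succ _ _
    rw [h5]
    nlinarith
  have hnotQ : ∀ p, p.Prime → w ≤ p → ¬ p ∣ Q := fun p hp h => by rw [hdvd p hp]; omega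
  have hf1 : ∀ p, p.Prime → p ∣ k * Q + (Q-1) → z ≤ p := by
    intro p hp hd
    by_contra hc
    push Not at hc
    by_cases hwp : w ≤ p
    · exact (hk p hp hwp hc).1 (BrunTwins.root_unique p Q (Q-1) _ _ hp (hnotQ p hp hwp) (hr1 p hp hwp) hd)
    · have h1 : p ∣ Q := (hdvd p hp).2 (by omega)
      have h2 : p ∣ k * Q + (Q-1) + 1 := by
        rw [show k * Q + (Q-1) + 1 = (k+1) * Q by rw [add_mul]; omega]
        exact h1.mul_left _
      rw [Nat.dvd_add_right hd] at h2
      exact hp.one_lt.ne' (Nat.dvd_one.1 h2)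
  have hf2 : ∀ p, p.Prime → p ∣ k * Q + (Q+1) → z ≤ p := by
    intro p hp hd
    by_contra hc
    push Not at hc
    by_cases hwp : w ≤ p
    · exact (hk p hp hwp hc).2 (BrunTwins.root_unique p Q (Q+1) _ _ hp (hnotQ p hp hwp) (hr2 p hp hwp) hd)
    · have h1 : p ∣ Q := (hdvd p hp).2 (by omega)
      have h2 : p ∣ (k+1) * Q := h1.mul_left _
      rw [show k * Q + (Q+1) = (k+1) * Q + 1 by ring, Nat.dvd_add_right h2] at hd
      exact hp.one_lt.ne' (Nat.dvd_one.1 hd)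
  have hn1 : 1 < k * Q + (Q-1) := by
    have := Nat.zero_le (k * Q); omega
  refine ⟨k * Q + (Q-1), ?_, hn1, ?_, ?_⟩
  · obtain ⟨p, hp, hd⟩ := Nat.exists_prime_and_dvd hn1.ne'
    have h1 := hf1 p hp hd
    have h2 := Nat.le_of_dvd (by omega) hd
    omega
  · exact BrunTwins.omega_le z _ hz2 (by omega) hf1 (by omega)
  · rw [show k * Q + (Q-1) + 2 = k * Q + (Q+1) by omega]
    exact BrunTwins.omega_le z _ hz2 hlt hf2 (by omega)
end
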